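/- Let 1 ≤ q₁, q₂ ≤ ∞ and 0 < r < ∞ with 1/r = 1/q₁ + 1/q₂. Suppose a ∈ S^m_{ρ,δ}(n,2) with 0 < ρ, δ ≤ 1, δ < 1, and m < n(ρ−1)[ max(|1/2 − 1/q₁|, |1/2 − 1/q₂|) + 1/min(2, q₁, q₂) ] + n·min(ρ−δ, 0)/2. Then the bilinear pseudodifferential operator T_a(f,g)(x) = ∫∫ a(x,ξ,η) e^{i⟨x, ξ+η⟩} f̂(ξ) ĝ(η) dξ dη satisfies ‖T_a(f,g)‖_{L^r} ≤ C ‖f‖_{L^{q₁}} ‖g‖_{L^{q₂}} for all Schwartz f, g. -/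

import Mathlib

open MeasureTheory Real Complex
open scoped ENNReal NNReal RealInnerProductSpace SchwartzMap Classical

noncomputable section

/-- `ℝⁿ` as a Euclidean space. -/
abbrev En (n : ℕ) : Type := EuclideanSpace ℝ (Fin n)

/-- Partial derivative in the `i`-th coordinate direction. -/
def pd {n : ℕ} {F : Type} [NormedAddCommGroup F] [NormedSpace ℝ F]
    (i : Fin n) (f : En n → F) : En n → F :=
  fun x => fderiv ℝ f x (EuclideanSpace.single i 1)

/-- Multi-index partial derivative `∂^α`. -/
def mderiv {n : ℕ} {F : Type} [NormedAddCommGroup F] [NormedSpace ℝ F]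
    (α : Fin n → ℕ) (f : En n → F) : En n → F :=
  (List.finRange n).foldr (fun i g => (pd i)^[α i] g) f

/-- The order `|α|` of a multi-index. -/
def mdeg {n : ℕ} (α : Fin n → ℕ) : ℕ := ∑ i, α i

/-- The finite set of multi-indices `α` with every entry `≤ k` and `|α| ≤ k`;
this enumerates all multi-indices of order at most `k`. -/
def multiIdx (n k : ℕ) : Finset (Fin n → ℕ) :=
  (Fintype.piFinset fun _ : Fin n => Finset.range (k + 1)).filter fun α => mdeg α ≤ k

/-- Japanese bracket `⟨ξ⟩^t = (1+|ξ|²)^{t/2}`. -/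
def jb {n : ℕ} (ξ : En n) (t : ℝ) : ℝ := (1 + ‖ξ‖ ^ 2) ^ (t / 2)

/-- The rough amplitude class `L^p S^m_ρ`. -/
def LpSm {n : ℕ} (p : ℝ≥0∞) (m ρ : ℝ) (a : En n → En n → ℂ) : Prop :=
  (∀ x, ContDiff ℝ (⊤ : ℕ∞) (a x)) ∧
  (∀ (α : Fin n → ℕ) (ξ : En n), AEStronglyMeasurable (fun x => mderiv α (a x) ξ) volume) ∧
  ∀ α : Fin n → ℕ, ∃ C : ℝ, ∀ ξ : En n,
    eLpNorm (fun x => mderiv α (a x) ξ) p volume ≤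
      ENNReal.ofReal (C * jb ξ (m - ρ * (mdeg α : ℝ)))

/-- The seminorms `|a|_{p,m,s}` of an amplitude in `L^p S^m_ρ`. -/
def aSemi {n : ℕ} (p : ℝ≥0∞) (m ρ : ℝ) (s : ℕ) (a : En n → En n → ℂ) : ℝ≥0∞ :=
  ∑ α ∈ multiIdx n s, ⨆ ξ : En n,
    ENNReal.ofReal (jb ξ (ρ * (mdeg α : ℝ) - m)) *
      eLpNorm (fun x => mderiv α (a x) ξ) p volume

/-- The mixed derivative `∂_ξ^α ∂_x^β φ(x,ξ)`. -/
def mixedD {n : ℕ} (α β : Fin n → ℕ) (φ : En n → En n → ℝ) (x ξ : En n) : ℝ :=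
  mderiv α (fun ζ => mderiv β (fun y => φ y ζ) x) ξ

/-- The phase function class `Φ^k`. -/
def PhiClass {n : ℕ} (k : ℕ) (φ : En n → En n → ℝ) : Prop :=
  ContDiffOn ℝ (⊤ : ℕ∞) (fun q : En n × En n => φ q.1 q.2) {q | q.2 ≠ 0} ∧
  (∀ (x ξ : En n) (t : ℝ), 0 < t → φ x (t • ξ) = t * φ x ξ) ∧
  ∀ α β : Fin n → ℕ, k ≤ mdeg α + mdeg β →
    ∃ C : ℝ, ∀ (x ξ : En n), ξ ≠ 0 →
      ‖ξ‖ ^ ((mdeg α : ℝ) - 1) * |mixedD α β φ x ξ| ≤ C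

/-- The mixed Hessian matrix `[∂²φ/∂x_j∂ξ_k]`. -/
def mixHess {n : ℕ} (φ : En n → En n → ℝ) (x ξ : En n) : Matrix (Fin n) (Fin n) ℝ :=
  Matrix.of fun j k => pd j (fun y => pd k (φ y) ξ) x

/-- The strong non-degeneracy (SND) condition. -/
def SNDcond {n : ℕ} (φ : En n → En n → ℝ) : Prop :=
  ∃ c : ℝ, 0 < c ∧ ∀ (x ξ : En n), ξ ≠ 0 → c ≤ |(mixHess φ x ξ).det|

/-- The Fourier transform `f̂(ξ) = ∫ e^{-i⟨y,ξ⟩} f(y) dy`. -/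
def ft {n : ℕ} (f : En n → ℂ) (ξ : En n) : ℂ :=
  ∫ y : En n, Complex.exp (-(Complex.I * Complex.ofReal ⟪y, ξ⟫)) * f y

/-- The linear Fourier integral operator
`T_a f(x) = (2π)^{-n} ∫ e^{iφ(x,ξ)} a(x,ξ) f̂(ξ) dξ`. -/
def fio {n : ℕ} (a : En n → En n → ℂ) (φ : En n → En n → ℝ) (f : En n → ℂ)
    (x : En n) : ℂ :=
  (((2 * Real.pi) ^ n)⁻¹ : ℝ) •
    ∫ ξ : En n, Complex.exp (Complex.I * Complex.ofReal (φ x ξ)) * a x ξ * ft f ξ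

/-- The conjugate exponent `p′` of `p ∈ [1,∞]`. -/
def pconj (p : ℝ≥0∞) : ℝ≥0∞ := (1 - p⁻¹)⁻¹

/-- The order `𝔪(ρ,p,q)` from Definition 4.6. -/
def frakm (n : ℕ) (ρ : ℝ) (p q : ℝ≥0∞) : ℝ :=
  if p < 2 ∨ (2 ≤ p ∧ q < pconj p) then
    (n : ℝ) * (ρ - 1) * (min p q)⁻¹.toReal -
      (((n : ℝ) - 1) / 2) * (p⁻¹.toReal + (min p q)⁻¹.toReal)
  else if 2 ≤ q then
    (n : ℝ) * (ρ - 1) / 2 - ((n : ℝ) - 1) * (1 / 2 - q⁻¹.toReal)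
  else
    (n : ℝ) * (ρ - 1) * q⁻¹.toReal -
      (((n : ℝ) - 1) / (1 - 2 * p⁻¹.toReal)) * (q⁻¹.toReal - 1 / 2)

/-- The order `ℳ(ρ,p,q)` from Definition 4.6. -/
def scrM (n : ℕ) (ρ : ℝ) (p q : ℝ≥0∞) : ℝ :=
  (n : ℝ) * (ρ - 1) * q⁻¹.toReal -
    (((n : ℝ) - 1) / (1 + p⁻¹.toReal)) * (q⁻¹.toReal - 1 / 2)

/-- The distribution function `λ_f(s) = |{x : |f(x)| > s}|`. -/
def distFn {n : ℕ} (f : En n → ℂ) (s : ℝ) : ℝ≥0∞ := volume {x : En n | s < ‖f x‖}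

/-- The decreasing rearrangement `f*`. -/
def rearr {n : ℕ} (f : En n → ℂ) (t : ℝ) : ℝ :=
  sInf {s : ℝ | 0 ≤ s ∧ distFn f s ≤ ENNReal.ofReal t}

/-- The Lorentz space quasinorm
`‖f‖_{L^{r,q}} = (∫_0^∞ (t^{1/r} f*(t))^q dt/t)^{1/q}`. -/
def lorentzNorm {n : ℕ} (r q : ℝ≥0∞) (f : En n → ℂ) : ℝ≥0∞ :=
  (∫⁻ t in Set.Ioi (0 : ℝ),
      ENNReal.ofReal ((t ^ r⁻¹.toReal * rearr f t) ^ q.toReal / t)) ^ q⁻¹.toReal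

/-- Mixed frequency derivatives `∂_ξ^{α₁} ∂_η^{α₂} a(x,ξ,η)` of a bilinear amplitude. -/
def d2 {n : ℕ} (α₁ α₂ : Fin n → ℕ) (a : En n → En n → En n → ℂ)
    (x ξ η : En n) : ℂ :=
  mderiv α₁ (fun ζ => mderiv α₂ (fun θ => a x ζ θ) η) ξ

/-- Mixed derivatives `∂_x^β ∂_ξ^{α₁} ∂_η^{α₂} a(x,ξ,η)` of a bilinear amplitude. -/
def d3 {n : ℕ} (β α₁ α₂ : Fin n → ℕ) (a : En n → En n → En n → ℂ)
    (x ξ η : En n) : ℂ :=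
  mderiv β (fun y => d2 α₁ α₂ a y ξ η) x

/-- The bilinear product-type rough amplitude class `L^p_Π S^{(m₁,m₂)}_{(ρ₁,ρ₂)}(n,2)`. -/
def LpPiSm2 {n : ℕ} (p : ℝ≥0∞) (m₁ m₂ ρ₁ ρ₂ : ℝ) (a : En n → En n → En n → ℂ) : Prop :=
  (∀ x, ContDiff ℝ (⊤ : ℕ∞) (fun q : En n × En n => a x q.1 q.2)) ∧
  (∀ (α₁ α₂ : Fin n → ℕ) (ξ η : En n),
    AEStronglyMeasurable (fun x => d2 α₁ α₂ a x ξ η) volume) ∧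
  ∀ α₁ α₂ : Fin n → ℕ, ∃ C : ℝ, ∀ ξ η : En n,
    eLpNorm (fun x => d2 α₁ α₂ a x ξ η) p volume ≤
      ENNReal.ofReal (C * jb ξ (m₁ - ρ₁ * (mdeg α₁ : ℝ)) * jb η (m₂ - ρ₂ * (mdeg α₂ : ℝ)))

/-- The bilinear rough amplitude class `L^p S^m_ρ(n,2)`. -/
def LpSm2 {n : ℕ} (p : ℝ≥0∞) (m ρ : ℝ) (a : En n → En n → En n → ℂ) : Prop :=
  (∀ x, ContDiff ℝ (⊤ : ℕ∞) (fun q : En n × En n => a x q.1 q.2)) ∧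
  (∀ (α₁ α₂ : Fin n → ℕ) (ξ η : En n),
    AEStronglyMeasurable (fun x => d2 α₁ α₂ a x ξ η) volume) ∧
  ∀ α₁ α₂ : Fin n → ℕ, ∃ C : ℝ, ∀ ξ η : En n,
    eLpNorm (fun x => d2 α₁ α₂ a x ξ η) p volume ≤
      ENNReal.ofReal (C * (1 + ‖ξ‖ + ‖η‖) ^ (m - ρ * ((mdeg α₁ : ℝ) + (mdeg α₂ : ℝ))))

/-- The bilinear Hörmander class `S^m_{ρ,δ}(n,2)`. -/
def HormS2 {n : ℕ} (m ρ δ : ℝ) (a : En n → En n → En n → ℂ) : Prop :=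
  ContDiff ℝ (⊤ : ℕ∞) (fun q : En n × En n × En n => a q.1 q.2.1 q.2.2) ∧
  ∀ β α₁ α₂ : Fin n → ℕ, ∃ C : ℝ, ∀ x ξ η : En n,
    ‖d3 β α₁ α₂ a x ξ η‖ ≤
      C * (1 + ‖ξ‖ + ‖η‖) ^ (m - ρ * ((mdeg α₁ : ℝ) + (mdeg α₂ : ℝ)) + δ * (mdeg β : ℝ))

/-- The bilinear Fourier integral operator
`T_a(f,g)(x) = ∫∫ a(x,ξ,η) e^{iφ₁(x,ξ)+iφ₂(x,η)} f̂(ξ) ĝ(η) dξ dη`. -/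
def bfio {n : ℕ} (a : En n → En n → En n → ℂ) (φ₁ φ₂ : En n → En n → ℝ)
    (f g : En n → ℂ) (x : En n) : ℂ :=
  ∫ w : En n × En n,
    a x w.1 w.2 * Complex.exp (Complex.I * Complex.ofReal (φ₁ x w.1 + φ₂ x w.2)) *
      ft f w.1 * ft g w.2

/-- Partial derivative of a function of `N` frequency variables in the `i`-th coordinate
of the `j`-th variable. -/
def pdN {n N : ℕ} (j : Fin N) (i : Fin n) (g : (Fin N → En n) → ℂ) :
    (Fin N → En n) → ℂ :=
  fun ξ => fderiv ℝ g ξ (Pi.single j (EuclideanSpace.single i 1))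

/-- Multi-index derivative `∂_{ξ₁}^{A 1} ⋯ ∂_{ξ_N}^{A N}`. -/
def mderivN {n N : ℕ} (A : Fin N → Fin n → ℕ) (g : (Fin N → En n) → ℂ) :
    (Fin N → En n) → ℂ :=
  (List.finRange N).foldr
    (fun j h => (List.finRange n).foldr (fun i h' => (pdN j i)^[A j i] h') h) g

/-- The multilinear product-type rough amplitude class `L^p_Π S^{m⃗}_{ρ⃗}(n,N)`. -/
def LpPiSmN {n N : ℕ} (p : ℝ≥0∞) (m ρ : Fin N → ℝ)
    (a : En n → (Fin N → En n) → ℂ) : Prop :=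
  (∀ x, ContDiff ℝ (⊤ : ℕ∞) (a x)) ∧
  (∀ (A : Fin N → Fin n → ℕ) (ξ : Fin N → En n),
    AEStronglyMeasurable (fun x => mderivN A (a x) ξ) volume) ∧
  ∀ A : Fin N → Fin n → ℕ, ∃ C : ℝ, ∀ ξ : Fin N → En n,
    eLpNorm (fun x => mderivN A (a x) ξ) p volume ≤
      ENNReal.ofReal (C * ∏ j, jb (ξ j) (m j - ρ j * (mdeg (A j) : ℝ)))

/-- The multilinear rough amplitude class `L^p S^m_ρ(n,N)`. -/
def LpSmN {n N : ℕ} (p : ℝ≥0∞) (m ρ : ℝ) (a : En n → (Fin N → En n) → ℂ) : Prop :=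
  (∀ x, ContDiff ℝ (⊤ : ℕ∞) (a x)) ∧
  (∀ (A : Fin N → Fin n → ℕ) (ξ : Fin N → En n),
    AEStronglyMeasurable (fun x => mderivN A (a x) ξ) volume) ∧
  ∀ A : Fin N → Fin n → ℕ, ∃ C : ℝ, ∀ ξ : Fin N → En n,
    eLpNorm (fun x => mderivN A (a x) ξ) p volume ≤
      ENNReal.ofReal (C * (1 + ∑ j, ‖ξ j‖) ^ (m - ρ * ∑ j, (mdeg (A j) : ℝ)))

/-- The multilinear Fourier integral operator. -/
def mfio {n N : ℕ} (a : En n → (Fin N → En n) → ℂ) (φ : Fin N → En n → En n → ℝ)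
    (f : Fin N → En n → ℂ) (x : En n) : ℂ :=
  ∫ ξ : Fin N → En n,
    a x ξ * Complex.exp (Complex.I * Complex.ofReal (∑ j, φ j x (ξ j))) *
      ∏ j, ft (f j) (ξ j)

/-- The Sobolev (Bessel potential) norm `‖f‖_{H^{s,q}} = ‖ℱ^{-1}(⟨ξ⟩^s f̂)‖_{L^q}`. -/
def besselNorm {n : ℕ} (s : ℝ) (q : ℝ≥0∞) (f : En n → ℂ) : ℝ≥0∞ :=
  eLpNorm (fun x : En n =>
    (((2 * Real.pi) ^ n)⁻¹ : ℝ) •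
      ∫ ξ : En n, Complex.ofReal (jb ξ s) * ft f ξ *
        Complex.exp (Complex.I * Complex.ofReal ⟪x, ξ⟫)) q volume

/-! ### Frequency-localised `L^p` bound for the Fourier transform -/

lemma holder_bilin {α : Type*} [MeasurableSpace α] (μ : Measure α) [SFinite μ]
    (F : α → ℝ≥0∞) (hF : Measurable F)
    (Φ : α → α → ℝ≥0∞) (hΦ : Measurable (Function.uncurry Φ)) (M I : ℝ≥0∞)
    (hM : ∀ u v, Φ u v ≤ M) (hI : ∀ u, ∫⁻ v, Φ u v ∂μ ≤ I) (hI' : ∀ v, ∫⁻ u, Φ u v ∂μ ≤ I)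
    (p : ℝ) (hp1 : 1 ≤ p) (hp2 : p ≤ 2) :
    ∫⁻ u, ∫⁻ v, F u * F v * Φ u v ∂μ ∂μ ≤
      M ^ (2 / p - 1) * (2 * I) ^ (2 - 2 / p) * (∫⁻ u, F u ^ p ∂μ) ^ (2 / p) := by
  have hp0 : 0 < p := by linarith
  set θ : ℝ := 2 / p - 1 with hθ
  have hθ0 : 0 ≤ θ := by
    rw [hθ, sub_nonneg, le_div_iff₀ hp0]; linarith
  have hθ1 : 0 ≤ 2 - 2 / p := by
    rw [sub_nonneg, div_le_iff₀ hp0]; linarith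
  have hθs : θ + (2 - 2 / p) = 1 := by rw [hθ]; ring
  -- pointwise bound
  have key : ∀ u v, F u * F v * Φ u v ≤
      M ^ θ * ((F u ^ p * F v ^ p) ^ θ * ((F u ^ p + F v ^ p) * Φ u v) ^ (2 - 2 / p)) := by
    intro u v
    have e1 : ∀ x : ℝ≥0∞, x = (x ^ p) ^ θ * (x ^ (p / 2)) ^ (2 - 2 / p) := by
      intro x
      rw [← ENNReal.rpow_mul, ← ENNReal.rpow_mul, ← ENNReal.rpow_add_of_nonneg]
      · have : p * θ + p / 2 * (2 - 2 / p) = 1 := by rw [hθ]; field_simp; ring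
        rw [this, ENNReal.rpow_one]
      · positivity
      · exact mul_nonneg (by linarith) hθ1
    have e2 : Φ u v ≤ M ^ θ * (Φ u v) ^ (2 - 2 / p) := by
      calc Φ u v = (Φ u v) ^ θ * (Φ u v) ^ (2 - 2 / p) := by
            rw [← ENNReal.rpow_add_of_nonneg _ _ hθ0 hθ1, hθs, ENNReal.rpow_one]
        _ ≤ _ := by gcongr; exact hM u v
    have e3 : F u ^ (p / 2) * F v ^ (p / 2) ≤ F u ^ p + F v ^ p := by
      have h2 : ∀ x : ℝ≥0∞, x ^ p = x ^ (p / 2) * x ^ (p / 2) := by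
        intro x
        rw [← ENNReal.rpow_add_of_nonneg _ _ (by positivity) (by positivity)]; congr 1; ring
      rcases le_total (F u) (F v) with h | h
      · calc _ ≤ F v ^ (p / 2) * F v ^ (p / 2) := by gcongr
          _ ≤ _ := by rw [← h2]; exact le_add_self
      · calc _ ≤ F u ^ (p / 2) * F u ^ (p / 2) := by gcongr
          _ ≤ _ := by rw [← h2]; exact le_self_add
    calc F u * F v * Φ u v
        ≤ ((F u ^ p) ^ θ * (F u ^ (p / 2)) ^ (2 - 2 / p)) *
            ((F v ^ p) ^ θ * (F v ^ (p / 2)) ^ (2 - 2 / p)) * (M ^ θ * (Φ u v) ^ (2 - 2 / p)) := by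
          rw [← e1, ← e1]; gcongr
      _ = M ^ θ * ((F u ^ p * F v ^ p) ^ θ *
            ((F u ^ (p / 2) * F v ^ (p / 2)) * Φ u v) ^ (2 - 2 / p)) := by
          rw [ENNReal.mul_rpow_of_nonneg _ _ hθ0, ENNReal.mul_rpow_of_nonneg _ _ hθ1,
            ENNReal.mul_rpow_of_nonneg _ _ hθ1]
          ring
      _ ≤ _ := by gcongr
  have hFp : Measurable fun u => F u ^ p := hF.pow_const p
  have m1 : Measurable fun z : α × α => F z.1 ^ p * F z.2 ^ p :=
    (hFp.comp measurable_fst).mul (hFp.comp measurable_snd)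
  have m2 : Measurable fun z : α × α => (F z.1 ^ p + F z.2 ^ p) * Φ z.1 z.2 :=
    ((hFp.comp measurable_fst).add (hFp.comp measurable_snd)).mul hΦ
  have m3 : Measurable fun z : α × α => F z.1 * F z.2 * Φ z.1 z.2 :=
    ((hF.comp measurable_fst).mul (hF.comp measurable_snd)).mul hΦ
  set J := ∫⁻ u, F u ^ p ∂μ with hJ
  have i1 : ∫⁻ z, F z.1 ^ p * F z.2 ^ p ∂(μ.prod μ) = J * J := by
    rw [lintegral_prod_mul hFp.aemeasurable hFp.aemeasurable]
  have m4 : Measurable fun z : α × α => F z.1 ^ p * Φ z.1 z.2 :=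
    (hFp.comp measurable_fst).mul hΦ
  have m5 : Measurable fun z : α × α => F z.2 ^ p * Φ z.1 z.2 :=
    (hFp.comp measurable_snd).mul hΦ
  have i2 : ∫⁻ z, (F z.1 ^ p + F z.2 ^ p) * Φ z.1 z.2 ∂(μ.prod μ) ≤ 2 * I * J := by
    have a1 : ∫⁻ z, F z.1 ^ p * Φ z.1 z.2 ∂(μ.prod μ) ≤ I * J := by
      rw [lintegral_prod _ m4.aemeasurable]
      calc _ = ∫⁻ u, F u ^ p * ∫⁻ v, Φ u v ∂μ ∂μ := by
            refine lintegral_congr fun u => ?_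
            exact lintegral_const_mul (F u ^ p) (f := fun v => Φ u v) (hΦ.comp measurable_prodMk_left)
        _ ≤ ∫⁻ u, F u ^ p * I ∂μ := by gcongr with u; exact hI u
        _ = _ := by rw [lintegral_mul_const _ hFp, mul_comm]
    have a2 : ∫⁻ z, F z.2 ^ p * Φ z.1 z.2 ∂(μ.prod μ) ≤ I * J := by
      rw [lintegral_prod_symm _ m5.aemeasurable]
      calc _ = ∫⁻ v, F v ^ p * ∫⁻ u, Φ u v ∂μ ∂μ := by
            refine lintegral_congr fun u => ?_
            exact lintegral_const_mul (F u ^ p) (f := fun v => Φ v u) (hΦ.comp measurable_prodMk_right)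
        _ ≤ ∫⁻ u, F u ^ p * I ∂μ := by gcongr with u; exact hI' u
        _ = _ := by rw [lintegral_mul_const _ hFp, mul_comm]
    simp_rw [add_mul]
    rw [lintegral_add_left m4]
    calc _ ≤ I * J + I * J := add_le_add a1 a2
      _ = _ := by ring
  calc ∫⁻ u, ∫⁻ v, F u * F v * Φ u v ∂μ ∂μ
      = ∫⁻ z, F z.1 * F z.2 * Φ z.1 z.2 ∂(μ.prod μ) := by
        rw [lintegral_prod _ m3.aemeasurable]
    _ ≤ ∫⁻ z, M ^ θ * ((F z.1 ^ p * F z.2 ^ p) ^ θ *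
          ((F z.1 ^ p + F z.2 ^ p) * Φ z.1 z.2) ^ (2 - 2 / p)) ∂(μ.prod μ) := by
        exact lintegral_mono fun z => key _ _
    _ = M ^ θ * ∫⁻ z, (F z.1 ^ p * F z.2 ^ p) ^ θ *
          ((F z.1 ^ p + F z.2 ^ p) * Φ z.1 z.2) ^ (2 - 2 / p) ∂(μ.prod μ) := by
        rw [lintegral_const_mul]
        exact (m1.pow_const _).mul (m2.pow_const _)
    _ ≤ M ^ θ * ((J * J) ^ θ * (2 * I * J) ^ (2 - 2 / p)) := by
        gcongr
        refine (ENNReal.lintegral_mul_norm_pow_le m1.aemeasurable m2.aemeasurable hθ0 hθ1 hθs).trans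
          ?_
        rw [i1]; gcongr
    _ = _ := by
        rw [ENNReal.mul_rpow_of_nonneg _ _ hθ0, ENNReal.mul_rpow_of_nonneg _ J hθ1]
        have : J ^ (2 / p) = J ^ θ * J ^ θ * J ^ (2 - 2 / p) := by
          rw [← ENNReal.rpow_add_of_nonneg _ _ hθ0 hθ0,
            ← ENNReal.rpow_add_of_nonneg _ _ (by linarith) hθ1]
          congr 1; rw [hθ]; ring
        rw [this]; ring

lemma ft_continuous {n : ℕ} {f : En n → ℂ} (hf : Integrable f) : Continuous (ft f) := by
  unfold ft
  refine continuous_of_dominated (bound := fun y => ‖f y‖) ?_ ?_ hf.norm ?_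
  · intro ξ
    refine AEStronglyMeasurable.mul ?_ hf.aestronglyMeasurable
    exact (Continuous.aestronglyMeasurable (by fun_prop))
  · intro ξ
    refine Filter.Eventually.of_forall fun y => ?_
    rw [norm_mul]
    have : ‖cexp (-(I * ((⟪y, ξ⟫ : ℝ) : ℂ)))‖ = 1 := by
      rw [show -(I * ((⟪y, ξ⟫ : ℝ) : ℂ)) = ((-⟪y, ξ⟫ : ℝ) : ℂ) * I by push_cast; ring]
      exact Complex.norm_exp_ofReal_mul_I _
    rw [this, one_mul]
  · refine Filter.Eventually.of_forall fun y => ?_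
    fun_prop

lemma norm_cexp_I (t : ℝ) : ‖cexp (I * (t : ℂ))‖ = 1 := by
  rw [mul_comm]; exact Complex.norm_exp_ofReal_mul_I _

lemma norm_cexp_neg_I (t : ℝ) : ‖cexp (-(I * (t : ℂ)))‖ = 1 := by
  rw [show -(I * (t : ℂ)) = ((-t : ℝ) : ℂ) * I by push_cast; ring]
  exact Complex.norm_exp_ofReal_mul_I _

lemma ft_norm_le {n : ℕ} (f : En n → ℂ) (ξ : En n) : ‖ft f ξ‖ ≤ ∫ y, ‖f y‖ := by
  unfold ft
  refine (norm_integral_le_integral_norm _).trans (le_of_eq ?_)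
  refine integral_congr_ae (Filter.Eventually.of_forall fun y => ?_)
  simp only [norm_mul, norm_cexp_neg_I, one_mul]

lemma gauss_integrable {n : ℕ} (β : ℝ) (hβ : 0 < β) :
    Integrable fun ξ : En n => Real.exp (-β * ‖ξ‖ ^ 2) := by
  have := GaussianFourier.integrable_cexp_neg_mul_sq_norm_add (V := En n) (b := (β : ℂ))
    (by simpa using hβ) 0 0
  have h2 := this.norm
  refine h2.congr (Filter.Eventually.of_forall fun ξ => ?_)
  simp only [Complex.norm_exp]
  congr 1
  simp [← Complex.ofReal_pow, ← Complex.ofReal_mul]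

lemma gauss_ft {n : ℕ} (β : ℝ) (hβ : 0 < β) (w : En n) :
    ‖∫ ξ : En n, (Real.exp (-β * ‖ξ‖ ^ 2) : ℂ) * cexp (-(I * (⟪w, ξ⟫ : ℝ)))‖ =
      (π / β) ^ ((n : ℝ) / 2) * Real.exp (-‖w‖ ^ 2 / (4 * β)) := by
  have := GaussianFourier.integral_cexp_neg_mul_sq_norm_add (V := En n) (b := (β : ℂ))
    (by simpa using hβ) (-I) w
  have e : (∫ ξ : En n, (Real.exp (-β * ‖ξ‖ ^ 2) : ℂ) * cexp (-(I * (⟪w, ξ⟫ : ℝ)))) =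
      ∫ v : En n, cexp (-(β : ℂ) * ‖v‖ ^ 2 + (-I) * ⟪w, v⟫) := by
    congr 1; ext ξ
    rw [Complex.exp_add]; push_cast; congr 2; ring
  rw [e, this, norm_mul]
  congr 1
  · have : ((π : ℂ) / β) ^ ((Module.finrank ℝ (En n) : ℂ) / 2) =
        (((π / β) ^ ((n : ℝ) / 2) : ℝ) : ℂ) := by
      rw [Complex.ofReal_cpow (by positivity)]
      simp
    rw [this, Complex.norm_real, Real.norm_of_nonneg (by positivity)]
  · rw [Complex.norm_exp]
    congr 1
    have : ((-I) ^ 2 * (‖w‖ : ℂ) ^ 2 / (4 * (β : ℂ))) = ((-‖w‖ ^ 2 / (4 * β) : ℝ) : ℂ) := by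
      push_cast; simp
    rw [this, Complex.ofReal_re]

lemma gauss_int {n : ℕ} (β : ℝ) (hβ : 0 < β) :
    ∫ ξ : En n, Real.exp (-β * ‖ξ‖ ^ 2) = (π / β) ^ ((n : ℝ) / 2) := by
  have := gauss_ft (n := n) β hβ 0
  simp only [inner_zero_left] at this
  have e : (∫ ξ : En n, (Real.exp (-β * ‖ξ‖ ^ 2) : ℂ) * cexp (-(I * ((0 : ℝ) : ℂ)))) =
      ((∫ ξ : En n, Real.exp (-β * ‖ξ‖ ^ 2) : ℝ) : ℂ) := by
    rw [← integral_complex_ofReal]; simp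
  rw [e, Complex.norm_real, Real.norm_of_nonneg (integral_nonneg fun _ => by positivity)] at this
  simpa using this

lemma ft_gauss_le {n : ℕ} {f : En n → ℂ} (hf : Integrable f) (β : ℝ) (hβ : 0 < β) :
    ∫⁻ ξ, ENNReal.ofReal (Real.exp (-β * ‖ξ‖ ^ 2)) * ‖ft f ξ‖ₑ ^ 2 ≤
      ∫⁻ u, ∫⁻ v, ‖f u‖ₑ * ‖f v‖ₑ *
        ENNReal.ofReal ((π / β) ^ ((n : ℝ) / 2) * Real.exp (-‖u - v‖ ^ 2 / (4 * β))) := by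
  have hg := gauss_integrable (n := n) β hβ
  -- the triple integrand
  set Ψ : En n → En n × En n → ℂ := fun ξ z =>
    (Real.exp (-β * ‖ξ‖ ^ 2) : ℂ) * cexp (-(I * ((⟪z.1 - z.2, ξ⟫ : ℝ) : ℂ))) *
      (f z.1 * (starRingEnd ℂ) (f z.2)) with hΨ
  have hff : Integrable (fun z : En n × En n => f z.1 * (starRingEnd ℂ) (f z.2)) :=
    Integrable.mul_prod hf ((LinearIsometryEquiv.integrable_comp_iff Complex.conjLIE).2 hf)
  have hΨi : Integrable (Function.uncurry Ψ) (volume.prod volume) := by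
    have h1 : Integrable (fun q : En n × (En n × En n) => (Real.exp (-β * ‖q.1‖ ^ 2) : ℂ) *
        (f q.2.1 * (starRingEnd ℂ) (f q.2.2))) (volume.prod volume) :=
      Integrable.mul_prod hg.ofReal hff
    refine h1.mono ?_ ?_
    · have : Function.uncurry Ψ = fun q : En n × (En n × En n) =>
          cexp (-(I * ((⟪q.2.1 - q.2.2, q.1⟫ : ℝ) : ℂ))) * ((Real.exp (-β * ‖q.1‖ ^ 2) : ℂ) *
        (f q.2.1 * (starRingEnd ℂ) (f q.2.2))) := by
        ext q; simp only [hΨ, Function.uncurry]; ring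
      rw [this]
      exact (Continuous.aestronglyMeasurable (by fun_prop)).mul h1.aestronglyMeasurable
    · refine Filter.Eventually.of_forall fun q => le_of_eq ?_
      simp only [hΨ, Function.uncurry, norm_mul, norm_cexp_neg_I, mul_one]
  have e1 : ∀ ξ, ∫ z, Ψ ξ z = ((Real.exp (-β * ‖ξ‖ ^ 2) * ‖ft f ξ‖ ^ 2 : ℝ) : ℂ) := by
    intro ξ
    have hs : ∀ z : En n × En n, Ψ ξ z = (Real.exp (-β * ‖ξ‖ ^ 2) : ℂ) *
        ((cexp (-(I * ((⟪z.1, ξ⟫ : ℝ) : ℂ))) * f z.1) *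
          (starRingEnd ℂ) (cexp (-(I * ((⟪z.2, ξ⟫ : ℝ) : ℂ))) * f z.2)) := by
      intro z
      simp only [hΨ, map_mul, ← Complex.exp_conj, map_neg, Complex.conj_I, Complex.conj_ofReal]
      rw [inner_sub_left]
      rw [show -(I * ((⟪z.1, ξ⟫ - ⟪z.2, ξ⟫ : ℝ) : ℂ)) = -(I * ((⟪z.1, ξ⟫ : ℝ) : ℂ)) +
        -(-I * ((⟪z.2, ξ⟫ : ℝ) : ℂ)) by push_cast; ring, Complex.exp_add]
      ring
    simp_rw [hs]
    rw [integral_const_mul]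
    rw [show (volume : Measure (En n × En n)) = volume.prod volume from rfl]
    rw [integral_prod_mul (fun u => cexp (-(I * ((⟪u, ξ⟫ : ℝ) : ℂ))) * f u)
      (fun v => (starRingEnd ℂ) (cexp (-(I * ((⟪v, ξ⟫ : ℝ) : ℂ))) * f v)), integral_conj]
    change _ * (ft f ξ * (starRingEnd ℂ) (ft f ξ)) = _
    rw [Complex.mul_conj, Complex.normSq_eq_norm_sq]; push_cast; rfl
  have hintg : Integrable fun ξ => Real.exp (-β * ‖ξ‖ ^ 2) * ‖ft f ξ‖ ^ 2 := by
    have := hΨi.integral_prod_left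
    simp only [Function.uncurry] at this
    simp_rw [e1] at this
    exact this.re.congr (Filter.Eventually.of_forall fun ξ => by simp [-Complex.ofReal_mul])
  have e2 : ∀ z, ‖∫ ξ, Ψ ξ z‖ = ‖f z.1‖ * ‖f z.2‖ *
      ((π / β) ^ ((n : ℝ) / 2) * Real.exp (-‖z.1 - z.2‖ ^ 2 / (4 * β))) := by
    intro z
    simp only [hΨ]
    rw [integral_mul_const, norm_mul, gauss_ft β hβ]
    simp only [norm_mul, RCLike.norm_conj]; ring
  have step : ENNReal.ofReal (∫ ξ, Real.exp (-β * ‖ξ‖ ^ 2) * ‖ft f ξ‖ ^ 2) ≤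
      ∫⁻ z : En n × En n, ‖∫ ξ, Ψ ξ z‖ₑ := by
    have : ((∫ ξ, Real.exp (-β * ‖ξ‖ ^ 2) * ‖ft f ξ‖ ^ 2 : ℝ) : ℂ) = ∫ z, ∫ ξ, Ψ ξ z := by
      rw [← integral_complex_ofReal]
      simp_rw [← e1]
      exact integral_integral_swap hΨi
    have h3 : ENNReal.ofReal (∫ ξ, Real.exp (-β * ‖ξ‖ ^ 2) * ‖ft f ξ‖ ^ 2) =
        ‖((∫ ξ, Real.exp (-β * ‖ξ‖ ^ 2) * ‖ft f ξ‖ ^ 2 : ℝ) : ℂ)‖ₑ := by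
      rw [← ofReal_norm, Complex.norm_real, Real.norm_of_nonneg
        (integral_nonneg fun _ => by positivity)]
    rw [h3, this]
    exact enorm_integral_le_lintegral_enorm _
  calc _ = ∫⁻ ξ, ENNReal.ofReal (Real.exp (-β * ‖ξ‖ ^ 2) * ‖ft f ξ‖ ^ 2) := by
        refine lintegral_congr fun ξ => ?_
        rw [ENNReal.ofReal_mul (by positivity), ENNReal.ofReal_pow (by positivity),
          ofReal_norm]
    _ = ENNReal.ofReal (∫ ξ, Real.exp (-β * ‖ξ‖ ^ 2) * ‖ft f ξ‖ ^ 2) := by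
        rw [ofReal_integral_eq_lintegral_ofReal hintg
          (Filter.Eventually.of_forall fun _ => by positivity)]
    _ ≤ _ := step
    _ = ∫⁻ z : En n × En n, ‖f z.1‖ₑ * ‖f z.2‖ₑ *
        ENNReal.ofReal ((π / β) ^ ((n : ℝ) / 2) * Real.exp (-‖z.1 - z.2‖ ^ 2 / (4 * β))) := by
        refine lintegral_congr fun z => ?_
        rw [← ofReal_norm, e2, ENNReal.ofReal_mul (by positivity),
          ENNReal.ofReal_mul (by positivity), ofReal_norm, ofReal_norm]
    _ = _ := by
        rw [show (volume : Measure (En n × En n)) = volume.prod volume from rfl]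
        rw [lintegral_prod]
        have hc : Continuous fun z : En n × En n =>
            ((π / β) ^ ((n : ℝ) / 2) * Real.exp (-‖z.1 - z.2‖ ^ 2 / (4 * β))) := by fun_prop
        refine AEMeasurable.mul (AEMeasurable.mul ?_ ?_) hc.measurable.ennreal_ofReal.aemeasurable
        · exact hf.aestronglyMeasurable.enorm.comp_quasiMeasurePreserving
            Measure.quasiMeasurePreserving_fst
        · exact hf.aestronglyMeasurable.enorm.comp_quasiMeasurePreserving
            Measure.quasiMeasurePreserving_snd

/-- Frequency-localised `L^p → L^2` bound, `1 ≤ p ≤ 2`. -/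
theorem ft_loc {n : ℕ} (p : ℝ) (hp1 : 1 ≤ p) (hp2 : p ≤ 2) :
    ∃ C : ℝ≥0∞, C ≠ ⊤ ∧ ∀ R : ℝ, 0 < R → ∀ f : En n → ℂ, Integrable f → Measurable f →
      ∫⁻ ξ in Metric.closedBall (0 : En n) R, ‖ft f ξ‖ₑ ^ 2 ≤
        C * ENNReal.ofReal R ^ ((n : ℝ) * (2 / p - 1)) * (∫⁻ u, ‖f u‖ₑ ^ p) ^ (2 / p) := by
  have hp0 : 0 < p := by linarith
  have hθ0 : 0 ≤ 2 / p - 1 := by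
    rw [sub_nonneg, le_div_iff₀ hp0]; linarith
  have hθ1 : 0 ≤ 2 - 2 / p := by
    rw [sub_nonneg, div_le_iff₀ hp0]; linarith
  refine ⟨ENNReal.ofReal (Real.exp 1) * (ENNReal.ofReal (π ^ ((n : ℝ) / 2)) ^ (2 / p - 1) *
    (2 * ENNReal.ofReal ((4 * π ^ 2) ^ ((n : ℝ) / 2))) ^ (2 - 2 / p)), ?_, ?_⟩
  · refine ENNReal.mul_ne_top ENNReal.ofReal_ne_top (ENNReal.mul_ne_top ?_ ?_)
    · exact ENNReal.rpow_ne_top_of_nonneg hθ0 ENNReal.ofReal_ne_top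
    · exact ENNReal.rpow_ne_top_of_nonneg hθ1
        (ENNReal.mul_ne_top (by simp) ENNReal.ofReal_ne_top)
  intro R hR f hf hfm
  set β : ℝ := (R ^ 2)⁻¹ with hβ
  have hβ0 : 0 < β := by positivity
  have h1 : ∫⁻ ξ in Metric.closedBall (0 : En n) R, ‖ft f ξ‖ₑ ^ 2 ≤
      ENNReal.ofReal (Real.exp 1) *
        ∫⁻ ξ, ENNReal.ofReal (Real.exp (-β * ‖ξ‖ ^ 2)) * ‖ft f ξ‖ₑ ^ 2 := by
    rw [← lintegral_const_mul' _ _ ENNReal.ofReal_ne_top]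
    refine le_trans ?_ (setLIntegral_le_lintegral (Metric.closedBall (0 : En n) R) _)
    refine setLIntegral_mono' Metric.isClosed_closedBall.measurableSet fun ξ hξ => ?_
    rw [← mul_assoc, ← ENNReal.ofReal_mul (by positivity), ← Real.exp_add]
    have : 1 ≤ Real.exp (1 + -β * ‖ξ‖ ^ 2) := by
      apply Real.one_le_exp
      have h : ‖ξ‖ ≤ R := by simpa using hξ
      have : β * ‖ξ‖ ^ 2 ≤ 1 := by
        rw [hβ, inv_mul_le_iff₀ (by positivity), mul_one]
        gcongr
      linarith
    calc ‖ft f ξ‖ₑ ^ 2 = ENNReal.ofReal 1 * ‖ft f ξ‖ₑ ^ 2 := by simp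
      _ ≤ _ := by gcongr
  refine h1.trans ?_
  have hΦc : Continuous fun z : En n × En n =>
      ((π / β) ^ ((n : ℝ) / 2) * Real.exp (-‖z.1 - z.2‖ ^ 2 / (4 * β))) := by fun_prop
  have hshift : ∀ u : En n, ∫⁻ v : En n,
      ENNReal.ofReal ((π / β) ^ ((n : ℝ) / 2) * Real.exp (-‖v - u‖ ^ 2 / (4 * β))) ≤
      ENNReal.ofReal ((4 * π ^ 2) ^ ((n : ℝ) / 2)) := by
    intro u
    rw [lintegral_sub_right_eq_self (fun v : En n => ENNReal.ofReal ((π / β) ^ ((n : ℝ) / 2) *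
      Real.exp (-‖v‖ ^ 2 / (4 * β)))) u]
    have hb4 : 0 < (4 * β)⁻¹ := by positivity
    have hr : ∀ v : En n, Real.exp (-‖v‖ ^ 2 / (4 * β)) = Real.exp (-(4 * β)⁻¹ * ‖v‖ ^ 2) := by
      intro v; congr 1; field_simp
    simp_rw [hr]
    rw [← ofReal_integral_eq_lintegral_ofReal ((gauss_integrable _ hb4).const_mul _)
      (Filter.Eventually.of_forall fun _ => by positivity), integral_const_mul, gauss_int _ hb4,
      ← Real.mul_rpow (by positivity) (by positivity)]
    apply le_of_eq
    congr 2
    field_simp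
  have h2 := holder_bilin (volume : Measure (En n)) (fun u => ‖f u‖ₑ) hfm.enorm
    (fun u v => ENNReal.ofReal ((π / β) ^ ((n : ℝ) / 2) * Real.exp (-‖u - v‖ ^ 2 / (4 * β))))
    hΦc.measurable.ennreal_ofReal (ENNReal.ofReal ((π / β) ^ ((n : ℝ) / 2)))
    (ENNReal.ofReal ((4 * π ^ 2) ^ ((n : ℝ) / 2)))
    (fun u v => by
      apply ENNReal.ofReal_le_ofReal
      apply mul_le_of_le_one_right (by positivity)
      rw [Real.exp_le_one_iff]
      exact div_nonpos_of_nonpos_of_nonneg (by nlinarith [sq_nonneg ‖u - v‖]) (by positivity))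
    (fun u => by
      have := hshift u
      simpa only [norm_sub_rev] using this)
    (fun v => hshift v) p hp1 hp2
  have h3 := (ft_gauss_le hf β hβ0).trans h2
  calc _ ≤ _ := mul_le_mul_right h3 _
    _ = _ := by
      have hM : ENNReal.ofReal ((π / β) ^ ((n : ℝ) / 2)) =
          ENNReal.ofReal (π ^ ((n : ℝ) / 2)) * ENNReal.ofReal R ^ (n : ℝ) := by
        rw [ENNReal.ofReal_rpow_of_pos hR, ← ENNReal.ofReal_mul (by positivity)]
        congr 1
        rw [hβ, div_inv_eq_mul, Real.mul_rpow (by positivity) (by positivity)]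
        congr 1
        rw [← Real.rpow_natCast, ← Real.rpow_mul hR.le]; congr 1; push_cast; ring
      rw [hM, ENNReal.mul_rpow_of_nonneg _ _ hθ0, ← ENNReal.rpow_mul]
      ring

/-! ### `L^2` bound for a frozen symbol -/

lemma sq_lintegral_mul_le {α : Type*} [MeasurableSpace α] (μ : Measure α)
    {f g : α → ℝ≥0∞} (hf : AEMeasurable f μ) (hg : AEMeasurable g μ) :
    (∫⁻ a, f a * g a ∂μ) ^ 2 ≤ (∫⁻ a, f a ^ 2 ∂μ) * ∫⁻ a, g a ^ 2 ∂μ := by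
  have h := ENNReal.lintegral_mul_norm_pow_le (μ := μ) (hf.pow_const 2) (hg.pow_const 2)
    (p := 1 / 2) (q := 1 / 2) (by norm_num) (by norm_num) (by norm_num)
  have e : ∀ x : ℝ≥0∞, (x ^ 2) ^ (1 / 2 : ℝ) = x := by
    intro x
    rw [← ENNReal.rpow_natCast, ← ENNReal.rpow_mul]; norm_num
  have e' : ∀ x : ℝ≥0∞, (x ^ (1 / 2 : ℝ)) ^ 2 = x := by
    intro x
    rw [← ENNReal.rpow_natCast, ← ENNReal.rpow_mul]; norm_num
  simp only [e] at h
  calc _ ≤ ((∫⁻ a, f a ^ 2 ∂μ) ^ (1 / 2 : ℝ) * (∫⁻ a, g a ^ 2 ∂μ) ^ (1 / 2 : ℝ)) ^ 2 := by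
        gcongr
    _ = _ := by rw [mul_pow, e', e']

lemma sq_setLIntegral_le {α : Type*} [MeasurableSpace α] (μ : Measure α) (s : Set α)
    {f : α → ℝ≥0∞} (hf : AEMeasurable f μ) :
    (∫⁻ a in s, f a ∂μ) ^ 2 ≤ μ s * ∫⁻ a in s, f a ^ 2 ∂μ := by
  have := sq_lintegral_mul_le (μ.restrict s) (f := fun _ => 1) (g := f) aemeasurable_const
    hf.restrict
  simpa using this

/-- symbol `c` with bound `A` and frequency support in balls of radius `R`. -/
structure FSym {n : ℕ} (R : ℝ) (A : ℝ≥0) (c : En n × En n → ℂ) : Prop where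
  meas : Measurable c
  bound : ∀ w, ‖c w‖ ≤ A
  supp : ∀ w, c w ≠ 0 → ‖w.1‖ ≤ R ∧ ‖w.2‖ ≤ R

lemma FSym.enorm_le {n : ℕ} {R : ℝ} {A : ℝ≥0} {c : En n × En n → ℂ} (hc : FSym R A c)
    (F G : En n → ℂ) (w : En n × En n) :
    ‖c w * F w.1 * G w.2‖ₑ ≤ A *
      ((Metric.closedBall (0 : En n) R).indicator (fun ξ => ‖F ξ‖ₑ) w.1 *
       (Metric.closedBall (0 : En n) R).indicator (fun ξ => ‖G ξ‖ₑ) w.2) := by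
  by_cases h : c w = 0
  · simp [h]
  · obtain ⟨h1, h2⟩ := hc.supp w h
    rw [Set.indicator_of_mem (by simpa using h1), Set.indicator_of_mem (by simpa using h2),
      enorm_mul, enorm_mul, mul_assoc]
    gcongr
    have h3 : ‖c w‖₊ ≤ A := by exact_mod_cast hc.bound w
    exact ENNReal.coe_le_coe.2 h3

lemma FSym.integrable {n : ℕ} {R : ℝ} {A : ℝ≥0} {c : En n × En n → ℂ} (hc : FSym R A c)
    {F G : En n → ℂ} (hF : Continuous F) (hG : Continuous G) :
    Integrable fun w : En n × En n => c w * F w.1 * G w.2 := by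
  have hK : IsCompact ((Metric.closedBall (0 : En n) R) ×ˢ (Metric.closedBall (0 : En n) R)) :=
    (isCompact_closedBall _ _).prod (isCompact_closedBall _ _)
  have h1 : IntegrableOn (fun w : En n × En n => (A : ℝ) * (‖F w.1‖ * ‖G w.2‖))
      ((Metric.closedBall (0 : En n) R) ×ˢ (Metric.closedBall (0 : En n) R)) :=
    ContinuousOn.integrableOn_compact hK (by fun_prop)
  rw [← integrable_indicator_iff hK.measurableSet] at h1
  refine h1.mono ?_ ?_
  · exact ((hc.meas.mul (hF.measurable.comp measurable_fst)).mul
      (hG.measurable.comp measurable_snd)).aestronglyMeasurable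
  · refine Filter.Eventually.of_forall fun w => ?_
    by_cases h : c w = 0
    · simp [h]
    · obtain ⟨h1, h2⟩ := hc.supp w h
      rw [Set.indicator_of_mem (by simp [h1, h2]), norm_mul, norm_mul, mul_assoc,
        Real.norm_of_nonneg (by positivity)]
      gcongr
      exact hc.bound w

/-- the frozen bilinear operator -/
def fz {n : ℕ} (c : En n × En n → ℂ) (F G : En n → ℂ) (x : En n) : ℂ :=
  ∫ w : En n × En n, c w * cexp (I * ((⟪x, w.1⟫ + ⟪x, w.2⟫ : ℝ) : ℂ)) * F w.1 * G w.2

lemma FSym.sup_le {n : ℕ} {R : ℝ} {A : ℝ≥0} {c : En n × En n → ℂ} (hc : FSym R A c)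
    {F G : En n → ℂ} (hF : Continuous F) (hG : Continuous G) (x : En n) :
    ‖fz c F G x‖ₑ ^ 2 ≤ (A : ℝ≥0∞) ^ 2 * volume (Metric.closedBall (0 : En n) R) ^ 2 *
      (∫⁻ ξ in Metric.closedBall (0 : En n) R, ‖F ξ‖ₑ ^ 2) *
      (∫⁻ ξ in Metric.closedBall (0 : En n) R, ‖G ξ‖ₑ ^ 2) := by
  have hB : MeasurableSet (Metric.closedBall (0 : En n) R) :=
    Metric.isClosed_closedBall.measurableSet
  have h1 : ‖fz c F G x‖ₑ ≤ A * ((∫⁻ ξ in Metric.closedBall (0 : En n) R, ‖F ξ‖ₑ) *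
      (∫⁻ ξ in Metric.closedBall (0 : En n) R, ‖G ξ‖ₑ)) := by
    unfold fz
    refine (enorm_integral_le_lintegral_enorm _).trans ?_
    calc _ ≤ ∫⁻ w : En n × En n, A *
      ((Metric.closedBall (0 : En n) R).indicator (fun ξ => ‖F ξ‖ₑ) w.1 *
       (Metric.closedBall (0 : En n) R).indicator (fun ξ => ‖G ξ‖ₑ) w.2) := by
          refine lintegral_mono fun w => ?_
          refine le_trans (le_of_eq ?_) (hc.enorm_le F G w)
          rw [enorm_mul, enorm_mul, enorm_mul, enorm_mul, enorm_mul,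
            show ‖cexp (I * ((⟪x, w.1⟫ + ⟪x, w.2⟫ : ℝ) : ℂ))‖ₑ = 1 by
              rw [← ofReal_norm, norm_cexp_I]; simp, mul_one]
      _ = _ := by
          rw [lintegral_const_mul' _ _ (by simp)]
          congr 1
          rw [show (volume : Measure (En n × En n)) = volume.prod volume from rfl,
            lintegral_prod_mul, lintegral_indicator hB, lintegral_indicator hB]
          · exact (hF.measurable.enorm.indicator hB).aemeasurable
          · exact (hG.measurable.enorm.indicator hB).aemeasurable
  calc _ ≤ (A * ((∫⁻ ξ in Metric.closedBall (0 : En n) R, ‖F ξ‖ₑ) *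
      (∫⁻ ξ in Metric.closedBall (0 : En n) R, ‖G ξ‖ₑ))) ^ 2 := by gcongr
    _ = (A : ℝ≥0∞) ^ 2 * ((∫⁻ ξ in Metric.closedBall (0 : En n) R, ‖F ξ‖ₑ) ^ 2 *
      (∫⁻ ξ in Metric.closedBall (0 : En n) R, ‖G ξ‖ₑ) ^ 2) := by ring
    _ ≤ (A : ℝ≥0∞) ^ 2 * ((volume (Metric.closedBall (0 : En n) R) *
        (∫⁻ ξ in Metric.closedBall (0 : En n) R, ‖F ξ‖ₑ ^ 2)) *
        (volume (Metric.closedBall (0 : En n) R) *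
        (∫⁻ ξ in Metric.closedBall (0 : En n) R, ‖G ξ‖ₑ ^ 2))) := by
        gcongr
        · exact sq_setLIntegral_le _ _ hF.measurable.enorm.aemeasurable
        · exact sq_setLIntegral_le _ _ hG.measurable.enorm.aemeasurable
    _ = _ := by ring

theorem frozen_L2 (n : ℕ) : ∃ C : ℝ≥0∞, C ≠ ⊤ ∧ ∀ (R : ℝ) (A : ℝ≥0) (c : En n × En n → ℂ),
    FSym R A c → ∀ F G : En n → ℂ, Continuous F → Continuous G → ∀ R' : ℝ, 0 < R' →
    ∫⁻ x in Metric.closedBall (0 : En n) R', ‖fz c F G x‖ₑ ^ 2 ≤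
      C * (A : ℝ≥0∞) ^ 2 * volume (Metric.closedBall (0 : En n) R) *
      (∫⁻ ξ in Metric.closedBall (0 : En n) R, ‖F ξ‖ₑ ^ 2) *
      (∫⁻ ξ in Metric.closedBall (0 : En n) R, ‖G ξ‖ₑ ^ 2) := by
  obtain ⟨C, hC, hloc⟩ := ft_loc (n := n) 2 (by norm_num) le_rfl
  refine ⟨C, hC, ?_⟩
  intro R A c hc F G hF hG R' hR'
  have hB : MeasurableSet (Metric.closedBall (0 : En n) R) :=
    Metric.isClosed_closedBall.measurableSet
  set k : En n × En n → ℂ := fun w => c w * F w.1 * G w.2 with hk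
  have hkm : Measurable k := (hc.meas.mul (hF.measurable.comp measurable_fst)).mul
      (hG.measurable.comp measurable_snd)
  have hki : Integrable k (volume.prod volume) := hc.integrable hF hG
  set k' : En n × En n → ℂ := fun z => k (z.1, z.2 - z.1) with hk'
  have hk'm : Measurable k' := hkm.comp (measurable_fst.prodMk (measurable_snd.sub measurable_fst))
  have mp : MeasurePreserving (fun z : En n × En n => (z.1, z.1 + z.2))
      (volume.prod volume) (volume.prod volume) := measurePreserving_prod_add volume volume
  have me : MeasurableEmbedding (fun z : En n × En n => (z.1, z.1 + z.2)) :=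
    (MeasurableEquiv.shearAddRight (En n)).measurableEmbedding
  have hk'i : Integrable k' (volume.prod volume) := by
    rw [← mp.integrable_comp_emb me]
    refine hki.congr (Filter.Eventually.of_forall fun z => ?_)
    simp [hk']
  set H : En n → ℂ := fun ζ => ∫ ξ, k' (ξ, ζ) with hH
  have hHi : Integrable H := hk'i.integral_prod_right
  have hHm : Measurable H :=
    (StronglyMeasurable.integral_prod_left' hk'm.stronglyMeasurable).measurable
  have hfz : ∀ x, fz c F G x = ft H (-x) := by
    intro x
    have e1 : fz c F G x = ∫ z, (fun z : En n × En n => cexp (I * ((⟪x, z.2⟫ : ℝ) : ℂ)) * k' z)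
        (z.1, z.1 + z.2) ∂(volume.prod volume) := by
      unfold fz
      refine integral_congr_ae (Filter.Eventually.of_forall fun w => ?_)
      simp only [hk', hk, add_sub_cancel_left, inner_add_right]
      ring
    have hi2 : Integrable (fun z : En n × En n => cexp (I * ((⟪x, z.2⟫ : ℝ) : ℂ)) * k' z)
        (volume.prod volume) := by
      refine hk'i.mono ?_ (Filter.Eventually.of_forall fun z => ?_)
      · exact (Continuous.aestronglyMeasurable (by fun_prop)).mul hk'i.aestronglyMeasurable
      · rw [norm_mul, norm_cexp_I, one_mul]
    rw [e1]
    refine (mp.integral_comp me (fun z : En n × En n =>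
      cexp (I * ((⟪x, z.2⟫ : ℝ) : ℂ)) * k' z)).trans ?_
    rw [integral_prod_symm _ hi2]
    unfold ft
    refine integral_congr_ae (Filter.Eventually.of_forall fun ζ => ?_)
    simp only [hH]
    rw [integral_const_mul]
    congr 2
    rw [inner_neg_right, real_inner_comm]; push_cast; ring
  have h1 : ∫⁻ x in Metric.closedBall (0 : En n) R', ‖fz c F G x‖ₑ ^ 2 =
      ∫⁻ x in Metric.closedBall (0 : En n) R', ‖ft H x‖ₑ ^ 2 := by
    have mn := Measure.measurePreserving_neg (volume : Measure (En n))
    have := mn.setLIntegral_comp_preimage_emb (MeasurableEquiv.neg (En n)).measurableEmbedding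
      (fun x => ‖ft H x‖ₑ ^ 2) (Metric.closedBall (0 : En n) R')
    rw [← this]
    have hs : (Neg.neg ⁻¹' Metric.closedBall (0 : En n) R') = Metric.closedBall (0 : En n) R' := by
      ext x; simp
    rw [hs]
    refine lintegral_congr fun x => ?_
    rw [hfz]
  rw [h1]
  refine (hloc R' hR' H hHi hHm).trans ?_
  have e2 : ENNReal.ofReal R' ^ ((n : ℝ) * (2 / 2 - 1)) = 1 := by norm_num
  have e3 : ((2 : ℝ) / 2) = 1 := by norm_num
  rw [e2, e3, ENNReal.rpow_one, mul_one]
  set F' := (Metric.closedBall (0 : En n) R).indicator (fun ξ => ‖F ξ‖ₑ) with hF'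
  set G' := (Metric.closedBall (0 : En n) R).indicator (fun ξ => ‖G ξ‖ₑ) with hG'
  have hF'm : Measurable F' := hF.measurable.enorm.indicator hB
  have hG'm : Measurable G' := hG.measurable.enorm.indicator hB
  have hHb : ∀ ζ, ‖H ζ‖ₑ ^ (2 : ℝ) ≤ (A : ℝ≥0∞) ^ 2 * (volume (Metric.closedBall (0 : En n) R) *
      ∫⁻ ξ, F' ξ ^ 2 * G' (ζ - ξ) ^ 2) := by
    intro ζ
    have b1 : ‖H ζ‖ₑ ≤ A * ∫⁻ ξ in Metric.closedBall (0 : En n) R, F' ξ * G' (ζ - ξ) := by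
      refine (enorm_integral_le_lintegral_enorm _).trans ?_
      rw [← lintegral_const_mul' _ _ (by simp), ← lintegral_indicator hB]
      refine lintegral_mono fun ξ => ?_
      by_cases hξ : ξ ∈ Metric.closedBall (0 : En n) R
      · rw [Set.indicator_of_mem hξ]
        exact hc.enorm_le F G (ξ, ζ - ξ)
      · have : k' (ξ, ζ) = 0 := by
          by_contra hne
          have : c (ξ, ζ - ξ) ≠ 0 := fun h0 => hne (by simp [hk', hk, h0])
          exact hξ (by simpa using (hc.supp _ this).1)
        simp [this]
    rw [ENNReal.rpow_two]
    calc _ ≤ (A * ∫⁻ ξ in Metric.closedBall (0 : En n) R, F' ξ * G' (ζ - ξ)) ^ 2 := by gcongr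
      _ ≤ (A : ℝ≥0∞) ^ 2 * (volume (Metric.closedBall (0 : En n) R) *
          ∫⁻ ξ in Metric.closedBall (0 : En n) R, (F' ξ * G' (ζ - ξ)) ^ 2) := by
        rw [mul_pow]
        gcongr
        refine sq_setLIntegral_le _ _ (Measurable.aemeasurable ?_)
        exact hF'm.mul (hG'm.comp (measurable_const.sub measurable_id))
      _ ≤ _ := by
        refine mul_le_mul' le_rfl (mul_le_mul' le_rfl ?_)
        refine (setLIntegral_le_lintegral _ _).trans (le_of_eq ?_)
        simp_rw [mul_pow]
  have hFG : ∫⁻ ζ, ∫⁻ ξ, F' ξ ^ 2 * G' (ζ - ξ) ^ 2 = (∫⁻ ξ, F' ξ ^ 2) * ∫⁻ ξ, G' ξ ^ 2 := by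
    rw [lintegral_lintegral_swap]
    · calc _ = ∫⁻ ξ, F' ξ ^ 2 * ∫⁻ ζ, G' ζ ^ 2 := by
            refine lintegral_congr fun ξ => ?_
            have mG : Measurable fun ζ => G' (ζ - ξ) ^ 2 :=
              (hG'm.comp (measurable_id.sub measurable_const)).pow_const 2
            rw [lintegral_const_mul _ mG]
            congr 1
            exact lintegral_sub_right_eq_self (fun ζ => G' ζ ^ 2) ξ
        _ = _ := lintegral_mul_const _ (hF'm.pow_const 2)
    · exact (((hF'm.comp measurable_snd).pow_const 2).mul
        ((hG'm.comp (measurable_fst.sub measurable_snd)).pow_const 2)).aemeasurable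
  have hind : ∀ K : En n → ℂ, ∫⁻ ξ, (Metric.closedBall (0 : En n) R).indicator
      (fun ξ => ‖K ξ‖ₑ) ξ ^ 2 = ∫⁻ ξ in Metric.closedBall (0 : En n) R, ‖K ξ‖ₑ ^ 2 := by
    intro K
    rw [← lintegral_indicator hB]
    refine lintegral_congr fun ξ => ?_
    by_cases h : ξ ∈ Metric.closedBall (0 : En n) R
    · simp only [Set.indicator_of_mem h]
    · simp only [Set.indicator_of_notMem h]; simp
  have hfin : volume (Metric.closedBall (0 : En n) R) ≠ ⊤ :=
    (isCompact_closedBall _ _).measure_lt_top.ne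
  calc C * ∫⁻ ζ, ‖H ζ‖ₑ ^ (2 : ℝ)
      ≤ C * ∫⁻ ζ, (A : ℝ≥0∞) ^ 2 * (volume (Metric.closedBall (0 : En n) R) *
          ∫⁻ ξ, F' ξ ^ 2 * G' (ζ - ξ) ^ 2) := by
        gcongr with ζ
        exact hHb ζ
    _ = C * ((A : ℝ≥0∞) ^ 2 * (volume (Metric.closedBall (0 : En n) R) *
          ((∫⁻ ξ, F' ξ ^ 2) * ∫⁻ ξ, G' ξ ^ 2))) := by
        rw [lintegral_const_mul' _ _ (by simp), lintegral_const_mul' _ _ hfin, hFG]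
    _ = _ := by
        rw [hind F, hind G]; ring

/-! ### Representation in the space variable and the near `L^2` estimate -/

/-- the one dimensional weight -/
def wt (S t : ℝ) : ℝ≥0∞ := ENNReal.ofReal (S * Real.exp (-(S * |t|)))

lemma wt_meas (S : ℝ) : Measurable (wt S) := by unfold wt; fun_prop

/-- the product weight -/
def om {n : ℕ} (S : ℝ) (z : En n) : ℝ≥0∞ := ∏ i, wt S (z i)

lemma om_meas {n : ℕ} (S : ℝ) : Measurable (om S : En n → ℝ≥0∞) := by
  unfold om
  refine Finset.measurable_prod _ fun i _ => (wt_meas S).comp ?_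
  exact (by fun_prop : Continuous fun z : En n => z i).measurable

lemma wt_int {S : ℝ} (hS : 0 < S) : Integrable (fun t : ℝ => S * Real.exp (-(S * |t|))) ∧
    ∫ t : ℝ, S * Real.exp (-(S * |t|)) = 2 := by
  have h1 : ∫ t : ℝ, S * Real.exp (-(S * |t|)) = 2 := by
    have := integral_comp_abs (f := fun t => S * Real.exp (-(S * t)))
    rw [this, integral_const_mul]
    have h2 := integral_exp_mul_Ioi (a := -S) (by linarith) 0
    simp only [neg_mul] at h2
    rw [h2]
    field_simp
    simp
  refine ⟨?_, h1⟩
  by_contra h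
  rw [integral_undef h] at h1
  norm_num at h1

lemma om_lint {n : ℕ} {S : ℝ} (hS : 0 < S) : ∫⁻ z : En n, om S z = 2 ^ n := by
  have h := (PiLp.volume_preserving_toLp (Fin n)).lintegral_comp (om_meas S)
  rw [← h]
  have hi : Integrable (fun z : Fin n → ℝ => ∏ i, (S * Real.exp (-(S * |z i|)))) :=
    Integrable.fintype_prod (fun _ => (wt_int hS).1)
  have e : ∀ z : Fin n → ℝ, om S (WithLp.toLp 2 z : En n) =
      ENNReal.ofReal (∏ i, (S * Real.exp (-(S * |z i|)))) := by
    intro z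
    rw [ENNReal.ofReal_prod_of_nonneg fun i _ => by positivity]
    rfl
  simp_rw [e]
  rw [← ofReal_integral_eq_lintegral_ofReal hi
    (Filter.Eventually.of_forall fun z => Finset.prod_nonneg fun i _ => by positivity),
    integral_fintype_prod_volume_eq_prod (fun (_ : Fin n) t => S * Real.exp (-(S * |t|)))]
  simp [(wt_int hS).2, ENNReal.ofReal_pow]

lemma iterate_rep {n : ℕ} (S : ℝ) (K : List (Fin n) → En n → ℝ≥0∞)
    (hK : ∀ l, l.Sublist (List.finRange n) → Measurable (K l))
    (h : ∀ i l, (i :: l).Sublist (List.finRange n) → ∀ y, K l y ≤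
      ∫⁻ t : ℝ, wt S t * K (i :: l) (y - t • EuclideanSpace.single i 1)) (y : En n) :
    K [] y ≤ ∫⁻ z, om S z * K (List.finRange n) (y - z) := by
  have key : ∀ l : List (Fin n), l.Sublist (List.finRange n) → ∀ z : Fin n → ℝ,
      (∀ i ∈ l, z i = 0) → K [] (y - WithLp.toLp 2 z) ≤
      (∫⋯∫⁻_l.toFinset, (fun z : Fin n → ℝ => (∏ i ∈ l.toFinset, wt S (z i)) *
        K l (y - WithLp.toLp 2 z)) ∂(fun _ => volume)) z := by
    intro l
    induction l with
    | nil => intro _ z _; simp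
    | cons i l ih =>
      intro hl z hz
      have hnd : (i :: l).Nodup := hl.nodup (List.nodup_finRange n)
      have hil : i ∉ l.toFinset := by simpa using (List.nodup_cons.1 hnd).1
      have hl' : l.Sublist (List.finRange n) := (List.sublist_cons_self i l).trans hl
      refine (ih hl' z (fun j hj => hz j (List.mem_cons_of_mem _ hj))).trans ?_
      have hm : Measurable (fun z : Fin n → ℝ => (∏ i ∈ (i :: l).toFinset, wt S (z i)) *
        K (i :: l) (y - WithLp.toLp 2 z)) := by
        refine (Finset.measurable_prod _ fun i _ => (wt_meas S).comp (measurable_pi_apply i)).mul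
          ((hK _ hl).comp (measurable_const.sub ?_))
        exact (PiLp.volume_preserving_toLp (Fin n)).measurable
      rw [List.toFinset_cons] at hm ⊢
      rw [lmarginal_insert' _ hm hil]
      unfold lmarginal
      refine lintegral_mono fun y' => ?_
      set z' := Function.updateFinset z l.toFinset y' with hz'
      have hz'i : z' i = 0 := by
        rw [hz', Function.updateFinset, dif_neg hil]
        exact hz i (by simp)
      refine (mul_le_mul' le_rfl (h i l hl _)).trans ?_
      have mc : Measurable fun t : ℝ => wt S t *
          K (i :: l) (y - WithLp.toLp 2 z' - t • EuclideanSpace.single i 1) :=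
        (wt_meas S).mul ((hK _ hl).comp (by fun_prop))
      rw [← lintegral_const_mul _ mc]
      refine lintegral_mono fun t => le_of_eq ?_
      simp only
      have e1 : ∏ j ∈ l.toFinset, wt S (Function.update z' i t j) =
          ∏ j ∈ l.toFinset, wt S (z' j) :=
        Finset.prod_congr rfl fun j hj => by
          have hne : j ≠ i := fun e => hil (e ▸ hj)
          rw [Function.update_of_ne hne]
      have e2 : (WithLp.toLp 2 (Function.update z' i t) : En n) =
          WithLp.toLp 2 z' + t • EuclideanSpace.single i 1 := by
        ext j
        by_cases hj : j = i
        · subst hj; simp [hz'i]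
        · simp [hj]
      rw [Finset.prod_insert hil, Function.update_self, e1, e2, sub_sub]
      ring
  have := key _ (List.Sublist.refl _) 0 (by simp)
  rw [List.toFinset_finRange, lmarginal_univ] at this
  simp only [WithLp.toLp_zero, sub_zero] at this
  refine this.trans (le_of_eq ?_)
  have mc : Measurable fun z : En n => om S z * K (List.finRange n) (y - z) :=
    (om_meas S).mul ((hK _ (List.Sublist.refl _)).comp (measurable_const.sub measurable_id))
  exact (PiLp.volume_preserving_toLp (Fin n)).lintegral_comp mc

/-- `b` is recovered from a bounded symbol by averaging at scale `1/S` in `x`. -/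
structure XRep {n : ℕ} (S R : ℝ) (A : ℝ≥0) (b : En n → En n × En n → ℂ)
    (d : List (Fin n) → En n → En n × En n → ℂ) : Prop where
  zero : d [] = b
  meas : ∀ l, l.Sublist (List.finRange n) → Measurable fun p : En n × (En n × En n) => d l p.1 p.2
  fin : ∀ l, l.Sublist (List.finRange n) → ∃ A' : ℝ≥0, ∀ y, FSym R A' (d l y)
  bd : ∀ y, FSym R A (d (List.finRange n) y)
  rep : ∀ i l, (i :: l).Sublist (List.finRange n) → ∀ y w, d l y w =
    ∫ t in Set.Ioi (0 : ℝ), ((S * Real.exp (-(S * |t|)) : ℝ) : ℂ) *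
      d (i :: l) (y - t • EuclideanSpace.single i 1) w

lemma FSym.ball {n : ℕ} (R : ℝ) : FSym R 1
    (((Metric.closedBall (0 : En n) R) ×ˢ (Metric.closedBall (0 : En n) R)).indicator
      (fun _ => (1 : ℂ))) := by
  have hB : MeasurableSet (Metric.closedBall (0 : En n) R) :=
    Metric.isClosed_closedBall.measurableSet
  refine ⟨measurable_const.indicator (hB.prod hB), fun w => ?_, fun w hw => ?_⟩
  · by_cases h : w ∈ (Metric.closedBall (0 : En n) R) ×ˢ (Metric.closedBall (0 : En n) R)
    · simp [Set.indicator_of_mem h]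
    · simp [Set.indicator_of_notMem h]
  · by_contra h
    refine hw (Set.indicator_of_notMem (fun hm => h ?_) _)
    simpa using hm

lemma FSym.norm_le {n : ℕ} {R : ℝ} {A : ℝ≥0} {c : En n × En n → ℂ} (hc : FSym R A c)
    (F G : En n → ℂ) (w : En n × En n) :
    ‖c w * F w.1 * G w.2‖ ≤ A * ‖((Metric.closedBall (0 : En n) R) ×ˢ
      (Metric.closedBall (0 : En n) R)).indicator (fun _ => (1 : ℂ)) w * F w.1 * G w.2‖ := by
  by_cases h : c w = 0
  · simp only [h, zero_mul, norm_zero]; positivity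
  · obtain ⟨h1, h2⟩ := hc.supp w h
    rw [Set.indicator_of_mem (by simp [h1, h2]), one_mul, mul_assoc, norm_mul]
    gcongr
    exact hc.bound w

lemma XRep.step {n : ℕ} {S R : ℝ} {A : ℝ≥0} {b : En n → En n × En n → ℂ}
    {d : List (Fin n) → En n → En n × En n → ℂ} (h : XRep S R A b d) (hS : 0 < S)
    {F G : En n → ℂ} (hF : Continuous F) (hG : Continuous G) (i : Fin n) (l : List (Fin n))
    (hl : (i :: l).Sublist (List.finRange n)) (x y : En n) :
    ‖fz (d l y) F G x‖ₑ ≤ ∫⁻ t : ℝ, wt S t *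
      ‖fz (d (i :: l) (y - t • EuclideanSpace.single i 1)) F G x‖ₑ := by
  obtain ⟨A', hA'⟩ := h.fin _ hl
  set e : En n × En n → ℂ := fun w => cexp (I * ((⟪x, w.1⟫ + ⟪x, w.2⟫ : ℝ) : ℂ)) with he
  have hec : Continuous e := by fun_prop
  set p : ℝ → ℂ := fun t => ((S * Real.exp (-(S * |t|)) : ℝ) : ℂ) with hp
  have hpc : Continuous p := by fun_prop
  have hpn : ∀ t, ‖p t‖ₑ = wt S t := by
    intro t
    rw [← ofReal_norm, hp, Complex.norm_real, Real.norm_of_nonneg (by positivity)]; rfl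
  set v : En n := EuclideanSpace.single i 1 with hv
  have hintg : Integrable (fun q : (En n × En n) × ℝ => p q.2 * d (i :: l) (y - q.2 • v) q.1 * e q.1 *
      F q.1.1 * G q.1.2) ((volume : Measure (En n × En n)).prod (volume.restrict (Set.Ioi 0))) := by
    have i1 := ((FSym.ball R).integrable hF hG).norm.const_mul (A' : ℝ)
    have i2 : Integrable (fun t : ℝ => S * Real.exp (-(S * |t|))) (volume.restrict (Set.Ioi 0)) :=
      (wt_int hS).1.restrict
    refine (i1.mul_prod i2).mono' ?_ (Filter.Eventually.of_forall fun q => ?_)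
    · refine Measurable.aestronglyMeasurable ?_
      have m1 : Measurable fun q : (En n × En n) × ℝ => d (i :: l) (y - q.2 • v) q.1 :=
        (h.meas _ hl).comp (Measurable.prodMk (by fun_prop) measurable_fst)
      exact ((((hpc.measurable.comp measurable_snd).mul m1).mul
        (hec.measurable.comp measurable_fst)).mul (hF.measurable.comp (by fun_prop))).mul
        (hG.measurable.comp (by fun_prop))
    · have := (hA' (y - q.2 • v)).norm_le F G q.1
      have hp' : ‖p q.2‖ = S * Real.exp (-(S * |q.2|)) := by
        rw [hp, Complex.norm_real, Real.norm_of_nonneg (by positivity)]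
      have he' : ‖e q.1‖ = 1 := norm_cexp_I _
      calc _ = ‖d (i :: l) (y - q.2 • v) q.1 * F q.1.1 * G q.1.2‖ * ‖p q.2‖ := by
            simp only [norm_mul, he']; ring
        _ ≤ _ := by
            rw [hp']; gcongr
  have e1 : fz (d l y) F G x = ∫ t in Set.Ioi (0 : ℝ), p t *
      fz (d (i :: l) (y - t • v)) F G x := by
    calc _ = ∫ w : En n × En n, ∫ t in Set.Ioi (0 : ℝ), p t * d (i :: l) (y - t • v) w * e w *
          F w.1 * G w.2 := by
          unfold fz
          refine integral_congr_ae (Filter.Eventually.of_forall fun w => ?_)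
          simp only
          rw [h.rep i l hl, ← integral_mul_const, ← integral_mul_const, ← integral_mul_const]
      _ = ∫ t in Set.Ioi (0 : ℝ), ∫ w : En n × En n, p t * d (i :: l) (y - t • v) w * e w *
          F w.1 * G w.2 := integral_integral_swap hintg
      _ = _ := by
          refine integral_congr_ae (Filter.Eventually.of_forall fun t => ?_)
          unfold fz
          simp only
          rw [← integral_const_mul]
          refine integral_congr_ae (Filter.Eventually.of_forall fun w => ?_)
          simp only [he]; ring
  rw [e1]
  refine (enorm_integral_le_lintegral_enorm _).trans ((setLIntegral_le_lintegral _ _).trans ?_)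
  refine lintegral_mono fun t => ?_
  simp only [enorm_mul, hpn, le_refl]

lemma fz_meas {n : ℕ} {d : En n → En n × En n → ℂ}
    (hd : Measurable fun p : En n × (En n × En n) => d p.1 p.2)
    {F G : En n → ℂ} (hF : Continuous F) (hG : Continuous G) :
    Measurable fun p : En n × En n => fz (d p.1) F G p.2 := by
  unfold fz
  have m : Measurable fun q : (En n × En n) × (En n × En n) => d q.1.1 q.2 *
      cexp (I * ((⟪q.1.2, q.2.1⟫ + ⟪q.1.2, q.2.2⟫ : ℝ) : ℂ)) * F q.2.1 * G q.2.2 := by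
    have m1 : Measurable fun q : (En n × En n) × (En n × En n) => d q.1.1 q.2 :=
      hd.comp (Measurable.prodMk (by fun_prop) measurable_snd)
    have m2 : Continuous fun q : (En n × En n) × (En n × En n) =>
      cexp (I * ((⟪q.1.2, q.2.1⟫ + ⟪q.1.2, q.2.2⟫ : ℝ) : ℂ)) := by fun_prop
    exact ((m1.mul m2.measurable).mul (hF.measurable.comp (by fun_prop))).mul
        (hG.measurable.comp (by fun_prop))
  exact (StronglyMeasurable.integral_prod_right' m.stronglyMeasurable).measurable

lemma XRep.pointwise {n : ℕ} {S R : ℝ} {A : ℝ≥0} {b : En n → En n × En n → ℂ}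
    {d : List (Fin n) → En n → En n × En n → ℂ} (h : XRep S R A b d) (hS : 0 < S)
    {F G : En n → ℂ} (hF : Continuous F) (hG : Continuous G) (x : En n) :
    ‖fz (b x) F G x‖ₑ ≤ ∫⁻ y, om S (x - y) * ‖fz (d (List.finRange n) y) F G x‖ₑ := by
  have h1 := iterate_rep S (fun l y => ‖fz (d l y) F G x‖ₑ) (fun l hl =>
    (((fz_meas (h.meas l hl) hF hG).comp (measurable_id.prodMk measurable_const)).enorm))
    (fun i l hl y => h.step hS hF hG i l hl x y) x
  simp only [h.zero] at h1
  refine h1.trans (le_of_eq ?_)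
  have := lintegral_sub_left_eq_self (μ := (volume : Measure (En n)))
    (fun y => om S (x - y) * ‖fz (d (List.finRange n) y) F G x‖ₑ) x
  rw [← this]
  simp

lemma om_shift {n : ℕ} {S L : ℝ} (hS : 0 < S) (hL : 0 < L) (hSL : 1 ≤ S * L) (x x0 y : En n)
    (hx : x ∈ Metric.closedBall x0 L) :
    om S (x - y) ≤ ENNReal.ofReal (Real.exp 1 * (S * L)) ^ n * om L⁻¹ (x0 - y) := by
  unfold om
  have hc : ENNReal.ofReal (Real.exp 1 * (S * L)) ^ n =
      ∏ _i : Fin n, ENNReal.ofReal (Real.exp 1 * (S * L)) := by simp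
  rw [hc, ← Finset.prod_mul_distrib]
  refine Finset.prod_le_prod' fun i _ => ?_
  unfold wt
  rw [← ENNReal.ofReal_mul (by positivity)]
  refine ENNReal.ofReal_le_ofReal ?_
  have h1 : |x i - x0 i| ≤ L := by
    have h := PiLp.norm_apply_le (x - x0) i
    rw [mem_closedBall_iff_norm] at hx
    exact (by simpa using h : |x i - x0 i| ≤ ‖x - x0‖).trans hx
  have h2 : |x0 i - y i| ≤ |x i - y i| + L := by
    have := abs_sub_le (x0 i) (x i) (y i)
    rw [abs_sub_comm (x0 i) (x i)] at this
    linarith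
  simp only [PiLp.sub_apply]
  calc S * Real.exp (-(S * |x i - y i|)) ≤ S * Real.exp (1 - L⁻¹ * |x0 i - y i|) := by
        gcongr
        have h3 : L⁻¹ * |x0 i - y i| ≤ L⁻¹ * |x i - y i| + 1 := by
          calc _ ≤ L⁻¹ * (|x i - y i| + L) := by gcongr
            _ = _ := by field_simp
        have h4 : L⁻¹ ≤ S := by rw [inv_le_iff_one_le_mul₀ hL]; exact hSL
        have h5 : L⁻¹ * |x i - y i| ≤ S * |x i - y i| := by gcongr
        linarith
    _ = _ := by
        rw [sub_eq_add_neg, Real.exp_add]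
        field_simp

lemma sq_lintegral_wt_le {α : Type*} [MeasurableSpace α] (μ : Measure α)
    {f g : α → ℝ≥0∞} (hf : Measurable f) (hg : Measurable g) :
    (∫⁻ a, f a * g a ∂μ) ^ 2 ≤ (∫⁻ a, f a ∂μ) * ∫⁻ a, f a * g a ^ 2 ∂μ := by
  have e : ∀ a : ℝ≥0∞, a ^ (1 / 2 : ℝ) * a ^ (1 / 2 : ℝ) = a := by
    intro a
    rw [← ENNReal.rpow_add_of_nonneg _ _ (by norm_num) (by norm_num)]; norm_num
  have e' : ∀ x : ℝ≥0∞, (x ^ (1 / 2 : ℝ)) ^ 2 = x := by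
    intro x
    rw [← ENNReal.rpow_natCast, ← ENNReal.rpow_mul]; norm_num
  have h2 := sq_lintegral_mul_le μ
    (f := fun y => f y ^ (1 / 2 : ℝ)) (g := fun y => f y ^ (1 / 2 : ℝ) * g y)
    (hf.pow_const _).aemeasurable ((hf.pow_const _).mul hg).aemeasurable
  simpa only [mul_pow, e', ← mul_assoc, e] using h2

theorem near_L2 (n : ℕ) : ∃ C : ℝ≥0∞, C ≠ ⊤ ∧ ∀ (S R L : ℝ) (A : ℝ≥0) (b : En n → En n × En n → ℂ)
    (d : List (Fin n) → En n → En n × En n → ℂ), XRep S R A b d → 0 < S → 0 < L → 1 ≤ S * L →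
    ∀ F G : En n → ℂ, Continuous F → Continuous G → ∀ x0 : En n,
    ∫⁻ x in Metric.closedBall x0 L, ‖fz (b x) F G x‖ₑ ^ 2 ≤
      C * ENNReal.ofReal (S * L) ^ n * (A : ℝ≥0∞) ^ 2 * volume (Metric.closedBall (0 : En n) R) *
      (∫⁻ ξ in Metric.closedBall (0 : En n) R, ‖F ξ‖ₑ ^ 2) *
      (∫⁻ ξ in Metric.closedBall (0 : En n) R, ‖G ξ‖ₑ ^ 2) := by
  obtain ⟨C, hC, hfr⟩ := frozen_L2 n
  refine ⟨2 ^ n * (ENNReal.ofReal (Real.exp 1) ^ n * (C * 2 ^ n)), ?_, ?_⟩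
  · finiteness
  intro S R L A b d h hS hL hSL F G hF hG x0
  have hB : MeasurableSet (Metric.closedBall x0 L) := Metric.isClosed_closedBall.measurableSet
  obtain ⟨K, hK⟩ : ∃ K : En n → En n → ℝ≥0∞,
    K = fun y x => ‖fz (d (List.finRange n) y) F G x‖ₑ := ⟨_, rfl⟩
  have hKm : Measurable fun p : En n × En n => K p.1 p.2 :=
    hK ▸ (fz_meas (h.meas _ (List.Sublist.refl _)) hF hG).enorm
  set M := C * (A : ℝ≥0∞) ^ 2 * volume (Metric.closedBall (0 : En n) R) *
      (∫⁻ ξ in Metric.closedBall (0 : En n) R, ‖F ξ‖ₑ ^ 2) *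
      (∫⁻ ξ in Metric.closedBall (0 : En n) R, ‖G ξ‖ₑ ^ 2) with hM
  have hKM : ∀ y, ∫⁻ x in Metric.closedBall x0 L, K y x ^ 2 ≤ M := by
    intro y
    rw [hK]
    refine le_trans (lintegral_mono_set ?_) (hfr R A _ (h.bd y) F G hF hG (L + ‖x0‖) (by positivity))
    intro x hx
    rw [mem_closedBall_iff_norm] at hx
    rw [mem_closedBall_zero_iff]
    calc ‖x‖ = ‖(x - x0) + x0‖ := by simp
      _ ≤ _ := (norm_add_le _ _).trans (by gcongr)
  have hpt : ∀ x, ‖fz (b x) F G x‖ₑ ^ 2 ≤ 2 ^ n * ∫⁻ y, om S (x - y) * K y x ^ 2 := by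
    intro x
    have h1 : ‖fz (b x) F G x‖ₑ ≤ ∫⁻ y, om S (x - y) * K y x := by
      rw [hK]; exact h.pointwise hS hF hG x
    have mo : Measurable fun y : En n => om S (x - y) :=
      (om_meas S).comp (measurable_const.sub measurable_id)
    have mK : Measurable fun y : En n => K y x := 
      hKm.comp (f := fun y : En n => (y, x)) (measurable_id.prodMk measurable_const)
    have h2 := sq_lintegral_wt_le volume mo mK
    rw [lintegral_sub_left_eq_self (μ := (volume : Measure (En n))) (om S) x, om_lint hS] at h2
    exact (pow_le_pow_left' h1 2).trans h2
  calc _ ≤ ∫⁻ x in Metric.closedBall x0 L, 2 ^ n * ∫⁻ y, om S (x - y) * K y x ^ 2 :=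
        lintegral_mono fun x => hpt x
    _ = 2 ^ n * ∫⁻ x in Metric.closedBall x0 L, ∫⁻ y, om S (x - y) * K y x ^ 2 :=
        lintegral_const_mul' _ _ (by finiteness)
    _ ≤ 2 ^ n * ∫⁻ x in Metric.closedBall x0 L, ∫⁻ y,
          (ENNReal.ofReal (Real.exp 1 * (S * L)) ^ n * om L⁻¹ (x0 - y)) * K y x ^ 2 := by
        refine mul_le_mul' le_rfl (setLIntegral_mono' hB fun x hx => ?_)
        exact lintegral_mono fun y => mul_le_mul' (om_shift hS hL hSL x x0 y hx) le_rfl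
    _ = 2 ^ n * ∫⁻ y, ∫⁻ x in Metric.closedBall x0 L,
          (ENNReal.ofReal (Real.exp 1 * (S * L)) ^ n * om L⁻¹ (x0 - y)) * K y x ^ 2 := by
        rw [lintegral_lintegral_swap]
        refine Measurable.aemeasurable ?_
        exact (measurable_const.mul ((om_meas _).comp (measurable_const.sub measurable_snd))).mul
          ((hKm.comp measurable_swap).pow_const 2)
    _ ≤ 2 ^ n * ∫⁻ y, (ENNReal.ofReal (Real.exp 1 * (S * L)) ^ n * om L⁻¹ (x0 - y)) * M := by
        refine mul_le_mul' le_rfl (lintegral_mono fun y => ?_)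
        have mK : Measurable fun x : En n => K y x ^ 2 :=
          (hKm.comp (f := fun x : En n => (y, x)) (measurable_const.prodMk measurable_id)).pow_const 2
        rw [lintegral_const_mul _ mK]
        exact mul_le_mul' le_rfl (hKM y)
    _ = 2 ^ n * (ENNReal.ofReal (Real.exp 1 * (S * L)) ^ n * 2 ^ n * M) := by
        have mo : Measurable fun y : En n => om L⁻¹ (x0 - y) :=
          (om_meas _).comp (measurable_const.sub measurable_id)
        have mo2 : Measurable fun y : En n =>
          ENNReal.ofReal (Real.exp 1 * (S * L)) ^ n * om L⁻¹ (x0 - y) := mo.const_mul _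
        rw [lintegral_mul_const _ mo2, lintegral_const_mul _ mo,
          lintegral_sub_left_eq_self (μ := (volume : Measure (En n))) (om L⁻¹) x0,
          om_lint (inv_pos.2 hL)]
    _ = _ := by
        rw [ENNReal.ofReal_mul (by positivity), mul_pow, hM]; ring

/-! ### Kernel decay and the far part -/

/-- directional derivative on phase space -/
def ddv {n : ℕ} (v : En n × En n) (c : En n × En n → ℂ) : En n × En n → ℂ :=
  fun w => fderiv ℝ c w v

/-- oscillatory kernel -/
def kn {n : ℕ} (c : En n × En n → ℂ) (p q : En n) : ℂ :=
  ∫ w : En n × En n, c w * cexp (I * ((⟪p, w.1⟫ + ⟪q, w.2⟫ : ℝ) : ℂ))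

lemma ddv_contDiff {n : ℕ} (v : En n × En n) {c : En n × En n → ℂ}
    (hc : ContDiff ℝ (⊤ : ℕ∞) c) : ContDiff ℝ (⊤ : ℕ∞) (ddv v c) := by
  unfold ddv
  exact (hc.fderiv_right (m := (⊤ : ℕ∞)) (by simp)).clm_apply contDiff_const

lemma ddv_tsupport {n : ℕ} (v : En n × En n) (c : En n × En n → ℂ) :
    tsupport (ddv v c) ⊆ tsupport c := tsupport_fderiv_apply_subset ℝ v

lemma kn_ddv {n : ℕ} (v : En n × En n) {c : En n × En n → ℂ}
    (hc : ContDiff ℝ (⊤ : ℕ∞) c) (hs : HasCompactSupport c) (p q : En n) :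
    kn (ddv v c) p q = -(I * ((⟪p, v.1⟫ + ⟪q, v.2⟫ : ℝ) : ℂ)) * kn c p q := by
  have hd : HasCompactSupport (ddv v c) := hs.fderiv_apply ℝ v
  have hdc := (ddv_contDiff v hc).continuous
  set e : En n × En n → ℂ := fun w => cexp (I * ((⟪p, w.1⟫ + ⟪q, w.2⟫ : ℝ) : ℂ)) with he
  have hec : ContDiff ℝ (⊤ : ℕ∞) e := by
    have h1 : ContDiff ℝ (⊤ : ℕ∞) fun w : En n × En n => (⟪p, w.1⟫ + ⟪q, w.2⟫ : ℝ) :=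
      (contDiff_const.inner ℝ contDiff_fst).add (contDiff_const.inner ℝ contDiff_snd)
    have h2 : ContDiff ℝ (⊤ : ℕ∞) fun w : En n × En n => ((⟪p, w.1⟫ + ⟪q, w.2⟫ : ℝ) : ℂ) :=
      Complex.ofRealCLM.contDiff.comp h1
    exact (contDiff_const.mul h2).cexp
  have hfe : ∀ w, fderiv ℝ e w v = (I * ((⟪p, v.1⟫ + ⟪q, v.2⟫ : ℝ) : ℂ)) * e w := by
    intro w
    have hl : HasLineDerivAt ℝ e ((I * ((⟪p, v.1⟫ + ⟪q, v.2⟫ : ℝ) : ℂ)) * e w) w v := by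
      unfold HasLineDerivAt
      have : HasDerivAt (fun t : ℝ => (I * ((⟪p, w.1⟫ + ⟪q, w.2⟫ : ℝ) : ℂ)) +
          (t : ℂ) * (I * ((⟪p, v.1⟫ + ⟪q, v.2⟫ : ℝ) : ℂ)))
          (1 * (I * ((⟪p, v.1⟫ + ⟪q, v.2⟫ : ℝ) : ℂ))) 0 := by
        refine HasDerivAt.const_add _ (HasDerivAt.mul_const ?_ _)
        exact Complex.ofRealCLM.hasDerivAt
      have h2 := this.cexp
      have e1 : (fun t : ℝ => e (w + t • v)) = fun x : ℝ => cexp (I * ((⟪p, w.1⟫ + ⟪q, w.2⟫ : ℝ) : ℂ) +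
          (x : ℂ) * (I * ((⟪p, v.1⟫ + ⟪q, v.2⟫ : ℝ) : ℂ))) := by
        funext t
        simp only [he, Prod.fst_add, Prod.snd_add, Prod.smul_fst, Prod.smul_snd, inner_add_right,
          inner_smul_right]
        congr 1
        push_cast; ring
      rw [e1]
      refine h2.congr_deriv ?_
      simp only [he]
      simp [mul_comm]
    rw [← hl.lineDeriv, (hec.differentiable (by simp) w).lineDeriv_eq_fderiv]
  haveI : (volume : Measure (En n × En n)).IsAddHaarMeasure :=
    inferInstanceAs ((volume.prod volume : Measure (En n × En n)).IsAddHaarMeasure)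
  have key := integral_mul_fderiv_eq_neg_fderiv_mul_of_integrable
    (μ := (volume : Measure (En n × En n))) (f := e) (g := c) (v := v) ?_ ?_ ?_
    (fun x _ => hec.differentiable (by simp) x) (fun x _ => hc.differentiable (by simp) x)
  · simp only [hfe] at key
    unfold kn
    calc _ = ∫ x, e x * fderiv ℝ c x v := by
          refine integral_congr_ae (Filter.Eventually.of_forall fun w => ?_)
          simp only [ddv, he]; ring
      _ = _ := by
          rw [key, neg_mul, ← integral_const_mul]
          congr 1
          refine integral_congr_ae (Filter.Eventually.of_forall fun w => ?_)
          simp only [he]; ring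
  · refine Continuous.integrable_of_hasCompactSupport ?_ (hs.mul_left)
    simp only [hfe]
    exact (continuous_const.mul hec.continuous).mul hc.continuous
  · exact Continuous.integrable_of_hasCompactSupport (hec.continuous.mul hdc) (hd.mul_left)
  · exact Continuous.integrable_of_hasCompactSupport (hec.continuous.mul hc.continuous) (hs.mul_left)

lemma kn_iter {n : ℕ} (v : En n × En n) (p q : En n) (N : ℕ) : ∀ c : En n × En n → ℂ,
    ContDiff ℝ (⊤ : ℕ∞) c → HasCompactSupport c →
    kn ((ddv v)^[N] c) p q = (-(I * ((⟪p, v.1⟫ + ⟪q, v.2⟫ : ℝ) : ℂ))) ^ N * kn c p q := by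
  induction N with
  | zero => intro c _ _; simp
  | succ N ih =>
    intro c hc hs
    rw [Function.iterate_succ_apply, ih _ (ddv_contDiff v hc) (hs.fderiv_apply ℝ v),
      kn_ddv v hc hs, pow_succ, mul_assoc]

lemma ddv_iter_tsupport {n : ℕ} (v : En n × En n) (N : ℕ) : ∀ c : En n × En n → ℂ,
    tsupport ((ddv v)^[N] c) ⊆ tsupport c := by
  induction N with
  | zero => intro c; simp
  | succ N ih =>
    intro c
    rw [Function.iterate_succ_apply]
    exact (ih _).trans (ddv_tsupport v c)

lemma FSym.tsupport {n : ℕ} {R : ℝ} {A : ℝ≥0} {c : En n × En n → ℂ} (hc : FSym R A c) :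
    tsupport c ⊆ (Metric.closedBall (0 : En n) R) ×ˢ (Metric.closedBall (0 : En n) R) := by
  refine closure_minimal (fun w hw => ?_)
    (Metric.isClosed_closedBall.prod Metric.isClosed_closedBall)
  have := hc.supp w hw
  simpa using this

lemma FSym.hcs {n : ℕ} {R : ℝ} {A : ℝ≥0} {c : En n × En n → ℂ} (hc : FSym R A c) :
    HasCompactSupport c :=
  ((isCompact_closedBall _ _).prod (isCompact_closedBall _ _)).of_isClosed_subset
    (isClosed_tsupport _) hc.tsupport

lemma kn_bound {n : ℕ} {R D : ℝ} {h : En n × En n → ℂ} (hD : ∀ w, ‖h w‖ ≤ D)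
    (hs : tsupport h ⊆ (Metric.closedBall (0 : En n) R) ×ˢ (Metric.closedBall (0 : En n) R))
    (p q : En n) :
    ‖kn h p q‖ ≤ D * (volume (Metric.closedBall (0 : En n) R)).toReal ^ 2 := by
  have hD0 : 0 ≤ D := (norm_nonneg _).trans (hD 0)
  set B := (Metric.closedBall (0 : En n) R) ×ˢ (Metric.closedBall (0 : En n) R) with hBdef
  have hfin : volume B ≠ ⊤ :=
    ((isCompact_closedBall _ _).prod (isCompact_closedBall _ _)).measure_lt_top.ne
  have hvol : (volume B).toReal = (volume (Metric.closedBall (0 : En n) R)).toReal ^ 2 := by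
    rw [show (volume : Measure (En n × En n)) = volume.prod volume from rfl, Measure.prod_prod,
      ENNReal.toReal_mul, sq]
  have h1 : kn h p q = ∫ w in B, h w * cexp (I * ((⟪p, w.1⟫ + ⟪q, w.2⟫ : ℝ) : ℂ)) := by
    unfold kn
    rw [setIntegral_eq_integral_of_forall_compl_eq_zero]
    intro w hw
    have : h w = 0 := by
      by_contra h0
      exact hw (hs (subset_tsupport _ h0))
    simp [this]
  rw [h1, ← hvol]
  refine norm_setIntegral_le_of_norm_le_const hfin.lt_top fun w _ => ?_
  rw [norm_mul, norm_cexp_I, mul_one]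
  exact hD w

lemma norm_le_coord {n : ℕ} (p : En n) (hp : p ≠ 0) : ∃ i, ‖p‖ ≤ n * |p i| := by
  have hn : (Finset.univ : Finset (Fin n)).Nonempty := by
    by_contra h
    rw [Finset.not_nonempty_iff_eq_empty] at h
    refine hp ?_
    ext i
    exact absurd (Finset.mem_univ i) (h ▸ Finset.notMem_empty i)
  obtain ⟨i, _, hi⟩ := Finset.exists_max_image Finset.univ (fun i => |p i|) hn
  refine ⟨i, ?_⟩
  calc ‖p‖ = ‖∑ j, p j • (EuclideanSpace.single j (1 : ℝ) : En n)‖ := by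
        congr 1
        ext k
        simp [Finset.sum_apply, Pi.single_apply]
    _ ≤ ∑ j, |p j| := (norm_sum_le _ _).trans (Finset.sum_le_sum fun j _ => by
        simp [norm_smul])
    _ ≤ ∑ _j : Fin n, |p i| := Finset.sum_le_sum fun j hj => hi j hj
    _ = _ := by simp

lemma kn_decay {n : ℕ} {R D : ℝ} {A : ℝ≥0} {N : ℕ} {c : En n × En n → ℂ} (hc : FSym R A c)
    (hcd : ContDiff ℝ (⊤ : ℕ∞) c)
    (h1 : ∀ i w, ‖(ddv (EuclideanSpace.single i 1, 0))^[N] c w‖ ≤ D)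
    (h2 : ∀ i w, ‖(ddv (0, EuclideanSpace.single i 1))^[N] c w‖ ≤ D) (hN : 1 ≤ N) (hD : 0 ≤ D)
    (p q : En n) :
    max ‖p‖ ‖q‖ ^ N * ‖kn c p q‖ ≤
      n ^ N * (D * (volume (Metric.closedBall (0 : En n) R)).toReal ^ 2) := by
  have gen : ∀ v : En n × En n, (∀ w, ‖(ddv v)^[N] c w‖ ≤ D) →
      |⟪p, v.1⟫ + ⟪q, v.2⟫| ^ N * ‖kn c p q‖ ≤
        D * (volume (Metric.closedBall (0 : En n) R)).toReal ^ 2 := by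
    intro v hv
    have := kn_bound hv ((ddv_iter_tsupport v N c).trans hc.tsupport) p q
    rw [kn_iter v p q N c hcd hc.hcs, norm_mul, norm_pow, norm_neg, norm_mul, norm_I, one_mul,
      Complex.norm_real, Real.norm_eq_abs] at this
    exact this
  rcases max_choice ‖p‖ ‖q‖ with hm | hm
  · rw [hm]
    by_cases hp : p = 0
    · rw [hp, norm_zero, zero_pow (by omega), zero_mul]; positivity
    · obtain ⟨i, hi⟩ := norm_le_coord p hp
      have := gen _ (h1 i)
      simp only [inner_zero_right, add_zero, EuclideanSpace.inner_single_right] at this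
      simp only [conj_trivial, one_mul] at this
      calc _ ≤ (n * |p i|) ^ N * ‖kn c p q‖ := by gcongr
        _ = n ^ N * (|p i| ^ N * ‖kn c p q‖) := by rw [mul_pow]; ring
        _ ≤ _ := by gcongr
  · rw [hm]
    by_cases hp : q = 0
    · rw [hp, norm_zero, zero_pow (by omega), zero_mul]; positivity
    · obtain ⟨i, hi⟩ := norm_le_coord q hp
      have := gen _ (h2 i)
      simp only [inner_zero_right, zero_add, EuclideanSpace.inner_single_right] at this
      simp only [conj_trivial, one_mul] at this
      calc _ ≤ (n * |q i|) ^ N * ‖kn c p q‖ := by gcongr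
        _ = n ^ N * (|q i| ^ N * ‖kn c p q‖) := by rw [mul_pow]; ring
        _ ≤ _ := by gcongr

/-- the integrable majorant -/
def Gm {n : ℕ} (p : En n) : ℝ := (1 + ‖p‖) ^ (-((n : ℝ) + 1))

lemma Gm_nonneg {n : ℕ} (p : En n) : 0 ≤ Gm p := by unfold Gm; positivity

lemma Gm_cont {n : ℕ} : Continuous (Gm : En n → ℝ) := by
  unfold Gm
  refine Continuous.rpow_const (by fun_prop) fun p => Or.inl ?_
  positivity

lemma Gm_int {n : ℕ} : Integrable (Gm : En n → ℝ) := by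
  unfold Gm
  refine integrable_one_add_norm ?_
  simp

/-- kernel bound away from the diagonal -/
lemma kn_far {n : ℕ} {R D L : ℝ} {A : ℝ≥0} {N : ℕ} {c : En n × En n → ℂ} (hc : FSym R A c)
    (hcd : ContDiff ℝ (⊤ : ℕ∞) c)
    (h1 : ∀ i w, ‖(ddv (EuclideanSpace.single i 1, 0))^[N] c w‖ ≤ D)
    (h2 : ∀ i w, ‖(ddv (0, EuclideanSpace.single i 1))^[N] c w‖ ≤ D) (hN : 2 * n + 2 ≤ N)
    (hD : 0 ≤ D) (hL : 0 < L) (hL1 : L ≤ 1) (p q : En n) (hpq : L ≤ max ‖p‖ ‖q‖) :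
    ‖kn c p q‖ ≤ (2 ^ (2 * n + 2) * n ^ N * (volume (Metric.closedBall (0 : En n) R)).toReal ^ 2 *
      (D * (L ^ N)⁻¹)) * (Gm p * Gm q) := by
  have hd := kn_decay hc hcd h1 h2 (by omega) hD p q
  set V := (volume (Metric.closedBall (0 : En n) R)).toReal with hV
  set M := max ‖p‖ ‖q‖ with hM
  have hM0 : 0 < M := hL.trans_le hpq
  have hG : (1 + M) ^ (-((n : ℝ) + 1)) * (1 + M) ^ (-((n : ℝ) + 1)) ≤ Gm p * Gm q := by
    unfold Gm
    refine mul_le_mul ?_ ?_ (by positivity) (by positivity)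
    · exact Real.rpow_le_rpow_of_nonpos (by positivity) (by gcongr; exact le_max_left _ _)
        (by have : (0:ℝ) ≤ n := by positivity
            linarith)
    · exact Real.rpow_le_rpow_of_nonpos (by positivity) (by gcongr; exact le_max_right _ _)
        (by have : (0:ℝ) ≤ n := by positivity
            linarith)
  have hG2 : (1 + M) ^ (-((n : ℝ) + 1)) * (1 + M) ^ (-((n : ℝ) + 1)) =
      ((1 + M) ^ (2 * n + 2))⁻¹ := by
    rw [← Real.rpow_add (by positivity), ← Real.rpow_natCast, ← Real.rpow_neg (by positivity)]
    congr 1; push_cast; ring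
  rw [hG2] at hG
  have h3 : (1 + M) ≤ 2 * (M / L) := by
    have : 1 ≤ M / L := by rwa [one_le_div hL]
    have : M ≤ M / L := by rw [le_div_iff₀ hL]; nlinarith
    linarith
  have h4 : (1 + M) ^ (2 * n + 2) * L ^ N ≤ 2 ^ (2 * n + 2) * M ^ N := by
    have h5 : 1 ≤ M / L := by rwa [one_le_div hL]
    calc (1 + M) ^ (2 * n + 2) * L ^ N ≤ (2 * (M / L)) ^ (2 * n + 2) * L ^ N := by gcongr
      _ = 2 ^ (2 * n + 2) * ((M / L) ^ (2 * n + 2) * L ^ N) := by rw [mul_pow]; ring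
      _ ≤ 2 ^ (2 * n + 2) * ((M / L) ^ N * L ^ N) := by
          gcongr
      _ = _ := by rw [← mul_pow, div_mul_cancel₀ _ hL.ne']
  calc ‖kn c p q‖ ≤ (2 ^ (2 * n + 2) * n ^ N * V ^ 2 * (D * (L ^ N)⁻¹)) *
        ((1 + M) ^ (2 * n + 2))⁻¹ := by
        have e : (2 ^ (2 * n + 2) * n ^ N * V ^ 2 * (D * (L ^ N)⁻¹)) *
            ((1 + M) ^ (2 * n + 2))⁻¹ =
            (2 ^ (2 * n + 2) * (n ^ N * (D * V ^ 2))) / ((1 + M) ^ (2 * n + 2) * L ^ N) := by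
          field_simp
        rw [e, le_div_iff₀ (by positivity)]
        calc ‖kn c p q‖ * ((1 + M) ^ (2 * n + 2) * L ^ N) ≤
              ‖kn c p q‖ * (2 ^ (2 * n + 2) * M ^ N) := by gcongr
          _ = 2 ^ (2 * n + 2) * (M ^ N * ‖kn c p q‖) := by ring
          _ ≤ _ := by gcongr
    _ ≤ _ := by gcongr

lemma fz_kernel {n : ℕ} {R : ℝ} {A : ℝ≥0} {c : En n × En n → ℂ} (hc : FSym R A c)
    {f g : En n → ℂ} (hf : Integrable f) (hg : Integrable g) (x : En n) :
    Integrable (fun u : En n × En n => kn c (x - u.1) (x - u.2) * (f u.1 * g u.2)) ∧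
    fz c (ft f) (ft g) x = ∫ u : En n × En n, kn c (x - u.1) (x - u.2) * (f u.1 * g u.2) := by
  have i0 : Integrable c := by
    have := hc.integrable (F := fun _ => 1) (G := fun _ => 1) continuous_const continuous_const
    simpa using this
  have i1 : Integrable (fun u : En n × En n => f u.1 * g u.2) (volume.prod volume) := hf.mul_prod hg
  have i2 : Integrable (fun z : (En n × En n) × (En n × En n) => c z.1 *
      cexp (I * ((⟪x - z.2.1, z.1.1⟫ + ⟪x - z.2.2, z.1.2⟫ : ℝ) : ℂ)) * (f z.2.1 * g z.2.2))
      ((volume : Measure (En n × En n)).prod volume) := by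
    have i3 := i0.mul_prod i1
    have hcont : Continuous fun z : (En n × En n) × (En n × En n) =>
      cexp (I * ((⟪x - z.2.1, z.1.1⟫ + ⟪x - z.2.2, z.1.2⟫ : ℝ) : ℂ)) := by fun_prop
    refine (i3.mono (hcont.aestronglyMeasurable.mul i3.aestronglyMeasurable)
      (Filter.Eventually.of_forall fun z => ?_)).congr (Filter.Eventually.of_forall fun z => ?_)
    · simp only [Pi.mul_apply]
      rw [norm_mul, norm_cexp_I, one_mul]
    · simp only [Pi.mul_apply]; ring
  have e0 : ∀ u : En n × En n, kn c (x - u.1) (x - u.2) * (f u.1 * g u.2) =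
      ∫ w, c w * cexp (I * ((⟪x - u.1, w.1⟫ + ⟪x - u.2, w.2⟫ : ℝ) : ℂ)) * (f u.1 * g u.2) := by
    intro u
    unfold kn
    rw [← integral_mul_const]
  refine ⟨?_, ?_⟩
  · simp_rw [e0]
    exact i2.integral_prod_right
  · simp_rw [e0]
    refine Eq.trans ?_ (integral_integral_swap i2)
    unfold fz
    refine integral_congr_ae (Filter.Eventually.of_forall fun w => ?_)
    simp only
    unfold ft
    rw [mul_assoc, ← integral_prod_mul, ← integral_const_mul]
    refine integral_congr_ae (Filter.Eventually.of_forall fun u => ?_)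
    simp only
    have : cexp (I * ((⟪x - u.1, w.1⟫ + ⟪x - u.2, w.2⟫ : ℝ) : ℂ)) =
        cexp (I * ((⟪x, w.1⟫ + ⟪x, w.2⟫ : ℝ) : ℂ)) * (cexp (-(I * Complex.ofReal ⟪u.1, w.1⟫)) *
          cexp (-(I * Complex.ofReal ⟪u.2, w.2⟫))) := by
      rw [← Complex.exp_add, ← Complex.exp_add]
      congr 1
      rw [inner_sub_left, inner_sub_left]; push_cast; ring
    rw [this]; ring

/-- convolution with the majorant -/
def Gc {n : ℕ} (f : En n → ℂ) (x : En n) : ℝ≥0∞ :=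
  ∫⁻ u, ENNReal.ofReal (Gm (x - u)) * ‖f u‖ₑ

theorem far_bound {n : ℕ} {R L κ : ℝ} {A : ℝ≥0} {c : En n × En n → ℂ} (hc : FSym R A c)
    (hκ : 0 ≤ κ)
    (hK : ∀ p q : En n, L ≤ max ‖p‖ ‖q‖ → ‖kn c p q‖ ≤ κ * (Gm p * Gm q))
    {f g : En n → ℂ} (hf : Integrable f) (hg : Integrable g) (hfm : Measurable f)
    (hgm : Measurable g) (x0 x : En n)
    (hx : x ∈ Metric.closedBall x0 L) :
    ‖fz c (ft f) (ft g) x -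
      fz c (ft ((Metric.closedBall x0 (2 * L)).indicator f))
        (ft ((Metric.closedBall x0 (2 * L)).indicator g)) x‖ₑ ≤
      ENNReal.ofReal κ * Gc f x * Gc g x := by
  set B := Metric.closedBall x0 (2 * L) with hBdef
  have hB : MeasurableSet B := Metric.isClosed_closedBall.measurableSet
  obtain ⟨i1, e1⟩ := fz_kernel hc hf hg x
  obtain ⟨i2, e2⟩ := fz_kernel hc (hf.indicator hB) (hg.indicator hB) x
  rw [e1, e2, ← integral_sub i1 i2]
  refine (enorm_integral_le_lintegral_enorm _).trans ?_
  have mf : Measurable fun u => ENNReal.ofReal (Gm (x - u)) * ‖f u‖ₑ :=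
    (Gm_cont.measurable.comp (measurable_const.sub measurable_id)).ennreal_ofReal.mul hfm.enorm
  have mg : Measurable fun u => ENNReal.ofReal (Gm (x - u)) * ‖g u‖ₑ :=
    (Gm_cont.measurable.comp (measurable_const.sub measurable_id)).ennreal_ofReal.mul hgm.enorm
  calc _ ≤ ∫⁻ u : En n × En n, ENNReal.ofReal κ *
        ((ENNReal.ofReal (Gm (x - u.1)) * ‖f u.1‖ₑ) * (ENNReal.ofReal (Gm (x - u.2)) * ‖g u.2‖ₑ)) := by
        refine lintegral_mono fun u => ?_
        by_cases hu : u.1 ∈ B ∧ u.2 ∈ B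
        · rw [Set.indicator_of_mem hu.1, Set.indicator_of_mem hu.2]; simp
        · have hz : B.indicator f u.1 * B.indicator g u.2 = 0 := by
            by_cases h1 : u.1 ∈ B
            · rw [Set.indicator_of_notMem (fun h2 => hu ⟨h1, h2⟩), mul_zero]
            · rw [Set.indicator_of_notMem h1, zero_mul]
          have hfar : L ≤ max ‖x - u.1‖ ‖x - u.2‖ := by
            by_contra hlt
            push Not at hlt
            rw [mem_closedBall_iff_norm] at hx
            refine hu ⟨?_, ?_⟩
            · rw [hBdef, mem_closedBall_iff_norm]
              have := (le_max_left ‖x - u.1‖ ‖x - u.2‖).trans hlt.le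
              calc ‖u.1 - x0‖ = ‖(x - x0) - (x - u.1)‖ := by congr 1; abel
                _ ≤ _ := norm_sub_le _ _
                _ ≤ _ := by linarith
            · rw [hBdef, mem_closedBall_iff_norm]
              have := (le_max_right ‖x - u.1‖ ‖x - u.2‖).trans hlt.le
              calc ‖u.2 - x0‖ = ‖(x - x0) - (x - u.2)‖ := by congr 1; abel
                _ ≤ _ := norm_sub_le _ _
                _ ≤ _ := by linarith
          rw [hz, mul_zero, sub_zero, enorm_mul, enorm_mul]
          have := ENNReal.ofReal_le_ofReal (hK _ _ hfar)
          rw [ofReal_norm, ENNReal.ofReal_mul hκ, ENNReal.ofReal_mul (Gm_nonneg _)] at this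
          calc _ ≤ ENNReal.ofReal κ * (ENNReal.ofReal (Gm (x - u.1)) * ENNReal.ofReal (Gm (x - u.2))) *
                (‖f u.1‖ₑ * ‖g u.2‖ₑ) := by gcongr
            _ = _ := by ring
    _ = _ := by
        rw [lintegral_const_mul' _ _ (by simp),
          show (volume : Measure (En n × En n)) = volume.prod volume from rfl,
          lintegral_prod_mul mf.aemeasurable mg.aemeasurable, mul_assoc]
        rfl


/-- `U` has `L^q` norm at most `N`. -/
def LqB {n : ℕ} (U : En n → ℝ≥0∞) (q N : ℝ≥0∞) : Prop :=
  (q = ⊤ → ∀ᵐ x, U x ≤ N) ∧ (q ≠ ⊤ → ∫⁻ x, U x ^ q.toReal ≤ N ^ q.toReal)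

lemma LqB.const_of_top {n : ℕ} {U W : En n → ℝ≥0∞} {q N1 N2 : ℝ≥0∞} {r : ℝ} (hr : 0 < r)
    (hU : LqB U ⊤ N1) (hW : LqB W q N2) (hWm : Measurable W) (hq : q ≠ ⊤) (hqr : q.toReal = r) :
    ∫⁻ x, (U x * W x) ^ r ≤ (N1 * N2) ^ r := by
  have h1 := hU.1 rfl
  have h2 := hW.2 hq
  rw [hqr] at h2
  calc ∫⁻ x, (U x * W x) ^ r ≤ ∫⁻ x, N1 ^ r * W x ^ r := by
        refine lintegral_mono_ae ?_
        filter_upwards [h1] with x hx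
        rw [ENNReal.mul_rpow_of_nonneg _ _ hr.le]
        exact mul_le_mul' (ENNReal.rpow_le_rpow hx hr.le) le_rfl
    _ = N1 ^ r * ∫⁻ x, W x ^ r := lintegral_const_mul _ (hWm.pow_const r)
    _ ≤ N1 ^ r * N2 ^ r := mul_le_mul' le_rfl h2
    _ = (N1 * N2) ^ r := (ENNReal.mul_rpow_of_nonneg _ _ hr.le).symm

lemma LqB.holder {n : ℕ} {U W : En n → ℝ≥0∞} {q1 q2 N1 N2 : ℝ≥0∞} {r : ℝ} (hr : 0 < r)
    (h1 : 1 ≤ q1) (h2 : 1 ≤ q2)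
    (hrq : 1 / r = q1⁻¹.toReal + q2⁻¹.toReal) (hU : LqB U q1 N1) (hW : LqB W q2 N2)
    (hUm : Measurable U) (hWm : Measurable W) :
    ∫⁻ x, (U x * W x) ^ r ≤ (N1 * N2) ^ r := by
  have hrpos : 0 < 1 / r := by positivity
  by_cases t1 : q1 = ⊤
  · subst t1
    have t2 : q2 ≠ ⊤ := by
      rintro rfl
      simp at hrq; linarith
    refine LqB.const_of_top hr hU hW hWm t2 ?_
    simp only [ENNReal.inv_top, ENNReal.toReal_zero, zero_add, ENNReal.toReal_inv] at hrq
    rw [one_div] at hrq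
    exact (inv_injective hrq).symm
  by_cases t2 : q2 = ⊤
  · subst t2
    have := LqB.const_of_top (q := q1) hr hW hU hUm t1 (by
      simp only [ENNReal.inv_top, ENNReal.toReal_zero, add_zero, ENNReal.toReal_inv] at hrq
      rw [one_div] at hrq
      exact (inv_injective hrq).symm)
    simpa only [mul_comm] using this
  have k1 : 0 < q1.toReal := ENNReal.toReal_pos (by positivity) t1
  have k2 : 0 < q2.toReal := ENNReal.toReal_pos (by positivity) t2
  have hU' := hU.2 t1
  have hW' := hW.2 t2
  rw [ENNReal.toReal_inv, ENNReal.toReal_inv] at hrq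
  have hs : r / q1.toReal + r / q2.toReal = 1 := by
    rw [div_eq_mul_inv, div_eq_mul_inv, ← mul_add, ← hrq]; field_simp
  have h := ENNReal.lintegral_mul_norm_pow_le (μ := (volume : Measure (En n)))
    (f := fun x => U x ^ q1.toReal) (g := fun x => W x ^ q2.toReal)
    (hUm.pow_const _).aemeasurable (hWm.pow_const _).aemeasurable
    (p := r / q1.toReal) (q := r / q2.toReal) (by positivity) (by positivity) hs
  have e1 : ∀ x : ℝ≥0∞, (x ^ q1.toReal) ^ (r / q1.toReal) = x ^ r := by
    intro x; rw [← ENNReal.rpow_mul]; congr 1; field_simp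
  have e2 : ∀ x : ℝ≥0∞, (x ^ q2.toReal) ^ (r / q2.toReal) = x ^ r := by
    intro x; rw [← ENNReal.rpow_mul]; congr 1; field_simp
  simp only [e1, e2] at h
  calc ∫⁻ x, (U x * W x) ^ r = ∫⁻ x, U x ^ r * W x ^ r := by
        refine lintegral_congr fun x => ENNReal.mul_rpow_of_nonneg _ _ hr.le
    _ ≤ _ := h
    _ ≤ (N1 ^ q1.toReal) ^ (r / q1.toReal) * (N2 ^ q2.toReal) ^ (r / q2.toReal) := by
        refine mul_le_mul' (ENNReal.rpow_le_rpow hU' (by positivity))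
          (ENNReal.rpow_le_rpow hW' (by positivity))
    _ = _ := by rw [e1, e2, ENNReal.mul_rpow_of_nonneg _ _ hr.le]

/-- Local `L^q` norms. -/
lemma LqB.local {n : ℕ} {f : En n → ℂ} (hf : Measurable f) {q : ℝ≥0∞} (hq : 1 ≤ q) (L : ℝ) :
    ∃ U : En n → ℝ≥0∞, Measurable U ∧
      (∀ x0, eLpNorm f q (volume.restrict (Metric.closedBall x0 L)) ≤ U x0) ∧
      LqB U q (volume (Metric.closedBall (0 : En n) L) ^ q⁻¹.toReal * eLpNorm f q volume) := by
  by_cases t : q = ⊤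
  · subst t
    refine ⟨fun _ => eLpNorm f ⊤ volume, measurable_const, fun x0 => ?_, fun _ => ?_, fun h => absurd rfl h⟩
    · exact eLpNorm_mono_measure _ Measure.restrict_le_self
    · simp
  have k : 0 < q.toReal := ENNReal.toReal_pos (by positivity) t
  have q0 : q ≠ 0 := by positivity
  have hmeas : Measurable fun x0 : En n => ∫⁻ u, (Metric.closedBall (0 : En n) L).indicator
      (fun _ => (1 : ℝ≥0∞)) (u - x0) * ‖f u‖ₑ ^ q.toReal := by
    refine Measurable.lintegral_prod_right' (f := fun p : En n × En n =>
      (Metric.closedBall (0 : En n) L).indicator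
      (fun _ => (1 : ℝ≥0∞)) (p.2 - p.1) * ‖f p.2‖ₑ ^ q.toReal) ?_
    refine Measurable.mul ?_ ((hf.comp measurable_snd).enorm.pow_const _)
    exact (measurable_const.indicator Metric.isClosed_closedBall.measurableSet).comp
      (measurable_snd.sub measurable_fst)
  have hval : ∀ x0, ∫⁻ u in Metric.closedBall x0 L, ‖f u‖ₑ ^ q.toReal =
      ∫⁻ u, (Metric.closedBall (0 : En n) L).indicator
      (fun _ => (1 : ℝ≥0∞)) (u - x0) * ‖f u‖ₑ ^ q.toReal := by
    intro x0
    rw [← lintegral_indicator Metric.isClosed_closedBall.measurableSet]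
    refine lintegral_congr fun u => ?_
    by_cases h : u ∈ Metric.closedBall x0 L
    · have h' : u - x0 ∈ Metric.closedBall (0 : En n) L := by
        simpa [dist_eq_norm] using h
      rw [Set.indicator_of_mem h, Set.indicator_of_mem h', one_mul]
    · have h' : u - x0 ∉ Metric.closedBall (0 : En n) L := by
        simpa [dist_eq_norm] using h
      rw [Set.indicator_of_notMem h, Set.indicator_of_notMem h', zero_mul]
  refine ⟨fun x0 => (∫⁻ u in Metric.closedBall x0 L, ‖f u‖ₑ ^ q.toReal) ^ (1 / q.toReal), ?_, ?_, ?_, ?_⟩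
  · simp only [hval]; exact hmeas.pow_const _
  · intro x0
    rw [eLpNorm_eq_lintegral_rpow_enorm_toReal q0 t]
  · intro h; exact absurd h t
  · intro _
    have e1 : ∀ x : ℝ≥0∞, (x ^ (1 / q.toReal)) ^ q.toReal = x := by
      intro x; rw [← ENNReal.rpow_mul, one_div_mul_cancel k.ne', ENNReal.rpow_one]
    simp only [e1, hval]
    rw [ENNReal.mul_rpow_of_nonneg _ _ k.le, ENNReal.toReal_inv,
      eLpNorm_eq_lintegral_rpow_enorm_toReal q0 t, ← one_div, e1, e1]
    rw [lintegral_lintegral_swap]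
    · have : ∀ u : En n, ∫⁻ x0 : En n, (Metric.closedBall (0 : En n) L).indicator
        (fun _ => (1 : ℝ≥0∞)) (u - x0) * ‖f u‖ₑ ^ q.toReal =
          volume (Metric.closedBall (0 : En n) L) * ‖f u‖ₑ ^ q.toReal := by
        intro u
        have mi : Measurable fun x0 : En n => (Metric.closedBall (0 : En n) L).indicator
            (fun _ => (1 : ℝ≥0∞)) (u - x0) :=
          (measurable_const.indicator Metric.isClosed_closedBall.measurableSet).comp
            (measurable_const.sub measurable_id)
        rw [lintegral_mul_const _ mi, lintegral_sub_left_eq_self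
          (fun v => (Metric.closedBall (0 : En n) L).indicator (fun _ => (1 : ℝ≥0∞)) v) u,
          lintegral_indicator_const Metric.isClosed_closedBall.measurableSet, one_mul]
      simp only [this]
      rw [lintegral_const_mul _ (hf.enorm.pow_const _)]
    · refine Measurable.aemeasurable ?_
      refine Measurable.mul ?_ ((hf.comp measurable_snd).enorm.pow_const _)
      exact (measurable_const.indicator Metric.isClosed_closedBall.measurableSet).comp
        (measurable_snd.sub measurable_fst)

lemma Gc_meas {n : ℕ} {f : En n → ℂ} (hf : Measurable f) : Measurable (Gc f) := by
  unfold Gc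
  refine Measurable.lintegral_prod_right' (f := fun p : En n × En n =>
      ENNReal.ofReal (Gm (p.1 - p.2)) * ‖f p.2‖ₑ) ?_
  refine Measurable.mul ?_ (hf.comp measurable_snd).enorm
  exact (Gm_cont.measurable.comp (measurable_fst.sub measurable_snd)).ennreal_ofReal

lemma LqB.young (n : ℕ) : ∃ K : ℝ≥0∞, K ≠ ⊤ ∧ ∀ (f : En n → ℂ), Measurable f → ∀ q : ℝ≥0∞, 1 ≤ q →
    LqB (Gc f) q (K * eLpNorm f q volume) := by
  set K : ℝ≥0∞ := ∫⁻ z : En n, ENNReal.ofReal (Gm z) with hK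
  have hKt : K ≠ ⊤ := (Gm_int (n := n)).lintegral_lt_top.ne
  have mG : Measurable fun z : En n => ENNReal.ofReal (Gm z) := Gm_cont.measurable.ennreal_ofReal
  refine ⟨K, hKt, fun f hf q hq => ⟨?_, ?_⟩⟩
  · rintro rfl
    refine Filter.Eventually.of_forall fun x => ?_
    unfold Gc
    have hle : ∀ᵐ u : En n, ‖f u‖ₑ ≤ eLpNorm f ⊤ volume := by
      rw [eLpNorm_exponent_top]; exact ae_le_eLpNormEssSup
    have m1 : Measurable fun u : En n => ENNReal.ofReal (Gm (x - u)) :=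
      mG.comp (measurable_const.sub measurable_id)
    calc ∫⁻ u, ENNReal.ofReal (Gm (x - u)) * ‖f u‖ₑ
        ≤ ∫⁻ u, ENNReal.ofReal (Gm (x - u)) * eLpNorm f ⊤ volume := by
          refine lintegral_mono_ae ?_
          filter_upwards [hle] with u hu
          exact mul_le_mul' le_rfl hu
      _ = K * eLpNorm f ⊤ volume := by
          rw [lintegral_mul_const _ m1, hK,
            lintegral_sub_left_eq_self (fun z => ENNReal.ofReal (Gm z)) x]
  · intro t
    have q0 : q ≠ 0 := by positivity
    have k1 : 1 ≤ q.toReal := by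
      have := ENNReal.toReal_mono t hq
      simpa using this
    have k : 0 < q.toReal := by linarith
    have pt : ∀ x, Gc f x ^ q.toReal ≤ K ^ (q.toReal - 1) *
        ∫⁻ u, ENNReal.ofReal (Gm (x - u)) * ‖f u‖ₑ ^ q.toReal := by
      intro x
      have m1 : Measurable fun u : En n => ENNReal.ofReal (Gm (x - u)) :=
        mG.comp (measurable_const.sub measurable_id)
      have h := ENNReal.lintegral_mul_norm_pow_le (μ := (volume : Measure (En n)))
        (f := fun u => ENNReal.ofReal (Gm (x - u)))
        (g := fun u => ENNReal.ofReal (Gm (x - u)) * ‖f u‖ₑ ^ q.toReal)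
        m1.aemeasurable (m1.mul (hf.enorm.pow_const _)).aemeasurable
        (p := 1 - 1 / q.toReal) (q := 1 / q.toReal)
        (by rw [sub_nonneg, div_le_one k]; exact k1) (by positivity) (by ring)
      have e : ∀ u, ENNReal.ofReal (Gm (x - u)) ^ (1 - 1 / q.toReal) *
          (ENNReal.ofReal (Gm (x - u)) * ‖f u‖ₑ ^ q.toReal) ^ (1 / q.toReal) =
          ENNReal.ofReal (Gm (x - u)) * ‖f u‖ₑ := by
        intro u
        rw [ENNReal.mul_rpow_of_nonneg _ _ (by positivity : 0 ≤ 1 / q.toReal), ← mul_assoc,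
          ← ENNReal.rpow_add_of_nonneg _ _ (by rw [sub_nonneg, div_le_one k]; exact k1)
            (by positivity), ← ENNReal.rpow_mul, mul_one_div_cancel k.ne', ENNReal.rpow_one]
        congr 1
        rw [sub_add_cancel, ENNReal.rpow_one]
      simp only [e] at h
      rw [lintegral_sub_left_eq_self (fun z : En n => ENNReal.ofReal (Gm z)) x, ← hK] at h
      have h2 := ENNReal.rpow_le_rpow h k.le
      rw [ENNReal.mul_rpow_of_nonneg _ _ k.le, ← ENNReal.rpow_mul, ← ENNReal.rpow_mul,
        one_div_mul_cancel k.ne', ENNReal.rpow_one] at h2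
      have e3 : (1 - 1 / q.toReal) * q.toReal = q.toReal - 1 := by field_simp
      rw [e3] at h2
      exact h2
    have e1 : ∀ x : ℝ≥0∞, (x ^ (1 / q.toReal)) ^ q.toReal = x := by
      intro x; rw [← ENNReal.rpow_mul, one_div_mul_cancel k.ne', ENNReal.rpow_one]
    have mj : Measurable fun p : En n × En n =>
        ENNReal.ofReal (Gm (p.1 - p.2)) * ‖f p.2‖ₑ ^ q.toReal := by
      refine Measurable.mul ?_ ((hf.comp measurable_snd).enorm.pow_const _)
      exact mG.comp (measurable_fst.sub measurable_snd)
    have mj' : Measurable fun x : En n => ∫⁻ u : En n,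
        ENNReal.ofReal (Gm (x - u)) * ‖f u‖ₑ ^ q.toReal := mj.lintegral_prod_right'
    refine (lintegral_mono pt).trans ?_
    rw [lintegral_const_mul _ mj', lintegral_lintegral_swap mj.aemeasurable]
    have : ∀ u : En n, ∫⁻ x : En n, ENNReal.ofReal (Gm (x - u)) * ‖f u‖ₑ ^ q.toReal =
        K * ‖f u‖ₑ ^ q.toReal := by
      intro u
      have m1 : Measurable fun x : En n => ENNReal.ofReal (Gm (x - u)) :=
        mG.comp (measurable_id.sub measurable_const)
      rw [lintegral_mul_const _ m1, hK,
        lintegral_sub_right_eq_self (fun z : En n => ENNReal.ofReal (Gm z)) u]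
    simp only [this]
    rw [lintegral_const_mul _ (hf.enorm.pow_const _), ENNReal.mul_rpow_of_nonneg _ _ k.le,
      eLpNorm_eq_lintegral_rpow_enorm_toReal q0 t, e1, ← mul_assoc]
    refine mul_le_mul' (le_of_eq ?_) le_rfl
    nth_rw 2 [← ENNReal.rpow_one K]
    rw [← ENNReal.rpow_add_of_nonneg _ _ (by linarith) zero_le_one, sub_add_cancel]


lemma vol_ball (n : ℕ) (x : En n) {c lam e : ℝ} (hc : 0 < c) (hl : 0 < lam) :
    volume (Metric.closedBall x (c * lam ^ e)) =
      ENNReal.ofReal c ^ (n : ℝ) * volume (Metric.ball (0 : En n) 1) *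
        ENNReal.ofReal lam ^ (e * n) := by
  rw [Measure.addHaar_closedBall _ _ (by positivity)]
  rw [finrank_euclideanSpace_fin, ENNReal.ofReal_pow (by positivity),
    ENNReal.ofReal_mul hc.le, ← ENNReal.ofReal_rpow_of_pos hl, mul_pow, ENNReal.rpow_mul]
  simp only [ENNReal.rpow_natCast]
  ring

lemma ball_ne_top (n : ℕ) : volume (Metric.ball (0 : En n) 1) ≠ ⊤ := measure_ball_lt_top.ne

lemma ball_ne_zero (n : ℕ) : volume (Metric.ball (0 : En n) 1) ≠ 0 :=
  (Metric.measure_ball_pos _ _ one_pos).ne'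

theorem ft_loc_q {n : ℕ} (p : ℝ) (hp1 : 1 ≤ p) (hp2 : p ≤ 2) (q : ℝ≥0∞)
    (hpq : ENNReal.ofReal p ≤ q) (l : ℝ) :
    ∃ C : ℝ≥0∞, C ≠ ⊤ ∧ ∀ lam : ℝ, 0 < lam → ∀ (x0 : En n) (f : En n → ℂ), Integrable f →
      Measurable f →
      ∫⁻ ξ in Metric.closedBall (0 : En n) (2 * lam),
        ‖ft ((Metric.closedBall x0 (2 * lam ^ (-l))).indicator f) ξ‖ₑ ^ 2 ≤
      C * ENNReal.ofReal lam ^ ((n : ℝ) * (2 / p - 1) - l * n * (2 / p - 2 * q⁻¹.toReal)) *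
        (eLpNorm f q (volume.restrict (Metric.closedBall x0 (2 * lam ^ (-l))))) ^ 2 := by
  obtain ⟨C, hC, h⟩ := ft_loc (n := n) p hp1 hp2
  have p0 : 0 < p := by linarith
  have hq0 : q ≠ 0 := by
    rintro rfl
    simp at hpq; linarith
  have hpq' : q⁻¹.toReal ≤ 1 / p := by
    have h1 : q⁻¹ ≤ (ENNReal.ofReal p)⁻¹ := ENNReal.inv_le_inv.2 hpq
    have h2 := ENNReal.toReal_mono (by simp [p0]) h1
    rw [ENNReal.toReal_inv (ENNReal.ofReal p), ENNReal.toReal_ofReal p0.le] at h2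
    rw [one_div p]; exact h2
  obtain ⟨V, hV⟩ : ∃ V, V = ENNReal.ofReal 2 ^ (n : ℝ) * volume (Metric.ball (0 : En n) 1) := ⟨_, rfl⟩
  have hVt : V ≠ ⊤ := by
    rw [hV]; exact ENNReal.mul_ne_top (by simp) (ball_ne_top n)
  refine ⟨C * 2 ^ ((n : ℝ) * (2 / p - 1)) * (V ^ (1 / p - q⁻¹.toReal)) ^ 2, ?_, ?_⟩
  · refine ENNReal.mul_ne_top (ENNReal.mul_ne_top hC (ENNReal.rpow_ne_top_of_nonneg ?_ (by simp)))
      (ENNReal.pow_ne_top (ENNReal.rpow_ne_top_of_nonneg (by linarith) hVt))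
    have : 1 ≤ 2 / p := by rw [le_div_iff₀ p0]; linarith
    have : (0 : ℝ) ≤ n := by positivity
    nlinarith
  intro lam hl x0 f hf hfm
  have hL0 : 0 < lam ^ (-l) := by positivity
  set B := Metric.closedBall x0 (2 * lam ^ (-l)) with hB
  have hBm : MeasurableSet B := Metric.isClosed_closedBall.measurableSet
  have l0 : ENNReal.ofReal lam ≠ 0 := by simpa using hl
  have lt : ENNReal.ofReal lam ≠ ⊤ := ENNReal.ofReal_ne_top
  have h1 := h (2 * lam) (by positivity) (B.indicator f) (hf.indicator hBm) (hfm.indicator hBm)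
  have h2 : (∫⁻ u, ‖B.indicator f u‖ₑ ^ p) ^ (2 / p) =
      (eLpNorm f (ENNReal.ofReal p) (volume.restrict B)) ^ 2 := by
    rw [eLpNorm_eq_lintegral_rpow_enorm_toReal (by simpa using p0) ENNReal.ofReal_ne_top,
      ENNReal.toReal_ofReal p0.le, ← ENNReal.rpow_natCast, ← ENNReal.rpow_mul,
      ← lintegral_indicator hBm]
    congr 1
    · refine lintegral_congr fun u => ?_
      by_cases hu : u ∈ B
      · rw [Set.indicator_of_mem hu, Set.indicator_of_mem hu]
      · rw [Set.indicator_of_notMem hu, Set.indicator_of_notMem hu]; simp [p0]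
    · push_cast; ring
  have h3 : eLpNorm f (ENNReal.ofReal p) (volume.restrict B) ≤
      eLpNorm f q (volume.restrict B) * volume B ^ (1 / p - q⁻¹.toReal) := by
    have := eLpNorm_le_eLpNorm_mul_rpow_measure_univ (μ := volume.restrict B) hpq
      (hfm.aestronglyMeasurable)
    rwa [ENNReal.toReal_ofReal p0.le, Measure.restrict_apply_univ, one_div q.toReal,
      ← ENNReal.toReal_inv] at this
  rw [h2] at h1
  refine h1.trans ?_
  have hv : volume B = V * ENNReal.ofReal lam ^ (-l * n) := by
    rw [hB, hV, vol_ball n x0 two_pos hl]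
  rw [hv, ENNReal.mul_rpow_of_nonneg _ _ (by linarith), ← ENNReal.rpow_mul] at h3
  have h4 : ENNReal.ofReal (2 * lam) ^ ((n : ℝ) * (2 / p - 1)) =
      2 ^ ((n : ℝ) * (2 / p - 1)) * ENNReal.ofReal lam ^ ((n : ℝ) * (2 / p - 1)) := by
    rw [ENNReal.ofReal_mul zero_le_two, ENNReal.mul_rpow_of_ne_top (by simp) lt]; simp
  rw [h4]
  have h5 : ENNReal.ofReal lam ^ ((n : ℝ) * (2 / p - 1) - l * n * (2 / p - 2 * q⁻¹.toReal)) =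
      ENNReal.ofReal lam ^ ((n : ℝ) * (2 / p - 1)) *
        (ENNReal.ofReal lam ^ (-l * n * (1 / p - q⁻¹.toReal))) ^ 2 := by
    rw [← ENNReal.rpow_natCast, ← ENNReal.rpow_mul, ← ENNReal.rpow_add _ _ l0 lt]
    congr 1; push_cast; ring
  rw [h5]
  refine (mul_le_mul' le_rfl (pow_le_pow_left' h3 2)).trans (le_of_eq ?_)
  ring

set_option maxHeartbeats 1600000 in
theorem near_r {n : ℕ} (m s l σ r p1 p2 : ℝ) (q1 q2 : ℝ≥0∞) (hr : 0 < r)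
    (hp11 : 1 ≤ p1) (hp12 : p1 ≤ 2) (hp21 : 1 ≤ p2) (hp22 : p2 ≤ 2)
    (hq1 : ENNReal.ofReal p1 ≤ q1) (hq2 : ENNReal.ofReal p2 ≤ q2) (hls : l ≤ s)
    (e : ℝ) (he : e = 2 * m + ((n : ℝ) * (2 / p1 - 1) - l * n * (2 / p1 - 2 * q1⁻¹.toReal)) +
      ((n : ℝ) * (2 / p2 - 1) - l * n * (2 / p2 - 2 * q2⁻¹.toReal)))
    (hE : (r ≤ 2 ∧ (e + (s - l) * n + n) * (r / 2) - l * n * (1 - r / 2) ≤ -σ * r) ∨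
      (2 < r ∧ (e + 2 * n) * ((r - 2) / 2) + (e + (s - l) * n + n) ≤ -σ * r))
    (A0 : ℝ≥0∞) (hA0 : A0 ≠ ⊤) :
    ∃ C : ℝ≥0∞, C ≠ ⊤ ∧ ∀ (lam : ℝ) (A : ℝ≥0) (b : En n → En n × En n → ℂ)
      (d : List (Fin n) → En n → En n × En n → ℂ), 1 ≤ lam → XRep (lam ^ s) (2 * lam) A b d →
      (∀ y, FSym (2 * lam) A (b y)) → (A : ℝ≥0∞) ≤ A0 * ENNReal.ofReal lam ^ m →
      ∀ f g : En n → ℂ, Integrable f → Integrable g → Measurable f → Measurable g → ∀ x0 : En n,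
      ∫⁻ x in Metric.closedBall x0 (lam ^ (-l)),
        ‖fz (b x) (ft ((Metric.closedBall x0 (2 * lam ^ (-l))).indicator f))
          (ft ((Metric.closedBall x0 (2 * lam ^ (-l))).indicator g)) x‖ₑ ^ r ≤
      C * ENNReal.ofReal lam ^ (-σ * r) *
        (eLpNorm f q1 (volume.restrict (Metric.closedBall x0 (2 * lam ^ (-l)))) *
         eLpNorm g q2 (volume.restrict (Metric.closedBall x0 (2 * lam ^ (-l))))) ^ r := by
  obtain ⟨C1, hC1, hf1⟩ := ft_loc_q (n := n) p1 hp11 hp12 q1 hq1 l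
  obtain ⟨C2, hC2, hf2⟩ := ft_loc_q (n := n) p2 hp21 hp22 q2 hq2 l
  obtain ⟨CN, hCN, hN⟩ := near_L2 n
  obtain ⟨V, hV⟩ : ∃ V, V = ENNReal.ofReal 2 ^ (n : ℝ) * volume (Metric.ball (0 : En n) 1) := ⟨_, rfl⟩
  have hVt : V ≠ ⊤ := by
    rw [hV]; exact ENNReal.mul_ne_top (by simp) (ball_ne_top n)
  obtain ⟨V1, hV1⟩ : ∃ V, V = ENNReal.ofReal 1 ^ (n : ℝ) * volume (Metric.ball (0 : En n) 1) := ⟨_, rfl⟩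
  have hV1t : V1 ≠ ⊤ := by
    rw [hV1]; exact ENNReal.mul_ne_top (by simp) (ball_ne_top n)
  obtain ⟨K2, hK2⟩ : ∃ K, K = CN * A0 ^ 2 * V * C1 * C2 := ⟨_, rfl⟩
  obtain ⟨Ki, hKi⟩ : ∃ K, K = A0 ^ 2 * V ^ 2 * C1 * C2 := ⟨_, rfl⟩
  have hK2t : K2 ≠ ⊤ := by
    rw [hK2]
    exact ENNReal.mul_ne_top (ENNReal.mul_ne_top (ENNReal.mul_ne_top (ENNReal.mul_ne_top hCN
      (ENNReal.pow_ne_top hA0)) hVt) hC1) hC2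
  have hKit : Ki ≠ ⊤ := by
    rw [hKi]
    exact ENNReal.mul_ne_top (ENNReal.mul_ne_top (ENNReal.mul_ne_top 
      (ENNReal.pow_ne_top hA0) (ENNReal.pow_ne_top hVt)) hC1) hC2
  -- the two basic bounds
  have key : ∀ (lam : ℝ) (A : ℝ≥0) (b : En n → En n × En n → ℂ)
      (d : List (Fin n) → En n → En n × En n → ℂ), 1 ≤ lam → XRep (lam ^ s) (2 * lam) A b d →
      (∀ y, FSym (2 * lam) A (b y)) → (A : ℝ≥0∞) ≤ A0 * ENNReal.ofReal lam ^ m →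
      ∀ f g : En n → ℂ, Integrable f → Integrable g → Measurable f → Measurable g → ∀ x0 : En n,
      ∀ N : En n → ℂ, (N = fun x => fz (b x) (ft ((Metric.closedBall x0 (2 * lam ^ (-l))).indicator f))
          (ft ((Metric.closedBall x0 (2 * lam ^ (-l))).indicator g)) x) →
      ∀ Q : ℝ≥0∞, Q = (eLpNorm f q1 (volume.restrict (Metric.closedBall x0 (2 * lam ^ (-l)))) *
         eLpNorm g q2 (volume.restrict (Metric.closedBall x0 (2 * lam ^ (-l))))) →
      Measurable N ∧
      (∫⁻ x in Metric.closedBall x0 (lam ^ (-l)), ‖N x‖ₑ ^ 2 ≤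
        K2 * ENNReal.ofReal lam ^ (e + (s - l) * n + n) * Q ^ 2) ∧
      (∀ x, ‖N x‖ₑ ^ 2 ≤ Ki * ENNReal.ofReal lam ^ (e + 2 * n) * Q ^ 2) ∧
      volume (Metric.closedBall x0 (lam ^ (-l))) = V1 * ENNReal.ofReal lam ^ (-l * n) := by
    intro lam A b d hlam hX hb hA f g hf hg hfm hgm x0 N hNdef Q hQ
    have hl0 : 0 < lam := by linarith
    have l0 : ENNReal.ofReal lam ≠ 0 := by simpa using hl0
    have lt : ENNReal.ofReal lam ≠ ⊤ := ENNReal.ofReal_ne_top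
    have j1 := hf1 lam hl0 x0 f hf hfm
    have j2 := hf2 lam hl0 x0 g hg hgm
    have hBm : MeasurableSet (Metric.closedBall x0 (2 * lam ^ (-l))) :=
      Metric.isClosed_closedBall.measurableSet
    have cF := ft_continuous (hf.indicator hBm)
    have cG := ft_continuous (hg.indicator hBm)
    obtain ⟨F, hF⟩ : ∃ F, F = ft ((Metric.closedBall x0 (2 * lam ^ (-l))).indicator f) := ⟨_, rfl⟩
    obtain ⟨G, hG⟩ : ∃ F, F = ft ((Metric.closedBall x0 (2 * lam ^ (-l))).indicator g) := ⟨_, rfl⟩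
    rw [← hF] at cF j1 hNdef
    rw [← hG] at cG j2 hNdef
    obtain ⟨Q1, hQ1⟩ : ∃ Q, Q = eLpNorm f q1 (volume.restrict (Metric.closedBall x0 (2 * lam ^ (-l)))) :=
      ⟨_, rfl⟩
    obtain ⟨Q2, hQ2⟩ : ∃ Q, Q = eLpNorm g q2 (volume.restrict (Metric.closedBall x0 (2 * lam ^ (-l)))) :=
      ⟨_, rfl⟩
    rw [← hQ1] at j1 hQ
    rw [← hQ2] at j2 hQ
    have vR : volume (Metric.closedBall (0 : En n) (2 * lam)) = V * ENNReal.ofReal lam ^ (n : ℝ) := by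
      have := vol_ball n (0 : En n) (c := 2) (lam := lam) (e := 1) two_pos hl0
      rw [Real.rpow_one, ← hV, one_mul] at this
      exact this
    have hSL : lam ^ s * lam ^ (-l) = lam ^ (s - l) := by
      rw [← Real.rpow_add hl0]; rfl
    refine ⟨?_, ?_, ?_, ?_⟩
    · rw [hNdef]
      have h1 := hX.meas [] (by simp)
      rw [hX.zero] at h1
      have h2 : Measurable fun x : En n => (x, x) := measurable_id.prodMk measurable_id
      have h3 := fz_meas h1 cF cG
      exact h3.comp (f := fun x : En n => (x, x)) h2
    · have h := hN (lam ^ s) (2 * lam) (lam ^ (-l)) A b d hX (by positivity) (by positivity)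
        (by rw [hSL]; exact Real.one_le_rpow hlam (by linarith)) F G cF cG x0
      rw [hNdef]
      refine h.trans ?_
      rw [vR, hSL, ← ENNReal.ofReal_rpow_of_pos hl0, ← ENNReal.rpow_mul_natCast]
      refine (mul_le_mul' (mul_le_mul' (mul_le_mul' (mul_le_mul' le_rfl (pow_le_pow_left' hA 2))
        le_rfl) j1) j2).trans (le_of_eq ?_)
      have e1 : ENNReal.ofReal lam ^ (e + (s - l) * n + n) =
        ENNReal.ofReal lam ^ ((s - l) * n) * (ENNReal.ofReal lam ^ m) ^ 2 * ENNReal.ofReal lam ^ (n : ℝ) *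
        ENNReal.ofReal lam ^ ((n : ℝ) * (2 / p1 - 1) - l * n * (2 / p1 - 2 * q1⁻¹.toReal)) *
        ENNReal.ofReal lam ^ ((n : ℝ) * (2 / p2 - 1) - l * n * (2 / p2 - 2 * q2⁻¹.toReal)) := by
        rw [← ENNReal.rpow_mul_natCast, ← ENNReal.rpow_add _ _ l0 lt, ← ENNReal.rpow_add _ _ l0 lt,
          ← ENNReal.rpow_add _ _ l0 lt, ← ENNReal.rpow_add _ _ l0 lt, he]
        congr 1; push_cast; ring
      rw [e1, hK2, hQ]
      ring
    · intro x
      rw [hNdef]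
      have h := (hb x).sup_le cF cG x
      refine h.trans ?_
      rw [vR]
      refine (mul_le_mul' (mul_le_mul' (mul_le_mul' (pow_le_pow_left' hA 2) le_rfl) j1) j2).trans
        (le_of_eq ?_)
      have e1 : ENNReal.ofReal lam ^ (e + 2 * n) =
        (ENNReal.ofReal lam ^ m) ^ 2 * (ENNReal.ofReal lam ^ (n : ℝ)) ^ 2 *
        ENNReal.ofReal lam ^ ((n : ℝ) * (2 / p1 - 1) - l * n * (2 / p1 - 2 * q1⁻¹.toReal)) *
        ENNReal.ofReal lam ^ ((n : ℝ) * (2 / p2 - 1) - l * n * (2 / p2 - 2 * q2⁻¹.toReal)) := by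
        rw [← ENNReal.rpow_mul_natCast, ← ENNReal.rpow_mul_natCast, ← ENNReal.rpow_add _ _ l0 lt,
          ← ENNReal.rpow_add _ _ l0 lt, ← ENNReal.rpow_add _ _ l0 lt, he]
        congr 1; push_cast; ring
      rw [e1, hKi, hQ]
      ring
    · have := vol_ball n x0 (c := 1) (lam := lam) (e := -l) one_pos hl0
      rwa [one_mul, ← hV1] at this
  rcases hE with ⟨hr2, hE⟩ | ⟨hr2, hE⟩
  · refine ⟨K2 ^ (r / 2) * V1 ^ (1 - r / 2), ENNReal.mul_ne_top
      (ENNReal.rpow_ne_top_of_nonneg (by positivity) hK2t)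
      (ENNReal.rpow_ne_top_of_nonneg (by linarith) hV1t), ?_⟩
    intro lam A b d hlam hX hb hA f g hf hg hfm hgm x0
    obtain ⟨N, hNd⟩ : ∃ N : En n → ℂ, N = fun x => fz (b x)
      (ft ((Metric.closedBall x0 (2 * lam ^ (-l))).indicator f))
          (ft ((Metric.closedBall x0 (2 * lam ^ (-l))).indicator g)) x := ⟨_, rfl⟩
    obtain ⟨Q, hQ⟩ : ∃ Q : ℝ≥0∞, Q = (eLpNorm f q1 (volume.restrict (Metric.closedBall x0 (2 * lam ^ (-l)))) *
         eLpNorm g q2 (volume.restrict (Metric.closedBall x0 (2 * lam ^ (-l))))) := ⟨_, rfl⟩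
    obtain ⟨hNm, hI2, hsup, hvol⟩ := key lam A b d hlam hX hb hA f g hf hg hfm hgm x0 N hNd Q hQ
    have hl0 : 0 < lam := by linarith
    have l0 : ENNReal.ofReal lam ≠ 0 := by simpa using hl0
    have lt : ENNReal.ofReal lam ≠ ⊤ := ENNReal.ofReal_ne_top
    have l1 : 1 ≤ ENNReal.ofReal lam := by simpa using hlam
    have hrw : ∫⁻ x in Metric.closedBall x0 (lam ^ (-l)),
        ‖fz (b x) (ft ((Metric.closedBall x0 (2 * lam ^ (-l))).indicator f))
          (ft ((Metric.closedBall x0 (2 * lam ^ (-l))).indicator g)) x‖ₑ ^ r =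
          ∫⁻ x in Metric.closedBall x0 (lam ^ (-l)), ‖N x‖ₑ ^ r := by rw [hNd]
    rw [hrw, ← hQ]
    have h := ENNReal.lintegral_mul_norm_pow_le
      (μ := volume.restrict (Metric.closedBall x0 (lam ^ (-l))))
      (f := fun x => ‖N x‖ₑ ^ 2) (g := fun _ => 1) (hNm.enorm.pow_const 2).aemeasurable
      measurable_const.aemeasurable (p := r / 2) (q := 1 - r / 2) (by positivity) (by linarith)
      (by ring)
    have e1 : ∀ x : En n, (‖N x‖ₑ ^ 2) ^ (r / 2) * (1 : ℝ≥0∞) ^ (1 - r / 2) = ‖N x‖ₑ ^ r := by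
      intro x
      rw [ENNReal.one_rpow, mul_one, ← ENNReal.rpow_natCast, ← ENNReal.rpow_mul]
      congr 1; push_cast; ring
    simp only [e1] at h
    refine h.trans ?_
    rw [lintegral_const, Measure.restrict_apply_univ, one_mul, hvol]
    refine (mul_le_mul' (ENNReal.rpow_le_rpow hI2 (by positivity)) le_rfl).trans ?_
    rw [ENNReal.mul_rpow_of_nonneg _ _ (by positivity : 0 ≤ r / 2),
      ENNReal.mul_rpow_of_nonneg _ _ (by positivity : 0 ≤ r / 2),
      ENNReal.mul_rpow_of_nonneg _ _ (by linarith : 0 ≤ 1 - r / 2), ← ENNReal.rpow_mul,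
      ← ENNReal.rpow_mul]
    have e2 : (Q ^ 2) ^ (r / 2) = Q ^ r := by
      rw [← ENNReal.rpow_natCast, ← ENNReal.rpow_mul]
      congr 1; push_cast; ring
    rw [e2]
    calc _ = K2 ^ (r / 2) * V1 ^ (1 - r / 2) * (ENNReal.ofReal lam ^ ((e + (s - l) * n + n) * (r / 2)) *
          ENNReal.ofReal lam ^ (-l * n * (1 - r / 2))) * Q ^ r := by ring
      _ ≤ _ := by
        refine mul_le_mul' (mul_le_mul' le_rfl ?_) le_rfl
        rw [← ENNReal.rpow_add _ _ l0 lt]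
        exact ENNReal.rpow_le_rpow_of_exponent_le l1 (by linarith)
  · refine ⟨Ki ^ ((r - 2) / 2) * K2, ENNReal.mul_ne_top
      (ENNReal.rpow_ne_top_of_nonneg (by linarith) hKit) hK2t, ?_⟩
    intro lam A b d hlam hX hb hA f g hf hg hfm hgm x0
    obtain ⟨N, hNd⟩ : ∃ N : En n → ℂ, N = fun x => fz (b x)
      (ft ((Metric.closedBall x0 (2 * lam ^ (-l))).indicator f))
          (ft ((Metric.closedBall x0 (2 * lam ^ (-l))).indicator g)) x := ⟨_, rfl⟩
    obtain ⟨Q, hQ⟩ : ∃ Q : ℝ≥0∞, Q = (eLpNorm f q1 (volume.restrict (Metric.closedBall x0 (2 * lam ^ (-l)))) *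
         eLpNorm g q2 (volume.restrict (Metric.closedBall x0 (2 * lam ^ (-l))))) := ⟨_, rfl⟩
    obtain ⟨hNm, hI2, hsup, hvol⟩ := key lam A b d hlam hX hb hA f g hf hg hfm hgm x0 N hNd Q hQ
    have hl0 : 0 < lam := by linarith
    have l0 : ENNReal.ofReal lam ≠ 0 := by simpa using hl0
    have lt : ENNReal.ofReal lam ≠ ⊤ := ENNReal.ofReal_ne_top
    have l1 : 1 ≤ ENNReal.ofReal lam := by simpa using hlam
    have hrw : ∫⁻ x in Metric.closedBall x0 (lam ^ (-l)),
        ‖fz (b x) (ft ((Metric.closedBall x0 (2 * lam ^ (-l))).indicator f))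
          (ft ((Metric.closedBall x0 (2 * lam ^ (-l))).indicator g)) x‖ₑ ^ r =
          ∫⁻ x in Metric.closedBall x0 (lam ^ (-l)), ‖N x‖ₑ ^ r := by rw [hNd]
    rw [hrw, ← hQ]
    have hk : 0 ≤ (r - 2) / 2 := by linarith
    have e0 : ∀ X : ℝ≥0∞, X ^ r = (X ^ 2) ^ ((r - 2) / 2) * X ^ 2 := by
      intro X
      rw [← ENNReal.rpow_natCast, ← ENNReal.rpow_mul, ← ENNReal.rpow_add_of_nonneg _ _
        (by push_cast; linarith) (by positivity)]
      congr 1; push_cast; ring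
    have pt : ∀ x, ‖N x‖ₑ ^ r ≤ (Ki * ENNReal.ofReal lam ^ (e + 2 * n) * Q ^ 2) ^ ((r - 2) / 2) *
        ‖N x‖ₑ ^ 2 := by
      intro x
      rw [e0]
      exact mul_le_mul' (ENNReal.rpow_le_rpow (hsup x) hk) le_rfl
    refine (lintegral_mono pt).trans ?_
    rw [lintegral_const_mul _ (hNm.enorm.pow_const 2)]
    refine (mul_le_mul' le_rfl hI2).trans ?_
    rw [ENNReal.mul_rpow_of_nonneg _ _ hk, ENNReal.mul_rpow_of_nonneg _ _ hk, ← ENNReal.rpow_mul,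
      e0 Q]
    calc _ = Ki ^ ((r - 2) / 2) * K2 * (ENNReal.ofReal lam ^ ((e + 2 * n) * ((r - 2) / 2)) *
          ENNReal.ofReal lam ^ (e + (s - l) * n + n)) * ((Q ^ 2) ^ ((r - 2) / 2) * Q ^ 2) := by ring
      _ ≤ _ := by
        refine mul_le_mul' (mul_le_mul' le_rfl ?_) le_rfl
        rw [← ENNReal.rpow_add _ _ l0 lt]
        exact ENNReal.rpow_le_rpow_of_exponent_le l1 (by linarith)


lemma avg_ball {n : ℕ} {H : En n → ℝ≥0∞} (hH : Measurable H) (L : ℝ) :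
    ∫⁻ x0 : En n, ∫⁻ x in Metric.closedBall x0 L, H x =
      volume (Metric.closedBall (0 : En n) L) * ∫⁻ x, H x := by
  have mi : Measurable ((Metric.closedBall (0 : En n) L).indicator (fun _ => (1 : ℝ≥0∞))) :=
    measurable_const.indicator Metric.isClosed_closedBall.measurableSet
  have hval : ∀ x0, ∫⁻ u in Metric.closedBall x0 L, H u =
      ∫⁻ u, (Metric.closedBall (0 : En n) L).indicator
      (fun _ => (1 : ℝ≥0∞)) (u - x0) * H u := by
    intro x0
    rw [← lintegral_indicator Metric.isClosed_closedBall.measurableSet]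
    refine lintegral_congr fun u => ?_
    by_cases h : u ∈ Metric.closedBall x0 L
    · have h' : u - x0 ∈ Metric.closedBall (0 : En n) L := by
        simpa [dist_eq_norm] using h
      rw [Set.indicator_of_mem h, Set.indicator_of_mem h', one_mul]
    · have h' : u - x0 ∉ Metric.closedBall (0 : En n) L := by
        simpa [dist_eq_norm] using h
      rw [Set.indicator_of_notMem h, Set.indicator_of_notMem h', zero_mul]
  have mj : Measurable fun p : En n × En n => (Metric.closedBall (0 : En n) L).indicator
      (fun _ => (1 : ℝ≥0∞)) (p.2 - p.1) * H p.2 :=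
    (mi.comp (measurable_snd.sub measurable_fst)).mul (hH.comp measurable_snd)
  simp only [hval]
  rw [lintegral_lintegral_swap mj.aemeasurable]
  have : ∀ u : En n, ∫⁻ x0 : En n, (Metric.closedBall (0 : En n) L).indicator
      (fun _ => (1 : ℝ≥0∞)) (u - x0) * H u = volume (Metric.closedBall (0 : En n) L) * H u := by
    intro u
    have m1 : Measurable fun x0 : En n => (Metric.closedBall (0 : En n) L).indicator
        (fun _ => (1 : ℝ≥0∞)) (u - x0) := mi.comp (measurable_const.sub measurable_id)
    rw [lintegral_mul_const _ m1, lintegral_sub_left_eq_self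
      (fun v => (Metric.closedBall (0 : En n) L).indicator (fun _ => (1 : ℝ≥0∞)) v) u,
      lintegral_indicator_const Metric.isClosed_closedBall.measurableSet, one_mul]
  simp only [this]
  rw [lintegral_const_mul _ hH]

lemma add_rpow_le_two (a b : ℝ≥0∞) {r : ℝ} (hr : 0 < r) :
    (a + b) ^ r ≤ 2 ^ r * (a ^ r + b ^ r) := by
  have h : a + b ≤ 2 * max a b := by
    rw [two_mul]; exact add_le_add (le_max_left _ _) (le_max_right _ _)
  refine (ENNReal.rpow_le_rpow h hr.le).trans ?_
  rw [ENNReal.mul_rpow_of_nonneg _ _ hr.le]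
  refine mul_le_mul' le_rfl ?_
  rcases le_total a b with h | h
  · rw [max_eq_right h]; exact le_add_self
  · rw [max_eq_left h]; exact le_self_add

set_option maxHeartbeats 1600000 in
theorem single_scale {n : ℕ} (m s l σ r p1 p2 : ℝ) (q1 q2 : ℝ≥0∞) (hr : 0 < r)
    (h1q1 : 1 ≤ q1) (h1q2 : 1 ≤ q2)
    (hrq : 1 / r = q1⁻¹.toReal + q2⁻¹.toReal)
    (hp11 : 1 ≤ p1) (hp12 : p1 ≤ 2) (hp21 : 1 ≤ p2) (hp22 : p2 ≤ 2)
    (hq1 : ENNReal.ofReal p1 ≤ q1) (hq2 : ENNReal.ofReal p2 ≤ q2) (hls : l ≤ s)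
    (e : ℝ) (he : e = 2 * m + ((n : ℝ) * (2 / p1 - 1) - l * n * (2 / p1 - 2 * q1⁻¹.toReal)) +
      ((n : ℝ) * (2 / p2 - 1) - l * n * (2 / p2 - 2 * q2⁻¹.toReal)))
    (hE : (r ≤ 2 ∧ (e + (s - l) * n + n) * (r / 2) - l * n * (1 - r / 2) ≤ -σ * r) ∨
      (2 < r ∧ (e + 2 * n) * ((r - 2) / 2) + (e + (s - l) * n + n) ≤ -σ * r))
    (A0 : ℝ≥0∞) (hA0 : A0 ≠ ⊤) (K0 : ℝ) (hK0 : 0 ≤ K0) :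
    ∃ C : ℝ≥0∞, C ≠ ⊤ ∧ ∀ (lam : ℝ) (A : ℝ≥0) (b : En n → En n × En n → ℂ)
      (d : List (Fin n) → En n → En n × En n → ℂ), 1 ≤ lam → XRep (lam ^ s) (2 * lam) A b d →
      (∀ y, FSym (2 * lam) A (b y)) → (A : ℝ≥0∞) ≤ A0 * ENNReal.ofReal lam ^ m →
      (∀ y p q, lam ^ (-l) ≤ max ‖p‖ ‖q‖ → ‖kn (b y) p q‖ ≤ K0 * lam ^ (-σ) * (Gm p * Gm q)) →
      ∀ f g : En n → ℂ, Integrable f → Integrable g → Measurable f → Measurable g →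
      ∫⁻ x, ‖fz (b x) (ft f) (ft g) x‖ₑ ^ r ≤ C * ENNReal.ofReal lam ^ (-σ * r) *
        (eLpNorm f q1 volume * eLpNorm g q2 volume) ^ r := by
  obtain ⟨C1, hC1, hnear⟩ := near_r (n := n) m s l σ r p1 p2 q1 q2 hr hp11 hp12 hp21 hp22 hq1 hq2 hls
    e he hE A0 hA0
  obtain ⟨K, hKt, hY⟩ := LqB.young n
  refine ⟨2 ^ r * (C1 * 2 ^ (n : ℝ) + ENNReal.ofReal K0 ^ r * (K * K) ^ r), ?_, ?_⟩
  · refine ENNReal.mul_ne_top (ENNReal.rpow_ne_top_of_nonneg hr.le (by simp))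
      (ENNReal.add_ne_top.2 ⟨ENNReal.mul_ne_top hC1 (ENNReal.rpow_ne_top_of_nonneg (by positivity) (by simp)),
        ENNReal.mul_ne_top (ENNReal.rpow_ne_top_of_nonneg hr.le (by simp))
        (ENNReal.rpow_ne_top_of_nonneg hr.le (ENNReal.mul_ne_top hKt hKt))⟩)
  intro lam A b d hlam hX hb hA hK f g hf hg hfm hgm
  have hl0 : 0 < lam := by linarith
  have l0 : ENNReal.ofReal lam ≠ 0 := by simpa using hl0
  have lt : ENNReal.ofReal lam ≠ ⊤ := ENNReal.ofReal_ne_top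
  obtain ⟨T, hT⟩ : ∃ T : En n → ℂ, T = fun x => fz (b x) (ft f) (ft g) x := ⟨_, rfl⟩
  have hTm : Measurable T := by
    have h1 := hX.meas [] (by simp)
    rw [hX.zero] at h1
    have h2 : Measurable fun x : En n => (x, x) := measurable_id.prodMk measurable_id
    have h3 := fz_meas h1 (ft_continuous hf) (ft_continuous hg)
    rw [hT]
    exact h3.comp (f := fun x : En n => (x, x)) h2
  have hrw : ∫⁻ x, ‖fz (b x) (ft f) (ft g) x‖ₑ ^ r = ∫⁻ x, ‖T x‖ₑ ^ r := by rw [hT]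
  rw [hrw]
  obtain ⟨L, hL⟩ : ∃ L, L = lam ^ (-l) := ⟨_, rfl⟩
  have hL0 : 0 < L := by rw [hL]; positivity
  obtain ⟨U1, hU1m, hU1, hU1q⟩ := LqB.local hfm h1q1 (2 * L)
  obtain ⟨U2, hU2m, hU2, hU2q⟩ := LqB.local hgm h1q2 (2 * L)
  obtain ⟨n1, hn1⟩ : ∃ N, N = eLpNorm f q1 volume := ⟨_, rfl⟩
  obtain ⟨n2, hn2⟩ : ∃ N, N = eLpNorm g q2 volume := ⟨_, rfl⟩
  have hG1 := hY f hfm q1 h1q1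
  have hG2 := hY g hgm q2 h1q2
  rw [← hn1] at hU1q hG1 ⊢
  rw [← hn2] at hU2q hG2 ⊢
  have mU : Measurable fun x => U1 x * U2 x := hU1m.mul hU2m
  have mG : Measurable fun x => Gc f x * Gc g x := (Gc_meas hfm).mul (Gc_meas hgm)
  have ho1 := LqB.holder hr h1q1 h1q2 hrq hU1q hU2q hU1m hU2m
  have ho2 := LqB.holder hr h1q1 h1q2 hrq hG1 hG2 (Gc_meas hfm) (Gc_meas hgm)
  obtain ⟨k, hk⟩ : ∃ k, k = ENNReal.ofReal (K0 * lam ^ (-σ)) := ⟨_, rfl⟩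
  have hloc : ∀ x0 : En n, ∫⁻ x in Metric.closedBall x0 L, ‖T x‖ₑ ^ r ≤
      2 ^ r * (C1 * ENNReal.ofReal lam ^ (-σ * r) * (U1 x0 * U2 x0) ^ r +
        k ^ r * ∫⁻ x in Metric.closedBall x0 L, (Gc f x * Gc g x) ^ r) := by
    intro x0
    have hn := hnear lam A b d hlam hX hb hA f g hf hg hfm hgm x0
    rw [← hL] at hn
    obtain ⟨N, hNd⟩ : ∃ N : En n → ℂ, N = fun x => fz (b x)
      (ft ((Metric.closedBall x0 (2 * L)).indicator f))
          (ft ((Metric.closedBall x0 (2 * L)).indicator g)) x := ⟨_, rfl⟩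
    have hNm : Measurable N := by
      have h1 := hX.meas [] (by simp)
      rw [hX.zero] at h1
      have h2 : Measurable fun x : En n => (x, x) := measurable_id.prodMk measurable_id
      have hBm : MeasurableSet (Metric.closedBall x0 (2 * L)) :=
        Metric.isClosed_closedBall.measurableSet
      have h3 := fz_meas h1 (ft_continuous (hf.indicator hBm)) (ft_continuous (hg.indicator hBm))
      rw [hNd]
      exact h3.comp (f := fun x : En n => (x, x)) h2
    have pt : ∀ x ∈ Metric.closedBall x0 L, ‖T x‖ₑ ^ r ≤
        2 ^ r * (‖N x‖ₑ ^ r + k ^ r * (Gc f x * Gc g x) ^ r) := by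
      intro x hx
      have hfar := far_bound (hb x) (L := L) (κ := K0 * lam ^ (-σ)) (by positivity)
        (by rw [hL]; exact hK x) hf hg hfm hgm x0 x hx
      have h1 : ‖T x‖ₑ ≤ ‖N x‖ₑ + k * (Gc f x * Gc g x) := by
        have : T x = N x + (T x - N x) := by ring
        rw [this]
        refine (enorm_add_le _ _).trans (add_le_add le_rfl ?_)
        rw [hT, hNd, hk, ← mul_assoc]
        exact hfar
      refine (ENNReal.rpow_le_rpow h1 hr.le).trans ?_
      refine (add_rpow_le_two _ _ hr).trans (le_of_eq ?_)
      rw [ENNReal.mul_rpow_of_nonneg _ _ hr.le]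
    have hn' : ∫⁻ x in Metric.closedBall x0 L, ‖N x‖ₑ ^ r ≤
        C1 * ENNReal.ofReal lam ^ (-σ * r) * (U1 x0 * U2 x0) ^ r := by
      rw [hNd]
      refine hn.trans (mul_le_mul' le_rfl (ENNReal.rpow_le_rpow (mul_le_mul' (hU1 x0) (hU2 x0)) hr.le))
    refine (setLIntegral_mono' Metric.isClosed_closedBall.measurableSet pt).trans ?_
    have mGr : Measurable fun x => (Gc f x * Gc g x) ^ r := mG.pow_const r
    have m1 : Measurable fun x => ‖N x‖ₑ ^ r := hNm.enorm.pow_const r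
    have m2 : Measurable fun x => k ^ r * (Gc f x * Gc g x) ^ r := measurable_const.mul mGr
    have m3 : Measurable fun x => ‖N x‖ₑ ^ r + k ^ r * (Gc f x * Gc g x) ^ r := m1.add m2
    rw [lintegral_const_mul _ m3, lintegral_add_left m1, lintegral_const_mul _ mGr]
    exact mul_le_mul' le_rfl (add_le_add hn' le_rfl)
  have hintg := lintegral_mono (μ := (volume : Measure (En n))) hloc
  have mT : Measurable fun x => ‖T x‖ₑ ^ r := hTm.enorm.pow_const r
  have mGr : Measurable fun x => (Gc f x * Gc g x) ^ r := mG.pow_const r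
  have mUr : Measurable fun x => (U1 x * U2 x) ^ r := mU.pow_const r
  have mU' : Measurable fun x => C1 * ENNReal.ofReal lam ^ (-σ * r) * (U1 x * U2 x) ^ r :=
    measurable_const.mul mUr
  have mavg : Measurable fun x0 : En n => ∫⁻ x in Metric.closedBall x0 L, (Gc f x * Gc g x) ^ r := by
    have mi : Measurable ((Metric.closedBall (0 : En n) L).indicator (fun _ => (1 : ℝ≥0∞))) :=
      measurable_const.indicator Metric.isClosed_closedBall.measurableSet
    have mj : Measurable fun p : En n × En n => (Metric.closedBall (0 : En n) L).indicator
        (fun _ => (1 : ℝ≥0∞)) (p.2 - p.1) * (Gc f p.2 * Gc g p.2) ^ r :=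
      (mi.comp (measurable_snd.sub measurable_fst)).mul (mGr.comp measurable_snd)
    have := mj.lintegral_prod_right' (ν := (volume : Measure (En n)))
    convert this using 2 with x0
    rw [← lintegral_indicator Metric.isClosed_closedBall.measurableSet]
    refine lintegral_congr fun u => ?_
    by_cases h : u ∈ Metric.closedBall x0 L
    · have h' : u - x0 ∈ Metric.closedBall (0 : En n) L := by
        simpa [dist_eq_norm] using h
      simp only [Set.indicator_of_mem h, Set.indicator_of_mem h', one_mul]
    · have h' : u - x0 ∉ Metric.closedBall (0 : En n) L := by
        simpa [dist_eq_norm] using h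
      simp only [Set.indicator_of_notMem h, Set.indicator_of_notMem h', zero_mul]
  have m4 : Measurable fun x0 : En n => C1 * ENNReal.ofReal lam ^ (-σ * r) * (U1 x0 * U2 x0) ^ r +
        k ^ r * ∫⁻ x in Metric.closedBall x0 L, (Gc f x * Gc g x) ^ r :=
    mU'.add (measurable_const.mul mavg)
  rw [avg_ball mT, lintegral_const_mul _ m4, lintegral_add_left mU',
    lintegral_const_mul _ mUr, lintegral_const_mul _ mavg, avg_ball mGr] at hintg
  have hv : volume (Metric.closedBall (0 : En n) L) =
      volume (Metric.ball (0 : En n) 1) * ENNReal.ofReal lam ^ (-l * n) := by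
    have := vol_ball n (0 : En n) (c := 1) (lam := lam) (e := -l) one_pos hl0
    rw [one_mul, ← hL] at this
    simpa using this
  have hv2 : volume (Metric.closedBall (0 : En n) (2 * L)) =
      2 ^ (n : ℝ) * volume (Metric.closedBall (0 : En n) L) := by
    have := vol_ball n (0 : En n) (c := 2) (lam := lam) (e := -l) two_pos hl0
    rw [← hL] at this
    rw [this, hv]; simp [mul_assoc]
  obtain ⟨v, hvd⟩ : ∃ v, v = volume (Metric.closedBall (0 : En n) L) := ⟨_, rfl⟩
  have v0 : v ≠ 0 := by rw [hvd]; exact (Metric.measure_closedBall_pos _ _ hL0).ne'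
  have vt : v ≠ ⊤ := by rw [hvd]; exact measure_closedBall_lt_top.ne
  rw [hv2] at ho1
  rw [← hvd] at hintg ho1
  have hv3 : (((2 ^ (n : ℝ) * v) ^ q1⁻¹.toReal * n1) * ((2 ^ (n : ℝ) * v) ^ q2⁻¹.toReal * n2)) ^ r =
      2 ^ (n : ℝ) * v * (n1 * n2) ^ r := by
    have : ((2 ^ (n : ℝ) * v) ^ q1⁻¹.toReal * n1) * ((2 ^ (n : ℝ) * v) ^ q2⁻¹.toReal * n2) =
        ((2 ^ (n : ℝ) * v) ^ q1⁻¹.toReal * (2 ^ (n : ℝ) * v) ^ q2⁻¹.toReal) * (n1 * n2) := by ring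
    rw [this, ENNReal.mul_rpow_of_nonneg _ _ hr.le, ← ENNReal.rpow_add_of_nonneg _ _ (by positivity)
      (by positivity), ← hrq, ← ENNReal.rpow_mul, one_div_mul_cancel hr.ne', ENNReal.rpow_one]
  rw [hv3] at ho1
  have hk' : k ^ r = ENNReal.ofReal K0 ^ r * ENNReal.ofReal lam ^ (-σ * r) := by
    rw [hk, ENNReal.ofReal_mul hK0, ENNReal.mul_rpow_of_nonneg _ _ hr.le,
      ← ENNReal.ofReal_rpow_of_pos hl0, ENNReal.rpow_mul]
  have hg2 : (K * n1 * (K * n2)) ^ r = (K * K) ^ r * (n1 * n2) ^ r := by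
    rw [← ENNReal.mul_rpow_of_nonneg _ _ hr.le]; congr 1; ring
  rw [hg2] at ho2
  have fin : v * ∫⁻ x, ‖T x‖ₑ ^ r ≤ v * (2 ^ r * (C1 * 2 ^ (n : ℝ) + ENNReal.ofReal K0 ^ r * (K * K) ^ r) *
      ENNReal.ofReal lam ^ (-σ * r) * (n1 * n2) ^ r) := by
    refine hintg.trans ?_
    rw [hk']
    refine (mul_le_mul' le_rfl (add_le_add (mul_le_mul' le_rfl ho1)
      (mul_le_mul' le_rfl (mul_le_mul' le_rfl ho2)))).trans (le_of_eq ?_)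
    ring
  exact (ENNReal.mul_le_mul_iff_right v0 vt).1 fin


lemma mderiv_zero {n : ℕ} (f : En n → ℂ) : mderiv (0 : Fin n → ℕ) f = f := by
  unfold mderiv
  generalize List.finRange n = l
  induction l with
  | nil => rfl
  | cons i l ih => simp only [List.foldr_cons, ih]; rfl

lemma mderiv_single {n : ℕ} (i : Fin n) (N : ℕ) (f : En n → ℂ) :
    mderiv (Pi.single i N) f = (pd i)^[N] f := by
  have key : ∀ l : List (Fin n), l.Nodup →
      l.foldr (fun j g => (pd j)^[(Pi.single i N : Fin n → ℕ) j] g) f =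
        if i ∈ l then (pd i)^[N] f else f := by
    intro l
    induction l with
    | nil => intro _; simp
    | cons j l ih =>
      intro hl
      rw [List.nodup_cons] at hl
      rw [List.foldr_cons, ih hl.2]
      by_cases h : j = i
      · subst h
        simp [hl.1]
      · have h' : ¬ i = j := fun h2 => h h2.symm
        simp [h']
  unfold mderiv
  rw [key _ (List.nodup_finRange n)]
  simp

/-- 0/1 multi-index of a list -/
def indx {n : ℕ} (t : List (Fin n)) : Fin n → ℕ := fun i => if i ∈ t then 1 else 0

lemma mderiv_indx {n : ℕ} (t : List (Fin n)) (ht : t.Sublist (List.finRange n)) (f : En n → ℂ) :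
    mderiv (indx t) f = t.foldr (fun i g => pd i g) f := by
  have key : ∀ t l : List (Fin n), t.Sublist l → l.Nodup →
      l.foldr (fun j g => (pd j)^[indx t j] g) f = t.foldr (fun i g => pd i g) f := by
    intro t l h
    induction h with
    | slnil => intro _; rfl
    | @cons t l a h ih =>
      intro hl
      rw [List.nodup_cons] at hl
      rw [List.foldr_cons, ih hl.2]
      have : a ∉ t := fun h2 => hl.1 (h.subset h2)
      simp [indx, this]
    | @cons_cons t l a h ih =>
      intro hl
      rw [List.nodup_cons] at hl
      rw [List.foldr_cons, List.foldr_cons, ← ih hl.2]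
      have h1 : indx (a :: t) a = 1 := by simp [indx]
      rw [h1, Function.iterate_one]
      congr 1
      refine List.foldr_ext _ _ _ fun j hj g => ?_
      have : j ≠ a := fun h2 => hl.1 (h2 ▸ hj)
      simp [indx, this]
  exact key t _ ht (List.nodup_finRange n)

lemma mdeg_indx {n : ℕ} (t : List (Fin n)) (ht : t.Sublist (List.finRange n)) :
    mdeg (indx t) = t.length := by
  have hn : t.Nodup := (List.nodup_finRange n).sublist ht
  unfold mdeg indx
  rw [Finset.sum_boole]
  rw [← List.toFinset_card_of_nodup hn]
  simp only [Nat.cast_id]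
  congr 1
  ext i; simp

lemma mdeg_zero {n : ℕ} : mdeg (0 : Fin n → ℕ) = 0 := by simp [mdeg]

lemma mdeg_single {n : ℕ} (i : Fin n) (N : ℕ) : mdeg (Pi.single i N : Fin n → ℕ) = N := by
  simp [mdeg]

/-- x-derivative of a joint symbol -/
def px {n : ℕ} (i : Fin n) (H : En n × (En n × En n) → ℂ) : En n × (En n × En n) → ℂ :=
  fun p => fderiv ℝ H p (EuclideanSpace.single i 1, 0)

lemma px_contDiff {n : ℕ} (i : Fin n) {H : En n × (En n × En n) → ℂ}
    (hH : ContDiff ℝ (⊤ : ℕ∞) H) : ContDiff ℝ (⊤ : ℕ∞) (px i H) := by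
  unfold px
  exact (hH.fderiv_right (m := (⊤ : ℕ∞)) (by simp)).clm_apply contDiff_const

lemma px_eq {n : ℕ} (i : Fin n) {H : En n × (En n × En n) → ℂ}
    (hH : ContDiff ℝ (⊤ : ℕ∞) H) (w : En n × En n) (y : En n) :
    pd i (fun y => H (y, w)) y = px i H (y, w) := by
  have h1 : HasFDerivAt H (fderiv ℝ H (y, w)) (y, w) :=
    (hH.differentiable (by simp) _).hasFDerivAt
  have h2 : HasFDerivAt (fun y : En n => (y, w))
      ((ContinuousLinearMap.id ℝ (En n)).prod 0) y :=
    (hasFDerivAt_id y).prodMk (hasFDerivAt_const w y)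
  have h3 := h1.comp y h2
  unfold pd px
  have h4 := h3.fderiv
  simp only [Function.comp_def] at h4
  rw [h4]
  simp

lemma px_foldr {n : ℕ} (t : List (Fin n)) {H : En n × (En n × En n) → ℂ}
    (hH : ContDiff ℝ (⊤ : ℕ∞) H) :
    ContDiff ℝ (⊤ : ℕ∞) (t.foldr (fun i g => px i g) H) ∧ ∀ w,
    t.foldr (fun i g => pd i g) (fun y => H (y, w)) =
      fun y => t.foldr (fun i g => px i g) H (y, w) := by
  induction t with
  | nil => exact ⟨hH, fun w => rfl⟩
  | cons i t ih =>
    refine ⟨px_contDiff i ih.1, fun w => ?_⟩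
    rw [List.foldr_cons, List.foldr_cons, ih.2 w]
    funext y
    exact px_eq i ih.1 w y

/-- iterated `1 + S⁻¹ ∂ᵢ` -/
def HD {n : ℕ} (S : ℝ) (H : En n × (En n × En n) → ℂ) (l : List (Fin n)) :
    En n × (En n × En n) → ℂ :=
  l.foldr (fun i g => fun p => g p + ((S⁻¹ : ℝ) : ℂ) * px i g p) H

lemma HD_contDiff {n : ℕ} (S : ℝ) {H : En n × (En n × En n) → ℂ}
    (hH : ContDiff ℝ (⊤ : ℕ∞) H) (l : List (Fin n)) : ContDiff ℝ (⊤ : ℕ∞) (HD S H l) := by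
  unfold HD
  induction l with
  | nil => exact hH
  | cons i l ih =>
    exact ih.add (contDiff_const.mul (px_contDiff i ih))

lemma px_list_sum {n : ℕ} (i : Fin n) {ι : Type} (L : List ι) (c : ι → ℂ)
    (g : ι → En n × (En n × En n) → ℂ) (hg : ∀ j, ContDiff ℝ (⊤ : ℕ∞) (g j)) :
    ContDiff ℝ (⊤ : ℕ∞) (fun p => (L.map fun j => c j * g j p).sum) ∧
    px i (fun p => (L.map fun j => c j * g j p).sum) =
      fun p => (L.map fun j => c j * px i (g j) p).sum := by
  induction L with
  | nil =>
    constructor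
    · simpa using contDiff_const
    · funext p; simp [px]
  | cons j L ih =>
    simp only [List.map_cons, List.sum_cons]
    have h1 : ContDiff ℝ (⊤ : ℕ∞) (fun p => c j * g j p) := contDiff_const.mul (hg j)
    refine ⟨h1.add ih.1, ?_⟩
    funext p
    have h2 := congrFun ih.2 p
    simp only [px] at h2 ⊢
    rw [← h2]
    have d1 := (h1.differentiable (by simp)) p
    have d2 := (ih.1.differentiable (by simp)) p
    have d3 := ((hg j).differentiable (by simp)) p
    have e1 : fderiv ℝ (fun p => c j * g j p + (L.map fun j => c j * g j p).sum) p =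
      fderiv ℝ (fun p => c j * g j p) p + fderiv ℝ (fun p => (L.map fun j => c j * g j p).sum) p :=
      fderiv_fun_add d1 d2
    rw [e1, fderiv_const_mul d3]
    simp

lemma HD_sum {n : ℕ} (S : ℝ) {H : En n × (En n × En n) → ℂ}
    (hH : ContDiff ℝ (⊤ : ℕ∞) H) (l : List (Fin n)) :
    HD S H l = fun p => (l.sublists'.map fun t => (((S⁻¹) ^ t.length : ℝ) : ℂ) *
      t.foldr (fun i g => px i g) H p).sum := by
  induction l with
  | nil => funext p; simp [HD]
  | cons i l ih =>
    have h0 : HD S H (i :: l) = fun p => HD S H l p + ((S⁻¹ : ℝ) : ℂ) * px i (HD S H l) p := rfl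
    rw [h0]
    funext p
    rw [ih, (px_list_sum i l.sublists' (fun t => (((S⁻¹) ^ t.length : ℝ) : ℂ))
      (fun t => t.foldr (fun i g => px i g) H) (fun t => (px_foldr t hH).1)).2]
    rw [List.sublists'_cons, List.map_append, List.sum_append, List.map_map, ← List.sum_map_mul_left]
    congr 3
    funext t
    simp only [Function.comp, List.length_cons, List.foldr_cons, pow_succ]
    push_cast; ring

lemma HD_bound {n : ℕ} (S : ℝ) {H : En n × (En n × En n) → ℂ}
    (hH : ContDiff ℝ (⊤ : ℕ∞) H) (l : List (Fin n)) (p : En n × (En n × En n)) (M : ℝ)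
    (hM : ∀ t : List (Fin n), t.Sublist l → |S⁻¹| ^ t.length * ‖t.foldr (fun i g => px i g) H p‖ ≤ M) :
    ‖HD S H l p‖ ≤ 2 ^ l.length * M := by
  rw [HD_sum S hH]
  have key : ∀ L : List (List (Fin n)), (∀ t ∈ L, t.Sublist l) →
      ‖(L.map fun t => (((S⁻¹) ^ t.length : ℝ) : ℂ) *
      t.foldr (fun i g => px i g) H p).sum‖ ≤ L.length * M := by
    intro L
    induction L with
    | nil => intro _; simp
    | cons t L ih =>
      intro h
      simp only [List.map_cons, List.sum_cons, List.length_cons]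
      refine (norm_add_le _ _).trans ?_
      have h1 := hM t (h t (by simp))
      have h2 := ih fun t' ht' => h t' (by simp [ht'])
      have h3 : ‖(((S⁻¹) ^ t.length : ℝ) : ℂ) * t.foldr (fun i g => px i g) H p‖ =
          |S⁻¹| ^ t.length * ‖t.foldr (fun i g => px i g) H p‖ := by
        rw [norm_mul, Complex.norm_real, Real.norm_eq_abs, abs_pow]
      rw [h3, Nat.cast_add, Nat.cast_one]; linarith
  have := key l.sublists' (fun t ht => List.mem_sublists'.1 ht)
  rw [List.length_sublists'] at this
  exact_mod_cast this

lemma HD_rep {n : ℕ} {S : ℝ} (hS : 0 < S) {H : En n × (En n × En n) → ℂ}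
    (hH : ContDiff ℝ (⊤ : ℕ∞) H) (i : Fin n) (w : En n × En n) (M M' : ℝ)
    (hM : ∀ y, ‖H (y, w)‖ ≤ M) (hM' : ∀ y, ‖H (y, w) + ((S⁻¹ : ℝ) : ℂ) * px i H (y, w)‖ ≤ M')
    (y : En n) :
    H (y, w) = ∫ t in Set.Ioi (0 : ℝ), ((S * Real.exp (-(S * |t|)) : ℝ) : ℂ) *
      (H (y - t • EuclideanSpace.single i 1, w) +
        ((S⁻¹ : ℝ) : ℂ) * px i H (y - t • EuclideanSpace.single i 1, w)) := by
  set u : ℝ → ℂ := fun t => H (y - t • EuclideanSpace.single i 1, w) with hu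
  set v : ℝ → ℂ := fun t => px i H (y - t • EuclideanSpace.single i 1, w) with hv
  have hud : ∀ t, HasDerivAt u (-(v t)) t := by
    intro t
    have h1 : HasFDerivAt H (fderiv ℝ H (y - t • EuclideanSpace.single i 1, w))
      (y - t • EuclideanSpace.single i 1, w) := (hH.differentiable (by simp) _).hasFDerivAt
    have h2 : HasDerivAt (fun t : ℝ => y - t • (EuclideanSpace.single i 1 : En n))
        (-(EuclideanSpace.single i 1)) t := by
      simpa using ((hasDerivAt_id t).smul_const (EuclideanSpace.single i 1 : En n)).const_sub y
    have h3 : HasDerivAt (fun t : ℝ => (y - t • (EuclideanSpace.single i 1 : En n), w))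
        (-(EuclideanSpace.single i 1), 0) t := h2.prodMk (hasDerivAt_const t w)
    have h4 := h1.comp_hasDerivAt t h3
    have h5 : ((-(EuclideanSpace.single i 1) : En n), (0 : En n × En n)) =
      -((EuclideanSpace.single i 1 : En n), (0 : En n × En n)) := by simp
    rw [h5, map_neg] at h4
    exact h4
  have hcv : Continuous v := by
    rw [hv]
    exact (px_contDiff i hH).continuous.comp (by fun_prop)
  have hcu : Continuous u := by
    rw [hu]
    exact hH.continuous.comp (by fun_prop)
  set F : ℝ → ℂ := fun t => -(((Real.exp (-(S * t)) : ℝ) : ℂ) * u t) with hF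
  set F' : ℝ → ℂ := fun t => ((S * Real.exp (-(S * t)) : ℝ) : ℂ) * (u t + ((S⁻¹ : ℝ) : ℂ) * v t) with hF'
  have hFd : ∀ t, HasDerivAt F (F' t) t := by
    intro t
    have e1 : HasDerivAt (fun t : ℝ => Real.exp (-(S * t))) (Real.exp (-(S * t)) * (-S)) t := by
      have : HasDerivAt (fun t : ℝ => -(S * t)) (-S) t := by
        have h0 : HasDerivAt (fun t : ℝ => S * t) S t := by
          simpa using (hasDerivAt_id t).const_mul S
        exact h0.neg
      exact this.exp
    have e2 := (e1.ofReal_comp.mul (hud t)).neg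
    refine e2.congr_deriv ?_
    show _ = ((S * Real.exp (-(S * t)) : ℝ) : ℂ) * (u t + ((S⁻¹ : ℝ) : ℂ) * v t)
    push_cast
    have : (S : ℂ) ≠ 0 := by exact_mod_cast hS.ne'
    field_simp
    ring
  have hexp : IntegrableOn (fun t : ℝ => S * Real.exp (-(S * t))) (Set.Ioi 0) := by
    have := (exp_neg_integrableOn_Ioi 0 hS).const_mul S
    unfold IntegrableOn
    simpa only [neg_mul] using this
  have hintg : IntegrableOn F' (Set.Ioi 0) := by
    refine Integrable.mono' (hexp.mul_const M') ?_ ?_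
    · refine Continuous.aestronglyMeasurable ?_
      rw [hF']
      refine Continuous.mul (Complex.continuous_ofReal.comp (by fun_prop))
        (hcu.add (continuous_const.mul hcv))
    · refine Filter.Eventually.of_forall fun t => ?_
      simp only [hF']
      rw [norm_mul, Complex.norm_real, Real.norm_eq_abs, abs_of_pos (by positivity)]
      exact mul_le_mul_of_nonneg_left (hM' _) (by positivity)
  have htend : Filter.Tendsto F Filter.atTop (nhds 0) := by
    have h1 : Filter.Tendsto (fun t : ℝ => Real.exp (-(S * t)) * M) Filter.atTop (nhds 0) := by
      have : Filter.Tendsto (fun t : ℝ => Real.exp (-(S * t))) Filter.atTop (nhds 0) :=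
        Real.tendsto_exp_neg_atTop_nhds_zero.comp (Filter.tendsto_id.const_mul_atTop hS)
      simpa using this.mul_const M
    refine squeeze_zero_norm (fun t => ?_) h1
    simp only [hF]
    rw [norm_neg, norm_mul, Complex.norm_real, Real.norm_eq_abs, abs_of_pos (by positivity)]
    exact mul_le_mul_of_nonneg_left (hM _) (by positivity)
  have hfin := integral_Ioi_of_hasDerivAt_of_tendsto' (a := 0) (fun t _ => hFd t) hintg htend
  have hF0 : F 0 = -H (y, w) := by simp [hF, hu]
  rw [hF0] at hfin
  have hcong : ∫ t in Set.Ioi (0 : ℝ), ((S * Real.exp (-(S * |t|)) : ℝ) : ℂ) *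
      (u t + ((S⁻¹ : ℝ) : ℂ) * v t) = ∫ t in Set.Ioi (0 : ℝ), F' t := by
    refine setIntegral_congr_fun measurableSet_Ioi fun t ht => ?_
    simp only [hF']
    rw [abs_of_pos ht]
  rw [hcong, hfin]; simp


lemma ddv_eq1 {n : ℕ} (i : Fin n) {c : En n × En n → ℂ} (hc : ContDiff ℝ (⊤ : ℕ∞) c) (ξ η : En n) :
    ddv (EuclideanSpace.single i 1, 0) c (ξ, η) = pd i (fun ζ => c (ζ, η)) ξ := by
  have h1 : HasFDerivAt c (fderiv ℝ c (ξ, η)) (ξ, η) :=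
    (hc.differentiable (by simp) _).hasFDerivAt
  have h2 : HasFDerivAt (fun y : En n => (y, η))
      ((ContinuousLinearMap.id ℝ (En n)).prod 0) ξ :=
    (hasFDerivAt_id ξ).prodMk (hasFDerivAt_const η ξ)
  have h4 := (h1.comp ξ h2).fderiv
  simp only [Function.comp_def] at h4
  unfold pd ddv
  rw [h4]
  simp

lemma ddv_eq2 {n : ℕ} (i : Fin n) {c : En n × En n → ℂ} (hc : ContDiff ℝ (⊤ : ℕ∞) c) (ξ η : En n) :
    ddv (0, EuclideanSpace.single i 1) c (ξ, η) = pd i (fun θ => c (ξ, θ)) η := by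
  have h1 : HasFDerivAt c (fderiv ℝ c (ξ, η)) (ξ, η) :=
    (hc.differentiable (by simp) _).hasFDerivAt
  have h2 : HasFDerivAt (fun y : En n => (ξ, y))
      ((0 : En n →L[ℝ] En n).prod (ContinuousLinearMap.id ℝ (En n))) η :=
    (hasFDerivAt_const ξ η).prodMk (hasFDerivAt_id η)
  have h4 := (h1.comp η h2).fderiv
  simp only [Function.comp_def] at h4
  unfold pd ddv
  rw [h4]
  simp

lemma ddv_iter_contDiff {n : ℕ} (v : En n × En n) (N : ℕ) : ∀ {c : En n × En n → ℂ},
    ContDiff ℝ (⊤ : ℕ∞) c → ContDiff ℝ (⊤ : ℕ∞) ((ddv v)^[N] c) := by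
  induction N with
  | zero => intro c hc; exact hc
  | succ N ih => intro c hc; rw [Function.iterate_succ_apply]; exact ih (ddv_contDiff v hc)

lemma ddv_iter1 {n : ℕ} (i : Fin n) (N : ℕ) : ∀ {c : En n × En n → ℂ}, ContDiff ℝ (⊤ : ℕ∞) c →
    ∀ ξ η : En n, (ddv (EuclideanSpace.single i 1, 0))^[N] c (ξ, η) =
      (pd i)^[N] (fun ζ => c (ζ, η)) ξ := by
  induction N with
  | zero => intro c _ ξ η; rfl
  | succ N ih =>
    intro c hc ξ η
    rw [Function.iterate_succ_apply, Function.iterate_succ_apply, ih (ddv_contDiff _ hc)]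
    simp only [ddv_eq1 i hc]

lemma ddv_iter2 {n : ℕ} (i : Fin n) (N : ℕ) : ∀ {c : En n × En n → ℂ}, ContDiff ℝ (⊤ : ℕ∞) c →
    ∀ ξ η : En n, (ddv (0, EuclideanSpace.single i 1))^[N] c (ξ, η) =
      (pd i)^[N] (fun θ => c (ξ, θ)) η := by
  induction N with
  | zero => intro c _ ξ η; rfl
  | succ N ih =>
    intro c hc ξ η
    rw [Function.iterate_succ_apply, Function.iterate_succ_apply, ih (ddv_contDiff _ hc)]
    simp only [ddv_eq2 i hc]

lemma ddv_iter_add {n : ℕ} (v : En n × En n) (N : ℕ) : ∀ {f g : En n × En n → ℂ},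
    ContDiff ℝ (⊤ : ℕ∞) f → ContDiff ℝ (⊤ : ℕ∞) g →
    (ddv v)^[N] (fun w => f w + g w) = fun w => (ddv v)^[N] f w + (ddv v)^[N] g w := by
  induction N with
  | zero => intro f g _ _; rfl
  | succ N ih =>
    intro f g hf hg
    simp only [Function.iterate_succ_apply]
    rw [← ih (ddv_contDiff v hf) (ddv_contDiff v hg)]
    congr 1
    funext w
    unfold ddv
    rw [fderiv_fun_add (hf.differentiable (by simp) w) (hg.differentiable (by simp) w)]
    rfl

lemma ddv_mul {n : ℕ} (v : En n × En n) {f g : En n × En n → ℂ}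
    (hf : ContDiff ℝ (⊤ : ℕ∞) f) (hg : ContDiff ℝ (⊤ : ℕ∞) g) :
    ddv v (fun w => f w * g w) = fun w => ddv v f w * g w + f w * ddv v g w := by
  funext w
  unfold ddv
  rw [fderiv_fun_mul (hf.differentiable (by simp) w) (hg.differentiable (by simp) w)]
  simp; ring

lemma ddv_leib {n : ℕ} (v : En n × En n) (w : En n × En n) {s : ℝ} (hs : 0 ≤ s) (N : ℕ) :
    ∀ {f g : En n × En n → ℂ} {A B : ℝ}, 0 ≤ A → 0 ≤ B →
    ContDiff ℝ (⊤ : ℕ∞) f → ContDiff ℝ (⊤ : ℕ∞) g →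
    (∀ j ≤ N, ‖(ddv v)^[j] f w‖ ≤ A * s ^ j) → (∀ j ≤ N, ‖(ddv v)^[j] g w‖ ≤ B * s ^ j) →
    ‖(ddv v)^[N] (fun w => f w * g w) w‖ ≤ 2 ^ N * (A * B * s ^ N) := by
  induction N with
  | zero =>
    intro f g A B hA hB hf hg h1 h2
    have a1 := h1 0 le_rfl
    have a2 := h2 0 le_rfl
    simp only [Function.iterate_zero, id, pow_zero, mul_one, one_mul] at a1 a2 ⊢
    rw [norm_mul]
    exact mul_le_mul a1 a2 (norm_nonneg _) hA
  | succ N ih =>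
    intro f g A B hA hB hf hg h1 h2
    rw [Function.iterate_succ_apply, ddv_mul v hf hg,
      ddv_iter_add v N ((ddv_contDiff v hf).mul hg) (hf.mul (ddv_contDiff v hg))]
    refine (norm_add_le _ _).trans ?_
    have b1 := ih (A := A * s) (B := B) (by positivity) hB (ddv_contDiff v hf) hg
      (fun j hj => by
        have := h1 (j + 1) (by omega)
        rw [Function.iterate_succ_apply] at this
        refine this.trans (le_of_eq ?_); ring) (fun j hj => h2 j (by omega))
    have b2 := ih (A := A) (B := B * s) hA (by positivity) hf (ddv_contDiff v hg)
      (fun j hj => h1 j (by omega)) (fun j hj => by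
        have := h2 (j + 1) (by omega)
        rw [Function.iterate_succ_apply] at this
        refine this.trans (le_of_eq ?_); ring)
    calc _ ≤ _ := add_le_add b1 b2
      _ = _ := by ring

lemma ddv_scale {n : ℕ} (v : En n × En n) (r : ℝ) (N : ℕ) : ∀ {h : En n × En n → ℂ},
    ContDiff ℝ (⊤ : ℕ∞) h → ∀ w,
    (ddv v)^[N] (fun w => h (r • w)) w = ((r ^ N : ℝ) : ℂ) * (ddv v)^[N] h (r • w) := by
  induction N with
  | zero => intro h _ w; simp
  | succ N ih =>
    intro h hh w
    simp only [Function.iterate_succ_apply']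
    have hs : ContDiff ℝ (⊤ : ℕ∞) (fun w : En n × En n => h (r • w)) :=
      hh.comp (by fun_prop : ContDiff ℝ (⊤ : ℕ∞) fun w : En n × En n => r • w)
    have e : (ddv v)^[N] (fun w => h (r • w)) = fun w => ((r ^ N : ℝ) : ℂ) * (ddv v)^[N] h (r • w) :=
      funext (ih hh)
    rw [e]
    have hN := ddv_iter_contDiff v N hh
    have h1 : HasFDerivAt ((ddv v)^[N] h) (fderiv ℝ ((ddv v)^[N] h) (r • w)) (r • w) :=
      (hN.differentiable (by simp) _).hasFDerivAt
    have h2 : HasFDerivAt (fun w : En n × En n => r • w)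
        (r • ContinuousLinearMap.id ℝ (En n × En n)) w := (hasFDerivAt_id w).const_smul r
    have h3 := (h1.comp w h2).const_mul ((r ^ N : ℝ) : ℂ)
    have h4 := h3.fderiv
    simp only [Function.comp_def] at h4
    unfold ddv at h4 ⊢
    rw [h4]
    simp only [ContinuousLinearMap.smul_apply, ContinuousLinearMap.comp_apply,
      ContinuousLinearMap.id_apply, map_smul, smul_eq_mul, Complex.real_smul]
    push_cast; ring

/-- bump -/
def bmp (n : ℕ) : ContDiffBump (0 : En n × En n) := ⟨1, 2, one_pos, one_lt_two⟩

def ph {n : ℕ} (w : En n × En n) : ℂ := ((bmp n w : ℝ) : ℂ)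

lemma ph_contDiff {n : ℕ} : ContDiff ℝ (⊤ : ℕ∞) (ph (n := n)) := by
  unfold ph
  exact Complex.ofRealCLM.contDiff.comp (bmp n).contDiff

lemma ph_one {n : ℕ} (w : En n × En n) (h : ‖w‖ ≤ 1) : ph w = 1 := by
  unfold ph
  rw [(bmp n).one_of_mem_closedBall (by simpa [bmp] using h)]; simp

lemma ph_zero {n : ℕ} (w : En n × En n) (h : 2 ≤ ‖w‖) : ph w = 0 := by
  unfold ph
  rw [(bmp n).zero_of_le_dist (by simpa [bmp] using h)]; simp

lemma ph_norm {n : ℕ} (w : En n × En n) : ‖ph w‖ ≤ 1 := by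
  unfold ph
  rw [Complex.norm_real, Real.norm_eq_abs, abs_of_nonneg (bmp n).nonneg]
  exact (bmp n).le_one

/-- mother functions -/
def mth {n : ℕ} (k : ℕ) (u : En n × En n) : ℂ :=
  if k = 0 then ph u else ph u - ph ((2 : ℝ) • u)

/-- dyadic cutoffs -/
def cut {n : ℕ} (k : ℕ) (w : En n × En n) : ℂ := mth k (((2 : ℝ) ^ k)⁻¹ • w)

lemma mth_contDiff {n : ℕ} (k : ℕ) : ContDiff ℝ (⊤ : ℕ∞) (mth (n := n) k) := by
  unfold mth
  by_cases h : k = 0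
  · simp only [h, if_true]; exact ph_contDiff
  · simp only [h, if_false]
    exact ph_contDiff.sub (ph_contDiff.comp (by fun_prop : ContDiff ℝ (⊤ : ℕ∞) fun w : En n × En n => (2 : ℝ) • w))

lemma cut_contDiff {n : ℕ} (k : ℕ) : ContDiff ℝ (⊤ : ℕ∞) (cut (n := n) k) := by
  unfold cut
  exact (mth_contDiff k).comp (by fun_prop : ContDiff ℝ (⊤ : ℕ∞) fun w : En n × En n => ((2 : ℝ) ^ k)⁻¹ • w)

lemma mth_supp {n : ℕ} (k : ℕ) (u : En n × En n) (h : mth k u ≠ 0) :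
    ‖u‖ ≤ 2 ∧ (k ≠ 0 → 1 / 2 ≤ ‖u‖) := by
  constructor
  · by_contra! hu
    apply h
    unfold mth
    split_ifs
    · exact ph_zero u hu.le
    · rw [ph_zero u hu.le, ph_zero _ (by rw [norm_smul]; simp; linarith)]; simp
  · intro hk
    by_contra! hu
    apply h
    unfold mth
    rw [if_neg hk, ph_one u (by linarith), ph_one _ (by rw [norm_smul]; simp; linarith)]
    simp

lemma mth_hcs {n : ℕ} (k : ℕ) : HasCompactSupport (mth (n := n) k) := by
  refine HasCompactSupport.intro (isCompact_closedBall (0 : En n × En n) 2) fun u hu => ?_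
  by_contra h
  exact hu (by simpa using (mth_supp k u h).1)

lemma cut_deriv {n : ℕ} (v : En n × En n) (N : ℕ) : ∃ B : ℝ, 0 ≤ B ∧ ∀ (k : ℕ) (w : En n × En n),
    ‖(ddv v)^[N] (cut k) w‖ ≤ B * (((2 : ℝ) ^ k)⁻¹) ^ N := by
  have hb : ∀ k : ℕ, ∃ B : ℝ, ∀ w : En n × En n, ‖(ddv v)^[N] (mth k) w‖ ≤ B := by
    intro k
    have hcs : HasCompactSupport ((ddv v)^[N] (mth (n := n) k)) :=
      (mth_hcs k).of_isClosed_subset (isClosed_tsupport _) (ddv_iter_tsupport v N _)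
    exact hcs.exists_bound_of_continuous (ddv_iter_contDiff v N (mth_contDiff k)).continuous
  obtain ⟨B0, hB0⟩ := hb 0
  obtain ⟨B1, hB1⟩ := hb 1
  refine ⟨max |B0| |B1|, by positivity, fun k w => ?_⟩
  have hk : ∀ u : En n × En n, ‖(ddv v)^[N] (mth k) u‖ ≤ max |B0| |B1| := by
    intro u
    by_cases h : k = 0
    · subst h; exact (hB0 u).trans ((le_abs_self _).trans (le_max_left _ _))
    · have e : mth (n := n) k = mth 1 := by funext u; simp [mth, h]
      rw [e]; exact (hB1 u).trans ((le_abs_self _).trans (le_max_right _ _))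
  have e2 : (cut k : En n × En n → ℂ) = fun w => mth k (((2 : ℝ) ^ k)⁻¹ • w) := rfl
  rw [e2, ddv_scale v _ N (mth_contDiff k), norm_mul, Complex.norm_real, Real.norm_eq_abs,
    abs_of_nonneg (by positivity), mul_comm]
  exact mul_le_mul_of_nonneg_right (hk _) (by positivity)

lemma cut_supp {n : ℕ} (k : ℕ) (w : En n × En n) (h : cut k w ≠ 0) :
    ‖w‖ ≤ 2 * 2 ^ k ∧ (2 : ℝ) ^ k ≤ 2 * (1 + ‖w‖) := by
  obtain ⟨h1, h2⟩ := mth_supp k _ h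
  have hp : (0 : ℝ) < 2 ^ k := by positivity
  rw [norm_smul, Real.norm_eq_abs, abs_of_nonneg (by positivity)] at h1 h2
  rw [inv_mul_le_iff₀ hp] at h1
  refine ⟨by linarith, ?_⟩
  by_cases hk : k = 0
  · subst hk; have := norm_nonneg w; norm_num; linarith
  · have := h2 hk
    rw [le_inv_mul_iff₀ hp] at this
    linarith

lemma cut_norm {n : ℕ} (k : ℕ) (w : En n × En n) : ‖cut k w‖ ≤ 2 := by
  unfold cut mth
  split_ifs
  · exact (ph_norm _).trans (by norm_num)
  · refine (norm_sub_le _ _).trans ?_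
    have := ph_norm (((2 : ℝ) ^ k)⁻¹ • w)
    have := ph_norm ((2 : ℝ) • ((2 : ℝ) ^ k)⁻¹ • w)
    linarith

lemma cut_sum {n : ℕ} (K : ℕ) (w : En n × En n) :
    ∑ k ∈ Finset.range (K + 1), cut k w = ph (((2 : ℝ) ^ K)⁻¹ • w) := by
  induction K with
  | zero => simp [cut, mth]
  | succ K ih =>
    rw [Finset.sum_range_succ, ih]
    have : (2 : ℝ) • ((2 : ℝ) ^ (K + 1))⁻¹ • w = ((2 : ℝ) ^ K)⁻¹ • w := by
      rw [smul_smul]; congr 1; rw [pow_succ]; field_simp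
    simp [cut, mth, this]

lemma br_bound {lam x : ℝ} (e : ℝ) (hl : 0 < lam) (h1 : lam / 5 ≤ x) (h2 : x ≤ 5 * lam) :
    x ^ e ≤ 5 ^ |e| * lam ^ e := by
  have hx : 0 < x := by linarith [div_pos hl (by norm_num : (0 : ℝ) < 5)]
  rcases le_total 0 e with he | he
  · rw [abs_of_nonneg he, ← Real.mul_rpow (by norm_num) hl.le]
    exact Real.rpow_le_rpow hx.le h2 he
  · rw [abs_of_nonpos he]
    have : x ^ e ≤ (lam / 5) ^ e := Real.rpow_le_rpow_of_nonpos (by positivity) h1 he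
    refine this.trans (le_of_eq ?_)
    rw [Real.div_rpow hl.le (by norm_num), Real.rpow_neg (by norm_num)]
    field_simp

/-- bracket -/
lemma br_mem {n k : ℕ} {w : En n × En n} (h : ‖w‖ ≤ 2 * 2 ^ k ∧ (2 : ℝ) ^ k ≤ 2 * (1 + ‖w‖)) :
    (2 : ℝ) ^ k / 5 ≤ 1 + ‖w.1‖ + ‖w.2‖ ∧ 1 + ‖w.1‖ + ‖w.2‖ ≤ 5 * 2 ^ k := by
  have h1 : ‖w.1‖ ≤ ‖w‖ := norm_fst_le w
  have h2 : ‖w.2‖ ≤ ‖w‖ := norm_snd_le w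
  have h3 : ‖w‖ ≤ ‖w.1‖ + ‖w.2‖ := by
    rw [Prod.norm_def]; exact max_le_add_of_nonneg (norm_nonneg _) (norm_nonneg _)
  have : (1 : ℝ) ≤ 2 ^ k := one_le_pow₀ (by norm_num)
  constructor <;> linarith [h.1, h.2]


/-- full symbol as function of one variable -/
def aa {n : ℕ} (a : En n → En n → En n → ℂ) : En n × (En n × En n) → ℂ := fun q => a q.1 q.2.1 q.2.2

lemma horm_x {n : ℕ} {m ρ δ : ℝ} {a : En n → En n → En n → ℂ} (h : HormS2 m ρ δ a)
    (t : List (Fin n)) : ∃ C : ℝ, 0 ≤ C ∧ (t.Sublist (List.finRange n) →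
      ∀ y (w : En n × En n), ‖t.foldr (fun i g => px i g) (aa a) (y, w)‖ ≤
        C * (1 + ‖w.1‖ + ‖w.2‖) ^ (m + δ * t.length)) := by
  by_cases ht : t.Sublist (List.finRange n)
  swap
  · exact ⟨0, le_rfl, fun h => absurd h ht⟩
  obtain ⟨C, hC⟩ := h.2 (indx t) 0 0
  refine ⟨|C|, abs_nonneg _, fun _ y w => ?_⟩
  have h1 := hC y w.1 w.2
  have e : d3 (indx t) 0 0 a y w.1 w.2 = t.foldr (fun i g => px i g) (aa a) (y, w) := by
    unfold d3 d2
    simp only [mderiv_zero]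
    rw [mderiv_indx t ht]
    have := (px_foldr t (H := aa a) h.1).2 w
    exact congrFun this y
  rw [e, mdeg_indx t ht, mdeg_zero] at h1
  refine h1.trans ?_
  have e2 : m - ρ * (((0 : ℕ) : ℝ) + ((0 : ℕ) : ℝ)) + δ * (t.length : ℝ) = m + δ * t.length := by
    simp
  rw [e2]
  exact mul_le_mul_of_nonneg_right (le_abs_self _) (by positivity)

lemma horm_w1 {n : ℕ} {m ρ δ : ℝ} {a : En n → En n → En n → ℂ} (h : HormS2 m ρ δ a)
    (i : Fin n) (j : ℕ) : ∃ C : ℝ, 0 ≤ C ∧ ∀ y (w : En n × En n),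
      ‖(ddv (EuclideanSpace.single i 1, 0))^[j] (fun w => a y w.1 w.2) w‖ ≤
        C * (1 + ‖w.1‖ + ‖w.2‖) ^ (m - ρ * j) := by
  obtain ⟨C, hC⟩ := h.2 0 (Pi.single i j) 0
  refine ⟨|C|, abs_nonneg _, fun y w => ?_⟩
  have h1 := hC y w.1 w.2
  have hc : ContDiff ℝ (⊤ : ℕ∞) (fun w : En n × En n => a y w.1 w.2) :=
    h.1.comp (contDiff_const.prodMk contDiff_id : ContDiff ℝ (⊤ : ℕ∞) fun w : En n × En n => (y, w))
  have e : d3 0 (Pi.single i j) 0 a y w.1 w.2 =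
      (ddv (EuclideanSpace.single i 1, 0))^[j] (fun w => a y w.1 w.2) w := by
    unfold d3 d2
    simp only [mderiv_zero, mderiv_single]
    exact (ddv_iter1 i j hc w.1 w.2).symm
  rw [e, mdeg_single, mdeg_zero] at h1
  refine h1.trans ?_
  have e2 : m - ρ * ((j : ℝ) + ((0 : ℕ) : ℝ)) + δ * ((0 : ℕ) : ℝ) = m - ρ * j := by
    simp
  rw [e2]
  exact mul_le_mul_of_nonneg_right (le_abs_self _) (by positivity)

lemma horm_w2 {n : ℕ} {m ρ δ : ℝ} {a : En n → En n → En n → ℂ} (h : HormS2 m ρ δ a)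
    (i : Fin n) (j : ℕ) : ∃ C : ℝ, 0 ≤ C ∧ ∀ y (w : En n × En n),
      ‖(ddv (0, EuclideanSpace.single i 1))^[j] (fun w => a y w.1 w.2) w‖ ≤
        C * (1 + ‖w.1‖ + ‖w.2‖) ^ (m - ρ * j) := by
  obtain ⟨C, hC⟩ := h.2 0 0 (Pi.single i j)
  refine ⟨|C|, abs_nonneg _, fun y w => ?_⟩
  have h1 := hC y w.1 w.2
  have hc : ContDiff ℝ (⊤ : ℕ∞) (fun w : En n × En n => a y w.1 w.2) :=
    h.1.comp (contDiff_const.prodMk contDiff_id : ContDiff ℝ (⊤ : ℕ∞) fun w : En n × En n => (y, w))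
  have e : d3 0 0 (Pi.single i j) a y w.1 w.2 =
      (ddv (0, EuclideanSpace.single i 1))^[j] (fun w => a y w.1 w.2) w := by
    unfold d3 d2
    simp only [mderiv_zero, mderiv_single]
    exact (ddv_iter2 i j hc w.1 w.2).symm
  rw [e, mdeg_single, mdeg_zero] at h1
  refine h1.trans ?_
  have e2 : m - ρ * (((0 : ℕ) : ℝ) + (j : ℝ)) + δ * ((0 : ℕ) : ℝ) = m - ρ * j := by
    simp
  rw [e2]
  exact mul_le_mul_of_nonneg_right (le_abs_self _) (by positivity)

/-- dyadic piece of a symbol -/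
def bk {n : ℕ} (a : En n → En n → En n → ℂ) (k : ℕ) (y : En n) (w : En n × En n) : ℂ :=
  a y w.1 w.2 * cut k w

lemma sym_xrep {n : ℕ} {m ρ δ s : ℝ} {a : En n → En n → En n → ℂ} (h : HormS2 m ρ δ a)
    (hs : δ ≤ s) : ∃ A0 : ℝ, 0 ≤ A0 ∧ ∀ k : ℕ, ∃ d,
      XRep (((2 : ℝ) ^ k) ^ s) (2 * 2 ^ k) (Real.toNNReal (A0 * ((2 : ℝ) ^ k) ^ m)) (bk a k) d ∧
      ∀ y, FSym (2 * 2 ^ k) (Real.toNNReal (A0 * ((2 : ℝ) ^ k) ^ m)) (bk a k y) := by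
  have hH : ContDiff ℝ (⊤ : ℕ∞) (aa a) := h.1
  choose C hC0 hC using horm_x h
  obtain ⟨M, hMd⟩ : ∃ M : ℝ, M = ∑ t ∈ (List.finRange n).sublists.toFinset,
      C t * 5 ^ |m + δ * (t.length : ℝ)| := ⟨_, rfl⟩
  have hM0 : 0 ≤ M := by
    rw [hMd]; exact Finset.sum_nonneg fun t _ => mul_nonneg (hC0 t) (by positivity)
  refine ⟨2 * (2 ^ n * M), by positivity, fun k => ?_⟩
  obtain ⟨lam, hlam⟩ : ∃ lam : ℝ, lam = 2 ^ k := ⟨_, rfl⟩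
  have hl1 : 1 ≤ lam := by rw [hlam]; exact one_le_pow₀ (by norm_num)
  have hl0 : 0 < lam := by linarith
  obtain ⟨S, hSd⟩ : ∃ S : ℝ, S = lam ^ s := ⟨_, rfl⟩
  have hS : 0 < S := by rw [hSd]; positivity
  have key : ∀ l : List (Fin n), l.Sublist (List.finRange n) → ∀ y (w : En n × En n),
      (‖w‖ ≤ 2 * 2 ^ k ∧ (2 : ℝ) ^ k ≤ 2 * (1 + ‖w‖)) →
      ‖HD S (aa a) l (y, w)‖ ≤ 2 ^ n * M * lam ^ m := by
    intro l hl y w hw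
    have b := HD_bound S hH l (y, w) (M * lam ^ m) (by
      intro t ht
      have ht' := ht.trans hl
      have b1 := hC t ht' y w
      obtain ⟨w1, w2⟩ := br_mem hw
      rw [← hlam] at w1 w2
      have b2 := br_bound (m + δ * t.length) hl0 w1 w2
      have b3 : C t * 5 ^ |m + δ * (t.length : ℝ)| ≤ M := by
        rw [hMd]
        exact Finset.single_le_sum (f := fun t : List (Fin n) => C t * 5 ^ |m + δ * (t.length : ℝ)|)
          (fun t _ => mul_nonneg (hC0 t) (by positivity)) (by simpa using ht')
      have b4 : |S⁻¹| ^ t.length * lam ^ (m + δ * t.length) ≤ lam ^ m := by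
        rw [abs_of_pos (inv_pos.mpr hS), hSd, ← Real.rpow_neg hl0.le, ← Real.rpow_natCast,
          ← Real.rpow_mul hl0.le, ← Real.rpow_add hl0]
        refine Real.rpow_le_rpow_of_exponent_le hl1 ?_
        have : (0 : ℝ) ≤ (s - δ) * t.length := mul_nonneg (by linarith) (by positivity)
        linarith
      calc |S⁻¹| ^ t.length * ‖t.foldr (fun i g => px i g) (aa a) (y, w)‖
          ≤ |S⁻¹| ^ t.length * (C t * (5 ^ |m + δ * (t.length : ℝ)| * lam ^ (m + δ * t.length))) := by
            refine mul_le_mul_of_nonneg_left (b1.trans ?_) (by positivity)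
            exact mul_le_mul_of_nonneg_left b2 (hC0 t)
        _ = (C t * 5 ^ |m + δ * (t.length : ℝ)|) * (|S⁻¹| ^ t.length * lam ^ (m + δ * t.length)) := by
            ring
        _ ≤ M * lam ^ m := mul_le_mul b3 b4 (by positivity) hM0)
    refine b.trans ?_
    rw [mul_assoc]
    refine mul_le_mul_of_nonneg_right ?_ (by positivity)
    refine pow_le_pow_right₀ (by norm_num) ?_
    simpa using hl.length_le
  have hdc : ∀ l, Continuous fun p : En n × (En n × En n) => HD S (aa a) l p * cut k p.2 := fun l =>
    (HD_contDiff S hH l).continuous.mul ((cut_contDiff k).continuous.comp continuous_snd)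
  have fs : ∀ l : List (Fin n), l.Sublist (List.finRange n) → ∀ y,
      FSym (2 * 2 ^ k) (Real.toNNReal (2 * (2 ^ n * M) * lam ^ m))
        (fun w => HD S (aa a) l (y, w) * cut k w) := by
    intro l hl y
    refine ⟨?_, fun w => ?_, fun w hw => ?_⟩
    · have : Continuous fun w : En n × En n => HD S (aa a) l (y, w) * cut k w :=
        (hdc l).comp (by fun_prop : Continuous fun w : En n × En n => (y, w))
      exact this.measurable
    · rw [Real.coe_toNNReal _ (by positivity)]
      by_cases hw : cut k w = 0
      · rw [hw]; simp; positivity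
      · rw [norm_mul]
        calc _ ≤ (2 ^ n * M * lam ^ m) * 2 :=
              mul_le_mul (key l hl y w (cut_supp k w hw)) (cut_norm k w) (norm_nonneg _)
                (by positivity)
          _ = _ := by ring
    · have hw' : cut k w ≠ 0 := fun h0 => hw (by simp [h0])
      have := (cut_supp k w hw').1
      exact ⟨(norm_fst_le w).trans this, (norm_snd_le w).trans this⟩
  rw [← hlam, ← hSd]
  rw [← hlam] at fs
  have hb : ∀ y, bk a k y = fun w => HD S (aa a) [] (y, w) * cut k w := fun y => rfl
  refine ⟨fun l y w => HD S (aa a) l (y, w) * cut k w, ⟨rfl, ?_, ?_, ?_, ?_⟩, ?_⟩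
  · intro l _; exact (hdc l).measurable
  · intro l hl; exact ⟨_, fun y => fs l hl y⟩
  · intro y; exact fs _ (List.Sublist.refl _) y
  · intro i l hil y w
    have hl : l.Sublist (List.finRange n) := (List.sublist_cons_self i l).trans hil
    by_cases hw : cut k w = 0
    · simp [hw]
    · have hz := cut_supp k w hw
      have := HD_rep hS (HD_contDiff S hH l) i w _ _ (fun y => key l hl y w hz)
        (fun y => key (i :: l) hil y w hz) y
      have e : ∀ t : ℝ, ((S * Real.exp (-(S * |t|)) : ℝ) : ℂ) *
          (HD S (aa a) (i :: l) (y - t • EuclideanSpace.single i 1, w) * cut k w) =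
          (((S * Real.exp (-(S * |t|)) : ℝ) : ℂ) *
          HD S (aa a) (i :: l) (y - t • EuclideanSpace.single i 1, w)) * cut k w := by
        intro t; ring
      simp only [e]
      rw [integral_mul_const]
      congr 1
  · intro y; rw [hb]; exact fs [] (List.nil_sublist _) y


lemma bk_contDiff {n : ℕ} {m ρ δ : ℝ} {a : En n → En n → En n → ℂ} (h : HormS2 m ρ δ a)
    (k : ℕ) (y : En n) : ContDiff ℝ (⊤ : ℕ∞) (bk a k y) := by
  have hc : ContDiff ℝ (⊤ : ℕ∞) (fun w : En n × En n => a y w.1 w.2) :=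
    h.1.comp (contDiff_const.prodMk contDiff_id : ContDiff ℝ (⊤ : ℕ∞) fun w : En n × En n => (y, w))
  exact hc.mul (cut_contDiff k)

lemma bk_tsupport {n : ℕ} (a : En n → En n → En n → ℂ) (k : ℕ) (y : En n) :
    tsupport (bk a k y) ⊆ {w | ‖w‖ ≤ 2 * 2 ^ k ∧ (2 : ℝ) ^ k ≤ 2 * (1 + ‖w‖)} := by
  refine closure_minimal (fun w hw => ?_) ?_
  · exact cut_supp k w fun h0 => hw (by simp [bk, h0])
  · exact (isClosed_le (f := fun w : En n × En n => ‖w‖) (g := fun _ => (2 : ℝ) * 2 ^ k)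
      (by fun_prop) (by fun_prop)).inter
      (isClosed_le (f := fun _ : En n × En n => (2 : ℝ) ^ k) (g := fun w => 2 * (1 + ‖w‖))
      (by fun_prop) (by fun_prop))

lemma sym_deriv_v {n : ℕ} {m ρ δ : ℝ} {a : En n → En n → En n → ℂ} (h : HormS2 m ρ δ a)
    (hρ1 : ρ ≤ 1) (N : ℕ) (v : En n × En n)
    (hv : ∀ j : ℕ, ∃ C : ℝ, 0 ≤ C ∧ ∀ y (w : En n × En n),
      ‖(ddv v)^[j] (fun w => a y w.1 w.2) w‖ ≤ C * (1 + ‖w.1‖ + ‖w.2‖) ^ (m - ρ * j)) :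
    ∃ D : ℝ, 0 ≤ D ∧ ∀ (k : ℕ) y w, ‖(ddv v)^[N] (bk a k y) w‖ ≤ D * ((2 : ℝ) ^ k) ^ (m - ρ * N) := by
  choose C hC0 hC using hv
  choose B hB0 hB using fun j => cut_deriv v j
  obtain ⟨A, hA⟩ : ∃ A : ℝ, A = ∑ j ∈ Finset.range (N + 1), C j * 5 ^ |m - ρ * (j : ℝ)| := ⟨_, rfl⟩
  obtain ⟨B', hB'⟩ : ∃ B' : ℝ, B' = ∑ j ∈ Finset.range (N + 1), B j := ⟨_, rfl⟩
  have hA0 : 0 ≤ A := by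
    rw [hA]; exact Finset.sum_nonneg fun t _ => mul_nonneg (hC0 t) (by positivity)
  have hB'0 : 0 ≤ B' := by
    rw [hB']; exact Finset.sum_nonneg fun t _ => hB0 t
  refine ⟨2 ^ N * (A * B'), by positivity, fun k y w => ?_⟩
  obtain ⟨lam, hlam⟩ : ∃ lam : ℝ, lam = 2 ^ k := ⟨_, rfl⟩
  have hl1 : 1 ≤ lam := by rw [hlam]; exact one_le_pow₀ (by norm_num)
  have hl0 : 0 < lam := by linarith
  rw [← hlam]
  by_cases hw : ‖w‖ ≤ 2 * 2 ^ k ∧ (2 : ℝ) ^ k ≤ 2 * (1 + ‖w‖)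
  swap
  · have : (ddv v)^[N] (bk a k y) w = 0 :=
      image_eq_zero_of_notMem_tsupport fun hh =>
        hw (bk_tsupport a k y (ddv_iter_tsupport v N _ hh))
    rw [this, norm_zero]; positivity
  have hc : ContDiff ℝ (⊤ : ℕ∞) (fun w : En n × En n => a y w.1 w.2) :=
    h.1.comp (contDiff_const.prodMk contDiff_id : ContDiff ℝ (⊤ : ℕ∞) fun w : En n × En n => (y, w))
  obtain ⟨w1, w2⟩ := br_mem hw
  rw [← hlam] at w1 w2
  have hpow : ∀ j : ℕ, lam ^ m * (lam ^ (-ρ)) ^ j = lam ^ (m - ρ * j) := by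
    intro j
    rw [← Real.rpow_natCast, ← Real.rpow_mul hl0.le, ← Real.rpow_add hl0]
    congr 1; ring
  have := ddv_leib v w (s := lam ^ (-ρ)) (by positivity) N (A := A * lam ^ m) (B := B')
    (by positivity) hB'0 hc (cut_contDiff k) (fun j hj => by
      refine (hC j y w).trans ?_
      rw [mul_assoc, hpow]
      have b3 : C j * 5 ^ |m - ρ * (j : ℝ)| ≤ A := by
        rw [hA]
        exact Finset.single_le_sum (f := fun j : ℕ => C j * 5 ^ |m - ρ * (j : ℝ)|)
          (fun t _ => mul_nonneg (hC0 t) (by positivity)) (by simp; omega)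
      calc _ ≤ C j * (5 ^ |m - ρ * (j : ℝ)| * lam ^ (m - ρ * j)) :=
            mul_le_mul_of_nonneg_left (br_bound _ hl0 w1 w2) (hC0 j)
        _ = (C j * 5 ^ |m - ρ * (j : ℝ)|) * lam ^ (m - ρ * j) := by ring
        _ ≤ _ := mul_le_mul_of_nonneg_right b3 (by positivity)) (fun j hj => by
      refine (hB j k w).trans ?_
      rw [← hlam]
      have b3 : B j ≤ B' := by
        rw [hB']
        exact Finset.single_le_sum (f := fun j : ℕ => B j)
          (fun t _ => hB0 t) (by simp; omega)
      refine mul_le_mul b3 ?_ (by positivity) hB'0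
      refine pow_le_pow_left₀ (by positivity) ?_ j
      rw [← Real.rpow_neg_one]
      exact Real.rpow_le_rpow_of_exponent_le hl1 (by linarith))
  refine this.trans (le_of_eq ?_)
  rw [← hpow]; ring

lemma sym_deriv {n : ℕ} {m ρ δ : ℝ} {a : En n → En n → En n → ℂ} (h : HormS2 m ρ δ a)
    (hρ1 : ρ ≤ 1) (N : ℕ) : ∃ D : ℝ, 0 ≤ D ∧ ∀ (k : ℕ) y (i : Fin n) w,
      ‖(ddv (EuclideanSpace.single i 1, 0))^[N] (bk a k y) w‖ ≤ D * ((2 : ℝ) ^ k) ^ (m - ρ * N) ∧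
      ‖(ddv (0, EuclideanSpace.single i 1))^[N] (bk a k y) w‖ ≤ D * ((2 : ℝ) ^ k) ^ (m - ρ * N) := by
  choose D1 hD1 h1 using fun i : Fin n => sym_deriv_v h hρ1 N (EuclideanSpace.single i 1, 0)
    (fun j => horm_w1 h i j)
  choose D2 hD2 h2 using fun i : Fin n => sym_deriv_v h hρ1 N (0, EuclideanSpace.single i 1)
    (fun j => horm_w2 h i j)
  have hs : ∀ i, D1 i + D2 i ≤ ∑ i, (D1 i + D2 i) := fun i =>
    Finset.single_le_sum (f := fun i => D1 i + D2 i)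
      (fun i _ => add_nonneg (hD1 i) (hD2 i)) (Finset.mem_univ i)
  refine ⟨∑ i, (D1 i + D2 i), Finset.sum_nonneg fun i _ => add_nonneg (hD1 i) (hD2 i),
    fun k y i w => ⟨(h1 i k y w).trans ?_, (h2 i k y w).trans ?_⟩⟩
  · exact mul_le_mul_of_nonneg_right (by linarith [hs i, hD2 i]) (by positivity)
  · exact mul_le_mul_of_nonneg_right (by linarith [hs i, hD1 i]) (by positivity)

lemma sym_far {n : ℕ} {m ρ δ l σ : ℝ} {a : En n → En n → En n → ℂ} (h : HormS2 m ρ δ a)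
    (hρ1 : ρ ≤ 1) (hm : m ≤ 0) (hl : 0 ≤ l) (hlρ : l < ρ) (hσ : σ ≤ 1)
    (hfs : ∀ k : ℕ, ∃ A : ℝ≥0, ∀ y, FSym (2 * 2 ^ k) A (bk a k y)) :
    ∃ K0 : ℝ, 0 ≤ K0 ∧ ∀ (k : ℕ) y p q, ((2 : ℝ) ^ k) ^ (-l) ≤ max ‖p‖ ‖q‖ →
      ‖kn (bk a k y) p q‖ ≤ K0 * ((2 : ℝ) ^ k) ^ (-σ) * (Gm p * Gm q) := by
  obtain ⟨N0, hN0⟩ := exists_nat_ge ((2 * n + 1) / (ρ - l))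
  obtain ⟨N, hNd⟩ : ∃ N : ℕ, N = max N0 (2 * n + 2) := ⟨_, rfl⟩
  have hN2 : 2 * n + 2 ≤ N := by rw [hNd]; exact le_max_right _ _
  have hN : (2 * n + 1) ≤ (ρ - l) * N := by
    have h1 : (N0 : ℝ) ≤ N := by rw [hNd]; exact_mod_cast le_max_left _ _
    have h2 := hN0.trans h1
    rw [div_le_iff₀ (by linarith)] at h2
    linarith
  obtain ⟨D, hD, hder⟩ := sym_deriv h hρ1 N
  obtain ⟨V, hV⟩ : ∃ V : ℝ, V = (volume (Metric.ball (0 : En n) 1)).toReal := ⟨_, rfl⟩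
  have hV0 : 0 ≤ V := by rw [hV]; exact ENNReal.toReal_nonneg
  refine ⟨2 ^ (2 * n + 2) * n ^ N * (2 ^ n * V) ^ 2 * D, by positivity, fun k y p q hpq => ?_⟩
  obtain ⟨lam, hlam⟩ : ∃ lam : ℝ, lam = 2 ^ k := ⟨_, rfl⟩
  have hl1 : 1 ≤ lam := by rw [hlam]; exact one_le_pow₀ (by norm_num)
  have hl0 : 0 < lam := by linarith
  obtain ⟨A, hA⟩ := hfs k
  have hA' := hA y
  rw [← hlam] at hpq hA' ⊢
  have := kn_far hA' (bk_contDiff h k y) (fun i w => (hder k y i w).1)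
    (fun i w => (hder k y i w).2) hN2 (by positivity) (L := lam ^ (-l)) (by positivity)
    (Real.rpow_le_one_of_one_le_of_nonpos hl1 (by linarith)) p q hpq
  refine this.trans (mul_le_mul_of_nonneg_right ?_ (mul_nonneg (Gm_nonneg _) (Gm_nonneg _)))
  rw [Measure.addHaar_closedBall _ _ (by positivity), ENNReal.toReal_mul, ← hV,
    ENNReal.toReal_ofReal (by positivity), ← hlam]
  have e1 : Module.finrank ℝ (En n) = n := by simp
  rw [e1]
  have e2 : ((2 * lam) ^ n * V) ^ 2 * (D * lam ^ (m - ρ * N) * ((lam ^ (-l)) ^ N)⁻¹) =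
      (2 ^ n * V) ^ 2 * D * (lam ^ ((2 * n : ℝ) + (m - ρ * N) + l * N)) := by
    have : ((lam ^ (-l)) ^ N)⁻¹ = lam ^ (l * N) := by
      rw [← Real.rpow_natCast, ← Real.rpow_mul hl0.le, ← Real.rpow_neg hl0.le]; congr 1; ring
    rw [this, Real.rpow_add hl0, Real.rpow_add hl0]
    have : lam ^ (2 * n : ℝ) = (lam ^ n) ^ 2 := by
      rw [← pow_mul, ← Real.rpow_natCast]; congr 1; push_cast; ring
    rw [this]; ring
  calc _ = 2 ^ (2 * n + 2) * n ^ N * (((2 * lam) ^ n * V) ^ 2 *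
        (D * lam ^ (m - ρ * N) * ((lam ^ (-l)) ^ N)⁻¹)) := by ring
    _ = 2 ^ (2 * n + 2) * n ^ N * ((2 ^ n * V) ^ 2 * D *
        (lam ^ ((2 * n : ℝ) + (m - ρ * N) + l * N))) := by rw [e2]
    _ = 2 ^ (2 * n + 2) * n ^ N * (2 ^ n * V) ^ 2 * D *
        (lam ^ ((2 * n : ℝ) + (m - ρ * N) + l * N)) := by ring
    _ ≤ _ := by
      refine mul_le_mul_of_nonneg_left ?_ (by positivity)
      refine Real.rpow_le_rpow_of_exponent_le hl1 ?_
      linarith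


lemma exp_q {q : ℝ≥0∞} (hq : 1 ≤ q) : ∃ p : ℝ, 1 ≤ p ∧ p ≤ 2 ∧ ENNReal.ofReal p ≤ q ∧
    1 / p = max (1 / 2) q⁻¹.toReal ∧ 0 ≤ q⁻¹.toReal ∧ q⁻¹.toReal ≤ 1 := by
  have h0 : 0 ≤ q⁻¹.toReal := ENNReal.toReal_nonneg
  have h1 : q⁻¹.toReal ≤ 1 := by
    have : q⁻¹ ≤ 1 := ENNReal.inv_le_one.mpr hq
    simpa using ENNReal.toReal_mono ENNReal.one_ne_top this
  have hM : (1 / 2 : ℝ) ≤ max (1 / 2) q⁻¹.toReal := le_max_left _ _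
  have hM1 : max (1 / 2) q⁻¹.toReal ≤ 1 := max_le (by norm_num) h1
  have hM0 : 0 < max (1 / 2) q⁻¹.toReal := by linarith
  refine ⟨(max (1 / 2) q⁻¹.toReal)⁻¹, (one_le_inv₀ hM0).mpr hM1, ?_, ?_, by simp, h0, h1⟩
  · rw [inv_le_comm₀ hM0 (by norm_num)]; linarith
  · have : q⁻¹ ≤ ENNReal.ofReal (max (1 / 2) q⁻¹.toReal) := by
      have ht : q⁻¹ ≠ ⊤ := by
        simp only [ne_eq, ENNReal.inv_eq_top]; rintro rfl; simp at hq
      rw [← ENNReal.ofReal_toReal ht]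
      exact ENNReal.ofReal_le_ofReal (by rw [ENNReal.ofReal_toReal ht]; exact le_max_right _ _)
    rw [ENNReal.ofReal_inv_of_pos hM0]
    exact ENNReal.inv_le_iff_inv_le.mp this

lemma min_inv {q₁ q₂ : ℝ≥0∞} (hq₁ : 1 ≤ q₁) (hq₂ : 1 ≤ q₂) :
    (min 2 (min q₁ q₂))⁻¹.toReal = max (1 / 2) (max q₁⁻¹.toReal q₂⁻¹.toReal) := by
  have t : ∀ {q : ℝ≥0∞}, 1 ≤ q → q⁻¹ ≠ ⊤ := by
    intro q hq; simp only [ne_eq, ENNReal.inv_eq_top]; rintro rfl; simp at hq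
  have anti : Antitone (fun x : ℝ≥0∞ => x⁻¹) := fun x y h => ENNReal.inv_le_inv.mpr h
  have e : (min 2 (min q₁ q₂))⁻¹ = max 2⁻¹ (max q₁⁻¹ q₂⁻¹) := by
    rw [anti.map_min, anti.map_min]
  rw [e, ENNReal.toReal_max (by simp) (by simp [t hq₁, t hq₂]),
    ENNReal.toReal_max (t hq₁) (t hq₂)]
  simp

lemma arith_core {n : ℕ} {m ρ δ u1 u2 r : ℝ} (hr : 0 < r) (hru : 1 / r = u1 + u2)
    (hu1 : 0 ≤ u1) (hu11 : u1 ≤ 1) (hu2 : 0 ≤ u2) (hu21 : u2 ≤ 1) (hρ0 : 0 < ρ) (hρ1 : ρ ≤ 1)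
    (hm : m < (n : ℝ) * (ρ - 1) * (max |1 / 2 - u1| |1 / 2 - u2| + max (1 / 2) (max u1 u2)) +
      (n : ℝ) * min (ρ - δ) 0 / 2) :
    m ≤ 0 ∧ ∃ l σ : ℝ, 0 ≤ l ∧ l < ρ ∧ 0 < σ ∧ σ ≤ 1 ∧ ∀ X1 X2 s e : ℝ, X1 = max (1 / 2) u1 →
      X2 = max (1 / 2) u2 → s = max ρ δ →
      e = 2 * m + (n * (2 * X1 - 1) - l * n * (2 * X1 - 2 * u1)) +
        (n * (2 * X2 - 1) - l * n * (2 * X2 - 2 * u2)) →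
      (r ≤ 2 ∧ (e + (s - l) * n + n) * (r / 2) - l * n * (1 - r / 2) ≤ -σ * r) ∨
      (2 < r ∧ (e + 2 * n) * ((r - 2) / 2) + (e + (s - l) * n + n) ≤ -σ * r) := by
  obtain ⟨K, hK⟩ : ∃ K, K = max |1 / 2 - u1| |1 / 2 - u2| + max (1 / 2) (max u1 u2) := ⟨_, rfl⟩
  obtain ⟨M, hM⟩ : ∃ M, M = max |1 / 2 - u1| |1 / 2 - u2| := ⟨_, rfl⟩
  obtain ⟨Y, hY⟩ : ∃ Y, Y = max (1 / 2) (max u1 u2) := ⟨_, rfl⟩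
  have hM1 : |1 / 2 - u1| ≤ M := hM ▸ le_max_left _ _
  have hM2 : |1 / 2 - u2| ≤ M := hM ▸ le_max_right _ _
  have hM3 : M ≤ 1 / 2 := by
    rw [hM]; exact max_le (abs_le.mpr ⟨by linarith, by linarith⟩) (abs_le.mpr ⟨by linarith, by linarith⟩)
  have hY1 : 1 / 2 ≤ Y := hY ▸ le_max_left _ _
  have hY2 : u1 ≤ Y := hY ▸ (le_max_left _ _).trans (le_max_right _ _)
  have hY3 : u2 ≤ Y := hY ▸ (le_max_right _ _).trans (le_max_right _ _)
  have hY4 : Y ≤ 1 := by rw [hY]; exact max_le (by norm_num) (max_le hu11 hu21)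
  obtain ⟨a1, a2⟩ := abs_le.mp hM1
  obtain ⟨a3, a4⟩ := abs_le.mp hM2
  rw [← hK] at hm
  rw [← hM, ← hY] at hK
  obtain ⟨mn, hmn⟩ : ∃ mn, mn = min (ρ - δ) 0 := ⟨_, rfl⟩
  have hmn0 : mn ≤ 0 := hmn ▸ min_le_right _ _
  rw [← hmn] at hm
  have hn : (0 : ℝ) ≤ n := Nat.cast_nonneg n
  have hm0 : m ≤ 0 := by
    have h1 : (n : ℝ) * (1 - ρ) * K ≥ 0 := mul_nonneg (mul_nonneg hn (by linarith)) (by linarith)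
    have h2 : (n : ℝ) * mn ≤ 0 := mul_nonpos_of_nonneg_of_nonpos hn hmn0
    linarith
  refine ⟨hm0, ?_⟩
  obtain ⟨gap, hgap⟩ : ∃ gap, gap = (n : ℝ) * (ρ - 1) * K + n * mn / 2 - m := ⟨_, rfl⟩
  have hgap0 : 0 < gap := by rw [hgap]; linarith
  obtain ⟨ε, hε⟩ : ∃ ε, ε = min ρ (gap / (4 * n + 4)) := ⟨_, rfl⟩
  have hε0 : 0 < ε := by rw [hε]; exact lt_min hρ0 (by positivity)
  have hε1 : ε ≤ ρ := hε ▸ min_le_left _ _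
  have hε2 : ε * (4 * n + 4) ≤ gap := by
    have : ε ≤ gap / (4 * n + 4) := hε ▸ min_le_right _ _
    rwa [le_div_iff₀ (by positivity)] at this
  refine ⟨ρ - ε, min 1 (gap / 2), by linarith, by linarith, lt_min one_pos (by linarith),
    min_le_left _ _, ?_⟩
  obtain ⟨σ, hσ⟩ : ∃ σ, σ = min 1 (gap / 2) := ⟨_, rfl⟩
  rw [← hσ]
  have hσ2 : σ ≤ gap / 2 := hσ ▸ min_le_right _ _
  intro X1 X2 s e hX1 hX2 hs he
  have hsm : s = ρ - mn := by
    rw [hs, hmn]; rcases le_total ρ δ with h | h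
    · rw [max_eq_right h, min_eq_left (by linarith)]; ring
    · rw [max_eq_left h, min_eq_right (by linarith)]; ring
  obtain ⟨l, hl⟩ : ∃ l, l = ρ - ε := ⟨_, rfl⟩
  rw [← hl] at he ⊢
  have hur : r * (u1 + u2) = 1 := by rw [← hru]; field_simp
  -- common estimate
  have com : ∀ P : ℝ, P ≤ K → m + n * (1 - l) * P + n * (s - l) / 2 ≤ -σ := by
    intro P hP
    have h1 : n * (1 - l) * P ≤ n * (1 - l) * K :=
      mul_le_mul_of_nonneg_left hP (mul_nonneg hn (by linarith))
    have h2 : m + n * (1 - l) * K + n * (s - l) / 2 = -gap + n * ε * (K + 1 / 2) := by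
      rw [hgap, hsm, hl]; ring
    have h3 : n * ε * (K + 1 / 2) ≤ n * ε * 2 :=
      mul_le_mul_of_nonneg_left (by linarith) (mul_nonneg hn hε0.le)
    nlinarith
  rcases le_or_gt r 2 with hr2 | hr2
  · left
    refine ⟨hr2, ?_⟩
    have hP : X1 + X2 - 1 / 2 ≤ K := by
      rw [hX1, hX2, hK]
      rcases max_cases (1 / 2) u1 with ⟨h1, _⟩ | ⟨h1, _⟩ <;>
        rcases max_cases (1 / 2) u2 with ⟨h2, _⟩ | ⟨h2, _⟩ <;> rw [h1, h2] <;> linarith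
    have := mul_le_mul_of_nonneg_left (com _ hP) hr.le
    have e1 : (e + (s - l) * n + n) * (r / 2) - l * n * (1 - r / 2) =
        r * (m + n * (1 - l) * (X1 + X2 - 1 / 2) + n * (s - l) / 2) +
          l * n * (r * (u1 + u2) - 1) := by rw [he]; ring
    rw [e1, hur]; linarith
  · right
    refine ⟨hr2, ?_⟩
    have hu : u1 + u2 < 1 / 2 := by rw [← hru]; exact one_div_lt_one_div_of_lt (by norm_num) hr2
    have x1 : X1 = 1 / 2 := by rw [hX1]; exact max_eq_left (by linarith)
    have x2 : X2 = 1 / 2 := by rw [hX2]; exact max_eq_left (by linarith)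
    have hP : 1 - (u1 + u2) ≤ K := by linarith
    have h4 : n * (s - l) * (u1 + u2) ≤ n * (s - l) * (1 / 2) :=
      mul_le_mul_of_nonneg_left hu.le (mul_nonneg hn (by linarith))
    have := mul_le_mul_of_nonneg_left (com _ hP) hr.le
    have h5 := mul_le_mul_of_nonneg_left h4 hr.le
    have e1 : (e + 2 * n) * ((r - 2) / 2) + (e + (s - l) * n + n) =
        r * (m + n * (1 - l) * (1 - (u1 + u2))) + r * (n * (s - l) * (u1 + u2)) +
        (n * (s - l) - n) * (1 - r * (u1 + u2)) := by
      rw [he, x1, x2]; ring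
    rw [e1, hur]
    have e3 : r * (m + n * (1 - l) * (1 - (u1 + u2)) + n * (s - l) / 2) =
        r * (m + n * (1 - l) * (1 - (u1 + u2))) + r * (n * (s - l) * (1 / 2)) := by ring
    rw [e3] at this
    linarith

lemma scale_all {n : ℕ} (r q₁ q₂ : ℝ≥0∞) (hq₁ : 1 ≤ q₁) (hq₂ : 1 ≤ q₂)
    (hr0 : 0 < r) (hr1 : r < ⊤) (hrel : r⁻¹ = q₁⁻¹ + q₂⁻¹)
    (m ρ δ : ℝ) (hρ0 : 0 < ρ) (hρ1 : ρ ≤ 1)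
    (hm : m < (n : ℝ) * (ρ - 1) *
        (max |1 / 2 - q₁⁻¹.toReal| |1 / 2 - q₂⁻¹.toReal| +
          (min 2 (min q₁ q₂))⁻¹.toReal) +
      (n : ℝ) * min (ρ - δ) 0 / 2)
    (a : En n → En n → En n → ℂ) (ha : HormS2 m ρ δ a) :
    m ≤ 0 ∧ ∃ σ : ℝ, 0 < σ ∧ (∀ k : ℕ, ∃ A : ℝ≥0, ∀ y, FSym (2 * 2 ^ k) A (bk a k y)) ∧
      ∃ C : ℝ≥0∞, C ≠ ⊤ ∧ ∀ k : ℕ, ∀ f g : En n → ℂ, Integrable f → Integrable g →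
      Measurable f → Measurable g →
      ∫⁻ x, ‖fz (bk a k x) (ft f) (ft g) x‖ₑ ^ r.toReal ≤
        C * ENNReal.ofReal ((2 : ℝ) ^ k) ^ (-σ * r.toReal) *
          (eLpNorm f q₁ volume * eLpNorm g q₂ volume) ^ r.toReal := by
  obtain ⟨p1, hp11, hp12, hp1q, hp1X, hu10, hu11⟩ := exp_q hq₁
  obtain ⟨p2, hp21, hp22, hp2q, hp2X, hu20, hu21⟩ := exp_q hq₂
  rw [min_inv hq₁ hq₂] at hm
  have hr : 0 < r.toReal := ENNReal.toReal_pos hr0.ne' hr1.ne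
  have t : ∀ {q : ℝ≥0∞}, 1 ≤ q → q⁻¹ ≠ ⊤ := by
    intro q hq; simp only [ne_eq, ENNReal.inv_eq_top]; rintro rfl; simp at hq
  have hru : 1 / r.toReal = q₁⁻¹.toReal + q₂⁻¹.toReal := by
    rw [← ENNReal.toReal_add (t hq₁) (t hq₂), ← hrel, ENNReal.toReal_inv, one_div]
  obtain ⟨hm0, l, σ, hl0, hlρ, hσ0, hσ1, hE⟩ :=
    arith_core hr hru hu10 hu11 hu20 hu21 hρ0 hρ1 hm
  obtain ⟨A0, hA0, hX⟩ := sym_xrep (s := max ρ δ) ha (le_max_right _ _)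
  have hfs : ∀ k : ℕ, ∃ A : ℝ≥0, ∀ y, FSym (2 * 2 ^ k) A (bk a k y) := by
    intro k; obtain ⟨d, _, h2⟩ := hX k; exact ⟨_, h2⟩
  obtain ⟨K0, hK0, hfar⟩ := sym_far ha hρ1 hm0 hl0 hlρ hσ1 hfs
  refine ⟨hm0, σ, hσ0, hfs, ?_⟩
  have e1 : 2 / p1 = 2 * (1 / p1) := by ring
  have e2 : 2 / p2 = 2 * (1 / p2) := by ring
  obtain ⟨C, hC, hS⟩ := single_scale (n := n) m (max ρ δ) l σ r.toReal p1 p2 q₁ q₂ hr hq₁ hq₂ hru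
    hp11 hp12 hp21 hp22 hp1q hp2q (hlρ.le.trans (le_max_left _ _)) _ rfl
    (by rw [e1, e2]; exact hE (1 / p1) (1 / p2) _ _ hp1X hp2X rfl rfl)
    (ENNReal.ofReal A0) ENNReal.ofReal_ne_top K0 hK0
  refine ⟨C, hC, fun k f g hf hg hfm hgm => ?_⟩
  obtain ⟨d, h1, h2⟩ := hX k
  refine hS ((2 : ℝ) ^ k) _ _ d (one_le_pow₀ (by norm_num)) h1 h2 ?_ (fun y p q hpq => hfar k y p q hpq)
    f g hf hg hfm hgm
  rw [ENNReal.ofReal_rpow_of_pos (by positivity), ← ENNReal.ofReal_mul hA0]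
  rfl


lemma ft_schwartz {n : ℕ} (f : 𝓢(En n, ℂ)) : Integrable (ft (⇑f)) := by
  have h1 : Integrable (fun ξ : En n => (FourierTransform.fourier f : 𝓢(En n, ℂ)) ξ) :=
    SchwartzMap.integrable _
  have h2 := h1.comp_smul (R := (2 * π)⁻¹) (by positivity)
  refine h2.congr (Filter.Eventually.of_forall fun ξ => ?_)
  show (FourierTransform.fourier f : 𝓢(En n, ℂ)) ((2 * π)⁻¹ • ξ) = ft f ξ
  rw [SchwartzMap.fourier_coe, Real.fourier_eq']
  unfold ft
  congr 1
  funext y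
  rw [inner_smul_right, smul_eq_mul]
  congr 2
  have : (π : ℂ) ≠ 0 := by exact_mod_cast Real.pi_ne_zero
  push_cast
  field_simp

lemma bfio_le {n : ℕ} {m ρ δ : ℝ} {a : En n → En n → En n → ℂ} (ha : HormS2 m ρ δ a) (hm : m ≤ 0)
    (f g : 𝓢(En n, ℂ)) (x : En n) :
    ‖bfio a (fun x ξ => ⟪x, ξ⟫) (fun x η => ⟪x, η⟫) (⇑f) (⇑g) x‖ₑ ≤
      ∑' k : ℕ, ‖fz (bk a k x) (ft f) (ft g) x‖ₑ := by
  obtain ⟨F, hF⟩ : ∃ F : En n × En n → ℂ, F = fun w => a x w.1 w.2 *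
      cexp (I * ((⟪x, w.1⟫ + ⟪x, w.2⟫ : ℝ) : ℂ)) * ft f w.1 * ft g w.2 := ⟨_, rfl⟩
  have hac : Continuous (fun w : En n × En n => a x w.1 w.2) :=
    ha.1.continuous.comp (by fun_prop : Continuous fun w : En n × En n => (x, w))
  have hexp : Continuous fun w : En n × En n => cexp (I * ((⟪x, w.1⟫ + ⟪x, w.2⟫ : ℝ) : ℂ)) := by
    fun_prop
  obtain ⟨C, hC0, hC⟩ := horm_x ha []
  have hab : ∀ w : En n × En n, ‖a x w.1 w.2‖ ≤ C := by
    intro w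
    have := hC (List.nil_sublist _) x w
    simp only [List.foldr_nil, List.length_nil, Nat.cast_zero, mul_zero, add_zero] at this
    refine this.trans (mul_le_of_le_one_right hC0 ?_)
    refine Real.rpow_le_one_of_one_le_of_nonpos ?_ hm
    linarith [norm_nonneg w.1, norm_nonneg w.2]
  have hFG : Integrable (fun w : En n × En n => ft f w.1 * ft g w.2) :=
    (ft_schwartz f).mul_prod (ft_schwartz g)
  have hFi : Integrable F := by
    have hprod : Continuous fun w : En n × En n => a x w.1 w.2 *
        cexp (I * ((⟪x, w.1⟫ + ⟪x, w.2⟫ : ℝ) : ℂ)) := hac.mul hexp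
    have := hFG.bdd_mul (c := C) hprod.aestronglyMeasurable
      (Filter.Eventually.of_forall fun w => by
        rw [norm_mul, norm_cexp_I, mul_one]; exact hab w)
    refine this.congr (Filter.Eventually.of_forall fun w => ?_)
    simp only [hF]; ring
  have hk : ∀ k : ℕ, fz (bk a k x) (ft f) (ft g) x = ∫ w, cut k w * F w := by
    intro k
    unfold fz bk
    congr 1
    funext w
    simp only [hF]; ring
  have hki : ∀ k : ℕ, Integrable fun w => cut k w * F w := fun k =>
    hFi.bdd_mul (c := 2) (cut_contDiff k).continuous.aestronglyMeasurable
      (Filter.Eventually.of_forall fun w => cut_norm k w)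
  have hsum : ∀ K : ℕ, ∑ k ∈ Finset.range (K + 1), fz (bk a k x) (ft f) (ft g) x =
      ∫ w, ph (((2 : ℝ) ^ K)⁻¹ • w) * F w := by
    intro K
    simp only [hk]
    rw [← integral_finsetSum _ fun k _ => hki k]
    congr 1
    funext w
    rw [← Finset.sum_mul, cut_sum]
  have hlim : Filter.Tendsto (fun K : ℕ => ∫ w, ph (((2 : ℝ) ^ K)⁻¹ • w) * F w) Filter.atTop
      (nhds (∫ w, F w)) := by
    refine tendsto_integral_of_dominated_convergence (fun w => ‖F w‖) ?_ hFi.norm ?_ ?_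
    · intro K
      have : Continuous fun w : En n × En n => ph (((2 : ℝ) ^ K)⁻¹ • w) :=
        ph_contDiff.continuous.comp
          (by fun_prop : Continuous fun w : En n × En n => ((2 : ℝ) ^ K)⁻¹ • w)
      exact this.aestronglyMeasurable.mul hFi.aestronglyMeasurable
    · intro K
      refine Filter.Eventually.of_forall fun w => ?_
      rw [norm_mul]
      exact mul_le_of_le_one_left (norm_nonneg _) (ph_norm _)
    · refine Filter.Eventually.of_forall fun w => ?_
      refine tendsto_const_nhds.congr' ?_
      have : Filter.Tendsto (fun K : ℕ => (2 : ℝ) ^ K) Filter.atTop Filter.atTop :=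
        tendsto_pow_atTop_atTop_of_one_lt (by norm_num)
      filter_upwards [this.eventually_ge_atTop ‖w‖] with K hK
      rw [ph_one, one_mul]
      rw [norm_smul, Real.norm_eq_abs, abs_of_nonneg (by positivity),
        inv_mul_le_iff₀ (by positivity)]
      linarith
  have hb : bfio a (fun x ξ => ⟪x, ξ⟫) (fun x η => ⟪x, η⟫) (⇑f) (⇑g) x = ∫ w, F w := by
    unfold bfio; rw [hF]
  rw [hb]
  have := (hlim.enorm)
  refine le_of_tendsto this (Filter.Eventually.of_forall fun K => ?_)
  show ‖∫ w, ph (((2 : ℝ) ^ K)⁻¹ • w) * F w‖ₑ ≤ _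
  rw [← hsum]
  exact (enorm_sum_le _ _).trans (ENNReal.sum_le_tsum _)

lemma sum_scales {n : ℕ} {r σ : ℝ} (hr : 0 < r) (hσ : 0 < σ) : ∃ C2 : ℝ≥0∞, C2 ≠ ⊤ ∧
    ∀ (T : En n → ℝ≥0∞) (Tk : ℕ → En n → ℝ≥0∞) (C X : ℝ≥0∞), (∀ k, Measurable (Tk k)) →
      (∀ x, T x ≤ ∑' k, Tk k x) →
      (∀ k : ℕ, ∫⁻ x, Tk k x ^ r ≤ C * ENNReal.ofReal ((2 : ℝ) ^ k) ^ (-σ * r) * X) →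
      ∫⁻ x, T x ^ r ≤ C2 * (C * X) := by
  obtain ⟨θ, hθ⟩ : ∃ θ : ℝ≥0∞, θ = (2 : ℝ≥0∞) ^ (-(σ / 2)) := ⟨_, rfl⟩
  have hθ1 : θ < 1 := by
    rw [hθ]; exact ENNReal.rpow_lt_one_of_one_lt_of_neg (by norm_num) (by linarith)
  have hθ0 : θ ≠ 0 := by rw [hθ]; simp [ENNReal.rpow_eq_zero_iff]
  have hθt : θ ≠ ⊤ := (hθ1.trans ENNReal.one_lt_top).ne
  have hθr : θ ^ r < 1 := ENNReal.rpow_lt_one hθ1 hr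
  refine ⟨((1 - θ)⁻¹) ^ r * (1 - θ ^ r)⁻¹, ?_, ?_⟩
  · refine ENNReal.mul_ne_top (ENNReal.rpow_ne_top_of_nonneg hr.le ?_) ?_
    · simp only [ne_eq, ENNReal.inv_eq_top]; exact (tsub_pos_of_lt hθ1).ne'
    · simp only [ne_eq, ENNReal.inv_eq_top]; exact (tsub_pos_of_lt hθr).ne'
  intro T Tk C X hTm hT hTk
  have hpw : ∀ x, T x ^ r ≤ ((1 - θ)⁻¹) ^ r * ∑' k, ((θ ^ k)⁻¹) ^ r * Tk k x ^ r := by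
    intro x
    obtain ⟨S, hS⟩ : ∃ S : ℝ≥0∞, S = ∑' k, ((θ ^ k)⁻¹) ^ r * Tk k x ^ r := ⟨_, rfl⟩
    have h1 : ∀ k, Tk k x ≤ θ ^ k * S ^ (1 / r) := by
      intro k
      have h2 : ((θ ^ k)⁻¹) ^ r * Tk k x ^ r ≤ S := by
        rw [hS]; exact ENNReal.le_tsum (f := fun k => ((θ ^ k)⁻¹) ^ r * Tk k x ^ r) k
      rw [← ENNReal.mul_rpow_of_nonneg _ _ hr.le] at h2
      have h3 := ENNReal.rpow_le_rpow h2 (by positivity : 0 ≤ 1 / r)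
      rw [← ENNReal.rpow_mul, mul_one_div_cancel hr.ne', ENNReal.rpow_one] at h3
      calc Tk k x = θ ^ k * ((θ ^ k)⁻¹ * Tk k x) := by
            rw [← mul_assoc, ENNReal.mul_inv_cancel (pow_ne_zero _ hθ0) (ENNReal.pow_ne_top hθt),
              one_mul]
        _ ≤ _ := mul_le_mul' le_rfl h3
    have h4 : T x ≤ (1 - θ)⁻¹ * S ^ (1 / r) := by
      refine (hT x).trans ((ENNReal.tsum_le_tsum h1).trans (le_of_eq ?_))
      rw [ENNReal.tsum_mul_right, ENNReal.tsum_geometric]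
    have h5 := ENNReal.rpow_le_rpow h4 hr.le
    rw [ENNReal.mul_rpow_of_nonneg _ _ hr.le, ← ENNReal.rpow_mul, one_div_mul_cancel hr.ne',
      ENNReal.rpow_one] at h5
    rw [← hS]; exact h5
  have hmk : ∀ k, Measurable fun x => ((θ ^ k)⁻¹) ^ r * Tk k x ^ r := fun k =>
    ((hTm k).pow_const r).const_mul _
  calc ∫⁻ x, T x ^ r ≤ ∫⁻ x, ((1 - θ)⁻¹) ^ r * ∑' k, ((θ ^ k)⁻¹) ^ r * Tk k x ^ r :=
        lintegral_mono hpw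
    _ = ((1 - θ)⁻¹) ^ r * ∑' k, ((θ ^ k)⁻¹) ^ r * ∫⁻ x, Tk k x ^ r := by
        rw [lintegral_const_mul _ (Measurable.tsum hmk),
          lintegral_tsum fun k => (hmk k).aemeasurable]
        congr 1
        refine tsum_congr fun k => ?_
        rw [lintegral_const_mul _ ((hTm k).pow_const r)]
    _ ≤ ((1 - θ)⁻¹) ^ r * ∑' k : ℕ, (θ ^ r) ^ k * (C * X) := by
        refine mul_le_mul' le_rfl (ENNReal.tsum_le_tsum fun k => ?_)
        refine (mul_le_mul' le_rfl (hTk k)).trans (le_of_eq ?_)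
        have e : ENNReal.ofReal ((2 : ℝ) ^ k) ^ (-σ * r) = (θ ^ k) ^ r * (θ ^ k) ^ r := by
          rw [ENNReal.ofReal_pow (by norm_num), hθ]
          simp only [← ENNReal.rpow_natCast, ← ENNReal.rpow_mul]
          rw [← ENNReal.rpow_add _ _ (by simp) (by simp)]
          simp only [ENNReal.ofReal_ofNat]
          congr 1; ring
        have hz : (θ ^ k) ^ r ≠ 0 := by simp [ENNReal.rpow_eq_zero_iff, hθ0, hθt]
        have ht : (θ ^ k) ^ r ≠ ⊤ := ENNReal.rpow_ne_top_of_nonneg hr.le (ENNReal.pow_ne_top hθt)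
        have e2 : (θ ^ r) ^ k = (θ ^ k) ^ r := by
          simp only [← ENNReal.rpow_natCast, ← ENNReal.rpow_mul]; rw [mul_comm]
        rw [e, e2, ENNReal.inv_rpow]
        calc ((θ ^ k) ^ r)⁻¹ * (C * ((θ ^ k) ^ r * (θ ^ k) ^ r) * X)
            = (((θ ^ k) ^ r)⁻¹ * (θ ^ k) ^ r) * ((θ ^ k) ^ r * (C * X)) := by ring
          _ = _ := by rw [ENNReal.inv_mul_cancel hz ht, one_mul]
    _ = _ := by
        rw [ENNReal.tsum_mul_right, ENNReal.tsum_geometric, mul_assoc]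

/-- Theorem 5.19: boundedness of smooth bilinear pseudodifferential
operators in the Hörmander classes. -/
theorem statement18 {n : ℕ} (r q₁ q₂ : ℝ≥0∞) (hq₁ : 1 ≤ q₁) (hq₂ : 1 ≤ q₂)
    (hr0 : 0 < r) (hr1 : r < ⊤) (hrel : r⁻¹ = q₁⁻¹ + q₂⁻¹)
    (m ρ δ : ℝ) (hρ0 : 0 < ρ) (hρ1 : ρ ≤ 1) (hδ0 : 0 < δ) (hδ1 : δ ≤ 1) (hδ : δ < 1)
    (hm : m < (n : ℝ) * (ρ - 1) *
        (max |1 / 2 - q₁⁻¹.toReal| |1 / 2 - q₂⁻¹.toReal| +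
          (min 2 (min q₁ q₂))⁻¹.toReal) +
      (n : ℝ) * min (ρ - δ) 0 / 2)
    (a : En n → En n → En n → ℂ) (ha : HormS2 m ρ δ a) :
    ∃ C : ℝ, 0 < C ∧ ∀ f g : 𝓢(En n, ℂ),
      eLpNorm (bfio a (fun x ξ => ⟪x, ξ⟫) (fun x η => ⟪x, η⟫) (⇑f) (⇑g)) r volume ≤
        ENNReal.ofReal C * eLpNorm (⇑f) q₁ volume * eLpNorm (⇑g) q₂ volume := by
  obtain ⟨hm0, σ, hσ, hfs, C, hC, hS⟩ :=
    scale_all r q₁ q₂ hq₁ hq₂ hr0 hr1 hrel m ρ δ hρ0 hρ1 hm a ha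
  have hr : 0 < r.toReal := ENNReal.toReal_pos hr0.ne' hr1.ne
  obtain ⟨C2, hC2, hsum⟩ := sum_scales (n := n) hr hσ
  obtain ⟨B, hB⟩ : ∃ B : ℝ≥0∞, B = (C2 * C) ^ (1 / r.toReal) := ⟨_, rfl⟩
  have hBt : B ≠ ⊤ := by
    rw [hB]; exact ENNReal.rpow_ne_top_of_nonneg (by positivity) (ENNReal.mul_ne_top hC2 hC)
  refine ⟨B.toReal + 1, by positivity, fun f g => ?_⟩
  have hfi : Integrable (⇑f) := f.integrable
  have hgi : Integrable (⇑g) := g.integrable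
  have hmeas : ∀ k : ℕ, Measurable fun x => ‖fz (bk a k x) (ft f) (ft g) x‖ₑ := by
    intro k
    have hd : Continuous fun p : En n × (En n × En n) => bk a k p.1 p.2 := by
      unfold bk
      exact ha.1.continuous.mul ((cut_contDiff k).continuous.comp continuous_snd)
    have h3 := fz_meas hd.measurable (ft_continuous hfi) (ft_continuous hgi)
    have h2 : Measurable fun x : En n => (x, x) := by fun_prop
    exact (h3.comp (f := fun x => (x, x)) h2).enorm
  have key := hsum (fun x => ‖bfio a (fun x ξ => ⟪x, ξ⟫) (fun x η => ⟪x, η⟫) (⇑f) (⇑g) x‖ₑ)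
    (fun k x => ‖fz (bk a k x) (ft f) (ft g) x‖ₑ) C _ hmeas
    (fun x => bfio_le ha hm0 f g x)
    (fun k => hS k f g hfi hgi f.continuous.measurable g.continuous.measurable)
  rw [eLpNorm_eq_lintegral_rpow_enorm_toReal hr0.ne' hr1.ne]
  have h4 := ENNReal.rpow_le_rpow key (by positivity : 0 ≤ 1 / r.toReal)
  refine h4.trans ?_
  rw [← mul_assoc, ENNReal.mul_rpow_of_nonneg _ _ (by positivity), ← ENNReal.rpow_mul,
    mul_one_div_cancel hr.ne', ENNReal.rpow_one, ← hB, mul_assoc]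
  refine mul_le_mul' ?_ le_rfl
  rw [← ENNReal.ofReal_toReal hBt]
  exact ENNReal.ofReal_le_ofReal (by rw [ENNReal.ofReal_toReal hBt]; linarith)
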